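/- Every finite simple graph with maximum degree at most 3 admits a (1,2^7)-packing edge-coloring. -/

import Mathlib

open SimpleGraph

/-- A `(1,2^k)`-packing edge-coloring encoded as a function assigning a color in
`Fin (k+1)` to each unordered pair. Color `0` is the 1-color (its class must be a
matching) and each color `i ≠ 0` is a 2-color (its class must be an induced matching). -/
def IsPackingEC {V : Type} (G : SimpleGraph V) (k : ℕ)
    (c : Sym2 V → Fin (k + 1)) : Prop :=
  (∀ a b x y : V, G.Adj a b → G.Adj x y → s(a, b) ≠ s(x, y) →
      c s(a, b) = 0 → c s(x, y) = 0 →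
      a ≠ x ∧ a ≠ y ∧ b ≠ x ∧ b ≠ y) ∧
  ∀ a b x y : V, G.Adj a b → G.Adj x y → s(a, b) ≠ s(x, y) →
      c s(a, b) = c s(x, y) → c s(a, b) ≠ 0 →
      (a ≠ x ∧ a ≠ y ∧ b ≠ x ∧ b ≠ y) ∧
      ¬G.Adj a x ∧ ¬G.Adj a y ∧ ¬G.Adj b x ∧ ¬G.Adj b y

/-- A good coloring: a `(1,2^7)`-packing edge-coloring in which every edge of the
1-color class (color `0`) has both endpoints of degree 3. -/
def GoodColoring {V : Type} (G : SimpleGraph V) (c : Sym2 V → Fin 8) : Prop :=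
  IsPackingEC G 7 c ∧
  ∀ a b : V, G.Adj a b → c s(a, b) = 0 →
    (G.neighborSet a).ncard = 3 ∧ (G.neighborSet b).ncard = 3

/-- A graph is subcubic if every vertex has degree at most 3. -/
def Subcubic {V : Type} (G : SimpleGraph V) : Prop :=
  ∀ v : V, (G.neighborSet v).ncard ≤ 3

/-- A minimal counterexample: a finite subcubic simple graph with no good coloring such
that every finite subcubic simple graph with smaller `|V| + |E|` has a good coloring. -/
def MinCounter (V : Type) [Finite V] (G : SimpleGraph V) : Prop :=
  Subcubic G ∧
  (¬∃ c : Sym2 V → Fin 8, GoodColoring G c) ∧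
  ∀ (W : Type) [Finite W] (H : SimpleGraph W), Subcubic H →
    Nat.card W + H.edgeSet.ncard < Nat.card V + G.edgeSet.ncard →
    ∃ c : Sym2 W → Fin 8, GoodColoring H c

namespace PackingEC

open scoped Classical

variable {V : Type} {G : SimpleGraph V}

/-- An involution moving vertices along edges of `G` (a matching) such that deleting the
moved edges leaves a 2-regular graph. -/
structure Frame (G : SimpleGraph V) where
  mt : V → V
  mt_mt : ∀ v, mt (mt v) = v
  adj_mt : ∀ v, mt v ≠ v → G.Adj v (mt v)
  two : ∀ v, ∃ a b, a ≠ b ∧ ∀ w, (G.Adj v w ∧ w ≠ mt v) ↔ (w = a ∨ w = b)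

namespace Frame

variable (F : Frame G)

/-- The 2-regular graph of edges outside the matching. -/
def N : SimpleGraph V where
  Adj v w := G.Adj v w ∧ w ≠ F.mt v
  symm := ⟨fun v w h => ⟨h.1.symm, fun h' => h.2 (by rw [h', F.mt_mt])⟩⟩
  loopless := ⟨fun v h => h.1.ne rfl⟩

/-- The first neighbour of `v` outside the matching. -/
noncomputable def n1 (v : V) : V := (F.two v).choose

/-- The second neighbour of `v` outside the matching. -/
noncomputable def n2 (v : V) : V := (F.two v).choose_spec.choose

theorem n1_ne_n2 (v : V) : F.n1 v ≠ F.n2 v := (F.two v).choose_spec.choose_spec.1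

theorem N_adj_iff {v w : V} : F.N.Adj v w ↔ w = F.n1 v ∨ w = F.n2 v :=
  (F.two v).choose_spec.choose_spec.2 w

theorem N_adj_n1 (v : V) : F.N.Adj v (F.n1 v) := F.N_adj_iff.2 (Or.inl rfl)

theorem N_adj_n2 (v : V) : F.N.Adj v (F.n2 v) := F.N_adj_iff.2 (Or.inr rfl)

/-- For an edge `uv` outside the matching, the other neighbour of `v` outside the matching. -/
noncomputable def oth (u v : V) : V := if F.n1 v = u then F.n2 v else F.n1 v

theorem oth_ne (u v : V) : F.oth u v ≠ u := by
  unfold oth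
  have := F.n1_ne_n2 v
  split_ifs with h
  · rw [← h]; exact this.symm
  · exact h

theorem N_adj_oth (u v : V) : F.N.Adj v (F.oth u v) := by
  unfold oth
  split_ifs
  · exact F.N_adj_n2 v
  · exact F.N_adj_n1 v

theorem eq_or_eq_oth {u v w : V} (h : F.N.Adj v u) (hw : F.N.Adj v w) :
    w = u ∨ w = F.oth u v := by
  unfold oth
  rw [F.N_adj_iff] at h hw
  split_ifs with h'
  · rw [h'] at hw; exact hw
  · rcases h with h | h
    · exact absurd h.symm h'
    · rw [h]; exact hw.symm

theorem eq_oth {u v w : V} (h : F.N.Adj v u) (hw : F.N.Adj v w) (hne : w ≠ u) :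
    w = F.oth u v := (F.eq_or_eq_oth h hw).resolve_left hne

theorem adj_cases {v w : V} (h : G.Adj v w) : w = F.mt v ∨ F.N.Adj v w := by
  by_cases h' : w = F.mt v
  · exact Or.inl h'
  · exact Or.inr ⟨h, h'⟩

theorem mt_eq_comm {v w : V} : F.mt v = w ↔ F.mt w = v :=
  ⟨fun h => by rw [← h, F.mt_mt], fun h => by rw [← h, F.mt_mt]⟩

/-- Two distinct edges outside the matching are in conflict when they are at distance at
most one. -/
def cf (e f : Sym2 V) : Prop :=
  e ∈ F.N.edgeSet ∧ f ∈ F.N.edgeSet ∧ e ≠ f ∧ ∃ u ∈ e, ∃ w ∈ f, u = w ∨ G.Adj u w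

theorem cf_symm {e f : Sym2 V} (h : F.cf e f) : F.cf f e := by
  obtain ⟨he, hf, hne, u, hu, w, hw, h⟩ := h
  exact ⟨hf, he, hne.symm, w, hw, u, hu, h.imp Eq.symm fun h => h.symm⟩

theorem cf_comm {e f : Sym2 V} : F.cf e f ↔ F.cf f e := ⟨F.cf_symm, F.cf_symm⟩

theorem cf_irrefl (e : Sym2 V) : ¬ F.cf e e := fun h => h.2.2.1 rfl

theorem cf_mk {a b x y : V} (h1 : F.N.Adj a b) (h2 : F.N.Adj x y) (hne : s(a, b) ≠ s(x, y))
    (h : a = x ∨ a = y ∨ b = x ∨ b = y ∨ G.Adj a x ∨ G.Adj a y ∨ G.Adj b x ∨ G.Adj b y) :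
    F.cf s(a, b) s(x, y) := by
  refine ⟨h1, h2, hne, ?_⟩
  have ha : a ∈ s(a, b) := Sym2.mem_mk_left _ _
  have hb : b ∈ s(a, b) := Sym2.mem_mk_right _ _
  have hx : x ∈ s(x, y) := Sym2.mem_mk_left _ _
  have hy : y ∈ s(x, y) := Sym2.mem_mk_right _ _
  rcases h with h | h | h | h | h | h | h | h
  exacts [⟨a, ha, x, hx, Or.inl h⟩, ⟨a, ha, y, hy, Or.inl h⟩, ⟨b, hb, x, hx, Or.inl h⟩,
    ⟨b, hb, y, hy, Or.inl h⟩, ⟨a, ha, x, hx, Or.inr h⟩, ⟨a, ha, y, hy, Or.inr h⟩,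
    ⟨b, hb, x, hx, Or.inr h⟩, ⟨b, hb, y, hy, Or.inr h⟩]

theorem cf_mk_iff {a b x y : V} : F.cf s(a, b) s(x, y) ↔
    F.N.Adj a b ∧ F.N.Adj x y ∧ s(a, b) ≠ s(x, y) ∧
    (a = x ∨ a = y ∨ b = x ∨ b = y ∨ G.Adj a x ∨ G.Adj a y ∨ G.Adj b x ∨ G.Adj b y) := by
  constructor
  · rintro ⟨h1, h2, h3, u, hu, w, hw, h⟩
    refine ⟨h1, h2, h3, ?_⟩
    rw [Sym2.mem_iff] at hu hw
    rcases hu with rfl | rfl <;> rcases hw with rfl | rfl <;> tauto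
  · rintro ⟨h1, h2, h3, h⟩
    exact F.cf_mk h1 h2 h3 h

/-- The two edges outside the matching at `v`. -/
noncomputable def inc (v : V) : Finset (Sym2 V) := {s(v, F.n1 v), s(v, F.n2 v)}

theorem mem_inc {v : V} {e : Sym2 V} : e ∈ F.inc v ↔ e ∈ F.N.edgeSet ∧ v ∈ e := by
  unfold inc
  rw [Finset.mem_insert, Finset.mem_singleton]
  constructor
  · rintro (rfl | rfl)
    · exact ⟨F.N_adj_n1 v, Sym2.mem_mk_left _ _⟩
    · exact ⟨F.N_adj_n2 v, Sym2.mem_mk_left _ _⟩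
  · rintro ⟨h, hv⟩
    obtain ⟨w, rfl⟩ := hv
    have h' : F.N.Adj v w := h
    rcases F.N_adj_iff.1 h' with h' | h'
    · exact Or.inl (by rw [h'])
    · exact Or.inr (by rw [h'])

theorem card_inc (v : V) : (F.inc v).card = 2 := by
  unfold inc
  rw [Finset.card_pair]
  intro h
  exact F.n1_ne_n2 v (Sym2.congr_right.1 h)

theorem inc_eq {u v : V} (h : F.N.Adj v u) : F.inc v = {s(v, u), s(v, F.oth u v)} := by
  ext e
  rw [F.mem_inc, Finset.mem_insert, Finset.mem_singleton]
  constructor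
  · rintro ⟨he, w, rfl⟩
    have he' : F.N.Adj v w := he
    rcases F.eq_or_eq_oth h he' with h' | h'
    · exact Or.inl (by rw [h'])
    · exact Or.inr (by rw [h'])
  · rintro (rfl | rfl)
    · exact ⟨h, Sym2.mem_mk_left _ _⟩
    · exact ⟨F.N_adj_oth u v, Sym2.mem_mk_left _ _⟩

/-- The edges in conflict with the edge `uv` that are reached from its end `u`. -/
noncomputable def side (u v : V) : Finset (Sym2 V) :=
  {s(u, F.oth v u), s(F.oth v u, F.oth u (F.oth v u))} ∪ F.inc (F.mt u)

theorem card_side (u v : V) : (F.side u v).card ≤ 4 := by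
  unfold side
  have h1 := Finset.card_union_le {s(u, F.oth v u), s(F.oth v u, F.oth u (F.oth v u))}
    (F.inc (F.mt u))
  have h2 := Finset.card_le_two (a := s(u, F.oth v u))
    (b := s(F.oth v u, F.oth u (F.oth v u)))
  have := F.card_inc (F.mt u)
  omega

theorem mem_side_of_cf {u v : V} {f : Sym2 V} (h : F.cf s(u, v) f) :
    f ∈ F.side u v ∨ f ∈ F.side v u := by
  obtain ⟨he, hf, hne, p, hp, q, hq, hpq⟩ := h
  have key : ∀ u v : V, F.N.Adj u v → s(u, v) ≠ f → (u = q ∨ G.Adj u q) →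
      f ∈ F.side u v ∨ f ∈ F.side v u := by
    intro u v he hne hpq
    have h0 : ∀ u v : V, F.N.Adj u v → s(u, v) ≠ f → u ∈ f → f ∈ F.side u v := by
      intro u v he hne hu
      have : f ∈ F.inc u := F.mem_inc.2 ⟨hf, hu⟩
      rw [F.inc_eq he] at this
      simp only [Finset.mem_insert, Finset.mem_singleton] at this
      rcases this with rfl | rfl
      · exact absurd rfl hne
      · simp [side]
    rcases hpq with rfl | hpq
    · exact Or.inl (h0 u v he hne hq)
    · rcases F.adj_cases hpq with rfl | hN
      · left
        have : f ∈ F.inc (F.mt u) := F.mem_inc.2 ⟨hf, hq⟩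
        simp [side, this]
      · rcases F.eq_or_eq_oth he hN with rfl | rfl
        · exact Or.inr (h0 q u he.symm (by rwa [Sym2.eq_swap]) hq)
        · left
          have : f ∈ F.inc (F.oth v u) := F.mem_inc.2 ⟨hf, hq⟩
          rw [F.inc_eq hN.symm] at this
          simp only [Finset.mem_insert, Finset.mem_singleton] at this
          rcases this with rfl | rfl
          · simp [side, Sym2.eq_swap]
          · simp [side]
  rcases Sym2.mem_iff.1 hp with rfl | rfl
  · exact key p v he hne hpq
  · exact (key p u (SimpleGraph.Adj.symm he) (by rwa [Sym2.eq_swap]) hpq).symm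

/-- The colouring `c` separates all conflicting pairs within `S`. -/
def PropOn (S : Set (Sym2 V)) (c : Sym2 V → Fin 7) : Prop :=
  ∀ e ∈ S, ∀ f ∈ S, F.cf e f → c e ≠ c f

theorem PropOn.mono {F : Frame G} {S T : Set (Sym2 V)} {c : Sym2 V → Fin 7}
    (h : F.PropOn T c) (hST : S ⊆ T) : F.PropOn S c :=
  fun e he f hf => h e (hST he) f (hST hf)

/-- The edges outside the matching have a proper conflict colouring with seven colours. -/
def Good : Prop := ∃ c : Sym2 V → Fin 7, F.PropOn F.N.edgeSet c

theorem Good.packing {F : Frame G} (h : F.Good) : ∃ c : Sym2 V → Fin 8, IsPackingEC G 7 c := by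
  obtain ⟨c, hc⟩ := h
  refine ⟨fun e => if e ∈ F.N.edgeSet then (c e).succ else 0, ?_, ?_⟩
  · intro a b x y hab hxy hne h1 h2
    have k1 : b = F.mt a := by
      by_contra hk
      have : s(a, b) ∈ F.N.edgeSet := ⟨hab, hk⟩
      simp only [this, if_true] at h1
      exact Fin.succ_ne_zero _ h1
    have k2 : y = F.mt x := by
      by_contra hk
      have : s(x, y) ∈ F.N.edgeSet := ⟨hxy, hk⟩
      simp only [this, if_true] at h2
      exact Fin.succ_ne_zero _ h2
    subst k1 k2
    refine ⟨?_, ?_, ?_, ?_⟩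
    · rintro rfl; exact hne rfl
    · rintro rfl; exact hne (by rw [F.mt_mt, Sym2.eq_swap])
    · rintro rfl; exact hne (by rw [F.mt_mt, Sym2.eq_swap])
    · intro h
      have := congrArg F.mt h
      rw [F.mt_mt, F.mt_mt] at this
      exact hne (by rw [this])
  · intro a b x y hab hxy hne h1 h2
    have k1 : s(a, b) ∈ F.N.edgeSet := by
      by_contra hk
      simp only [hk, if_false] at h2
      exact h2 rfl
    have k2 : s(x, y) ∈ F.N.edgeSet := by
      by_contra hk
      simp only [hk, if_false] at h1
      exact h2 h1
    simp only [k1, k2, if_true] at h1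
    have h3 := Fin.succ_injective _ h1
    have h4 : ¬ F.cf s(a, b) s(x, y) := fun h => hc _ k1 _ k2 h h3
    rw [cf_mk_iff] at h4
    have : F.N.Adj a b := k1
    have : F.N.Adj x y := k2
    tauto

theorem propOn_insert {S : Set (Sym2 V)} {c : Sym2 V → Fin 7} (hc : F.PropOn S c)
    {e : Sym2 V} (he : e ∉ S) {x : Fin 7} (hx : ∀ f ∈ S, F.cf e f → c f ≠ x) :
    F.PropOn (insert e S) (Function.update c e x) := by
  have hS : ∀ f ∈ S, Function.update c e x f = c f := fun f hf =>
    Function.update_of_ne (fun h : f = e => he (by rw [← h]; exact hf)) _ _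
  rintro f (rfl | hf) g (rfl | hg) hfg
  · exact absurd hfg (F.cf_irrefl _)
  · rw [Function.update_self, hS g hg]; exact (hx g hg hfg).symm
  · rw [Function.update_self, hS f hf]; exact hx f hf (F.cf_symm hfg)
  · rw [hS g hg, hS f hf]; exact hc f hf g hg hfg

variable [Fintype V]

/-- All edges in conflict with `e`. -/
noncomputable def nb (e : Sym2 V) : Finset (Sym2 V) := Finset.univ.filter (F.cf e)

theorem mem_nb {e f : Sym2 V} : f ∈ F.nb e ↔ F.cf e f := by simp [nb]

theorem nb_subset (u v : V) : F.nb s(u, v) ⊆ F.side u v ∪ F.side v u := by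
  intro f hf
  rw [Finset.mem_union]
  exact F.mem_side_of_cf (F.mem_nb.1 hf)

theorem card_nb (e : Sym2 V) : (F.nb e).card ≤ 8 := by
  induction e with | _ u v
  have h1 := Finset.card_le_card (F.nb_subset u v)
  have h2 := Finset.card_union_le (F.side u v) (F.side v u)
  have h3 := F.card_side u v
  have h4 := F.card_side v u
  omega

/-- The colours still available at `e` when `S` is coloured by `c`. -/
noncomputable def av (S : Set (Sym2 V)) (c : Sym2 V → Fin 7) (e : Sym2 V) : Finset (Fin 7) :=
  Finset.univ.filter fun x => ∀ f ∈ S, F.cf e f → c f ≠ x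

theorem mem_av {S : Set (Sym2 V)} {c : Sym2 V → Fin 7} {e : Sym2 V} {x : Fin 7} :
    x ∈ F.av S c e ↔ ∀ f ∈ S, F.cf e f → c f ≠ x := by simp [av]

theorem card_av_of_image {S : Set (Sym2 V)} {c : Sym2 V → Fin 7} {e : Sym2 V}
    (T : Finset (Fin 7)) (hT : ∀ f ∈ S, F.cf e f → c f ∈ T) :
    7 ≤ (F.av S c e).card + T.card := by
  have h : Finset.univ ⊆ F.av S c e ∪ T := by
    intro x _
    rw [Finset.mem_union, F.mem_av]
    by_contra hx
    push Not at hx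
    obtain ⟨⟨f, hf, hef, rfl⟩, hx⟩ := hx
    exact hx (hT f hf hef)
  have h1 := Finset.card_le_card h
  have h2 := Finset.card_union_le (F.av S c e) T
  simp only [Finset.card_univ, Fintype.card_fin] at h1
  omega

theorem card_av {S : Set (Sym2 V)} {c : Sym2 V → Fin 7} {e : Sym2 V}
    (K : Finset (Sym2 V)) (hK : ∀ f ∈ K, F.cf e f ∧ f ∉ S) :
    K.card ≤ (F.av S c e).card + 1 := by
  have h1 := F.card_av_of_image (S := S) (c := c) (e := e) (((F.nb e) \ K).image c) (by
    intro f hf hef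
    refine Finset.mem_image_of_mem _ ?_
    rw [Finset.mem_sdiff, F.mem_nb]
    exact ⟨hef, fun h => (hK f h).2 hf⟩)
  have h2 : (((F.nb e) \ K).image c).card ≤ ((F.nb e) \ K).card := Finset.card_image_le
  have h3 : ((F.nb e) \ K).card = (F.nb e).card - K.card :=
    Finset.card_sdiff_of_subset fun f hf => F.mem_nb.2 (hK f hf).1
  have h4 := F.card_nb e
  have h5 : K.card ≤ (F.nb e).card :=
    Finset.card_le_card fun f hf => F.mem_nb.2 (hK f hf).1
  omega

theorem exists_insert {S : Set (Sym2 V)} {c : Sym2 V → Fin 7} (hc : F.PropOn S c)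
    {e : Sym2 V} (he : e ∉ S) (h : 0 < (F.av S c e).card) :
    ∃ c' : Sym2 V → Fin 7, (∀ f, f ≠ e → c' f = c f) ∧ F.PropOn (insert e S) c' := by
  obtain ⟨x, hx⟩ := Finset.card_pos.1 h
  exact ⟨Function.update c e x, fun f hf => Function.update_of_ne hf _ _,
    F.propOn_insert hc he (F.mem_av.1 hx)⟩

/-- An edge with two redundant conflicts (uncoloured, or repeating another colour) can be
coloured. -/
theorem card_av_of_redundant {S : Set (Sym2 V)} {c : Sym2 V → Fin 7} {e f₁ f₂ : Sym2 V}
    (h₁ : F.cf e f₁) (h₂ : F.cf e f₂) (hne : f₁ ≠ f₂)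
    (r₁ : f₁ ∉ S ∨ ∃ g, F.cf e g ∧ g ≠ f₁ ∧ g ≠ f₂ ∧ c g = c f₁)
    (r₂ : f₂ ∉ S ∨ ∃ g, F.cf e g ∧ g ≠ f₁ ∧ g ≠ f₂ ∧ c g = c f₂) :
    0 < (F.av S c e).card := by
  have h1 := F.card_av_of_image (S := S) (c := c) (e := e) (((F.nb e) \ {f₁, f₂}).image c) (by
    intro f hf hef
    rw [Finset.mem_image]
    by_cases hf1 : f = f₁
    · subst hf1
      rcases r₁ with r | ⟨g, hg, hg1, hg2, hg3⟩
      · exact absurd hf r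
      · exact ⟨g, by simp [F.mem_nb, hg, hg1, hg2], hg3⟩
    by_cases hf2 : f = f₂
    · subst hf2
      rcases r₂ with r | ⟨g, hg, hg1, hg2, hg3⟩
      · exact absurd hf r
      · exact ⟨g, by simp [F.mem_nb, hg, hg1, hg2], hg3⟩
    exact ⟨f, by simp [F.mem_nb, hef, hf1, hf2], rfl⟩)
  have h2 : (((F.nb e) \ {f₁, f₂}).image c).card ≤ ((F.nb e) \ {f₁, f₂}).card :=
    Finset.card_image_le
  have hsub : ({f₁, f₂} : Finset (Sym2 V)) ⊆ F.nb e := by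
    intro f hf
    simp only [Finset.mem_insert, Finset.mem_singleton] at hf
    rcases hf with rfl | rfl
    exacts [F.mem_nb.2 h₁, F.mem_nb.2 h₂]
  have h3 := Finset.card_sdiff_of_subset hsub
  have h4 := F.card_nb e
  have h5 := Finset.card_le_card hsub
  rw [Finset.card_pair hne] at h3 h5
  omega

/-- Extending a colouring by available colours on a set `T`. -/
theorem propOn_union {S T : Set (Sym2 V)} {c g : Sym2 V → Fin 7} (hc : F.PropOn S c)
    (hST : ∀ e ∈ T, e ∉ S) (hav : ∀ e ∈ T, g e ∈ F.av S c e) (hg : F.PropOn T g) :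
    F.PropOn (S ∪ T) (fun e => if e ∈ T then g e else c e) := by
  have hS : ∀ e ∈ S, e ∉ T := fun e he hT => hST e hT he
  rintro e (he | he) f (hf | hf) hef
  · simp only [hS e he, hS f hf, if_false]; exact hc e he f hf hef
  · simp only [hS e he, hf, if_false, if_true]
    exact F.mem_av.1 (hav f hf) e he (F.cf_symm hef)
  · simp only [hS f hf, he, if_false, if_true]
    exact (F.mem_av.1 (hav e he) f hf hef).symm
  · simp only [he, hf, if_true]; exact hg e he f hf hef

end Frame

/-- Greedy colouring with seven colours along a rank function. -/
theorem greedy {α : Type} [Fintype α] (R : α → α → Prop) (hirr : ∀ e, ¬ R e e)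
    (hsymm : ∀ e f, R e f → R f e) (P : Set α) (Q : Finset α) (hPQ : ∀ e ∈ Q, e ∉ P)
    (r : α → ℕ) (hr : ∀ e ∈ Q, ∀ f ∈ Q, r e = r f → e = f)
    (c₀ : α → Fin 7) (hc₀ : ∀ e ∈ P, ∀ f ∈ P, R e f → c₀ e ≠ c₀ f)
    (hdeg : ∀ e ∈ Q, (Finset.univ.filter
      fun f => R e f ∧ (f ∈ P ∨ f ∈ Q ∧ r f < r e)).card ≤ 6) :
    ∃ c : α → Fin 7, (∀ e, e ∉ Q → c e = c₀ e) ∧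
      ∀ e, (e ∈ P ∨ e ∈ Q) → ∀ f, (f ∈ P ∨ f ∈ Q) → R e f → c e ≠ c f := by
  induction Q using Finset.induction_on_max_value r with
  | empty => exact ⟨c₀, fun _ _ => rfl, by simpa using hc₀⟩
  | insert a s has hmax ih =>
    obtain ⟨c, hcP, hc⟩ := ih (fun e he => hPQ e (Finset.mem_insert_of_mem he))
      (fun e he f hf => hr e (Finset.mem_insert_of_mem he) f (Finset.mem_insert_of_mem hf))
      (fun e he => (Finset.card_le_card (by
        intro f
        simp only [Finset.mem_filter, Finset.mem_univ, true_and, Finset.mem_insert]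
        tauto)).trans (hdeg e (Finset.mem_insert_of_mem he)))
    have hlt : ∀ x ∈ s, r x < r a := fun x hx => lt_of_le_of_ne (hmax x hx) fun h =>
      has (by rw [← hr x (Finset.mem_insert_of_mem hx) a (Finset.mem_insert_self _ _) h]
              exact hx)
    have hd := hdeg a (Finset.mem_insert_self _ _)
    set B := Finset.univ.filter
      fun f => R a f ∧ (f ∈ P ∨ f ∈ insert a s ∧ r f < r a) with hB
    obtain ⟨x, hx⟩ : ∃ x, x ∉ B.image c := by
      by_contra hcon
      push Not at hcon
      have h1 : (Finset.univ : Finset (Fin 7)) ⊆ B.image c := fun x _ => hcon x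
      have h2 := Finset.card_le_card h1
      have h3 : (B.image c).card ≤ B.card := Finset.card_image_le
      simp only [Finset.card_univ, Fintype.card_fin] at h2
      omega
    have haP : a ∉ P := hPQ a (Finset.mem_insert_self _ _)
    have hxB : ∀ f, (f ∈ P ∨ f ∈ s) → R a f → c f ≠ x := by
      intro f hf hR hcf
      refine hx (Finset.mem_image.2 ⟨f, ?_, hcf⟩)
      simp only [hB, Finset.mem_filter, Finset.mem_univ, true_and, Finset.mem_insert]
      refine ⟨hR, hf.imp id fun hf => ⟨Or.inr hf, hlt f hf⟩⟩
    have hne : ∀ f, (f ∈ P ∨ f ∈ s) → f ≠ a := by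
      rintro f (hf | hf) rfl
      exacts [haP hf, has hf]
    refine ⟨Function.update c a x, fun e he => ?_, ?_⟩
    · rw [Finset.mem_insert, not_or] at he
      rw [Function.update_of_ne he.1, hcP e he.2]
    have split : ∀ e, (e ∈ P ∨ e ∈ insert a s) → e = a ∨ (e ∈ P ∨ e ∈ s) := by
      intro e he
      rw [Finset.mem_insert] at he
      tauto
    intro e he f hf hef
    rcases split e he with h1 | h1 <;> rcases split f hf with h2 | h2
    · exact absurd (h1 ▸ h2 ▸ hef) (hirr _)
    · rw [h1] at hef ⊢
      rw [Function.update_self, Function.update_of_ne (hne f h2)]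
      exact (hxB f h2 hef).symm
    · rw [h2] at hef ⊢
      rw [Function.update_self, Function.update_of_ne (hne e h1)]
      exact hxB e h1 (hsymm _ _ hef)
    · rw [Function.update_of_ne (hne f h2), Function.update_of_ne (hne e h1)]
      exact hc e h1 f h2 hef

/-- Distances to a set, recorded only through the existence of a closer neighbour. -/
theorem exists_depth (H : SimpleGraph V) (Z : Set V) : ∃ d : V → ℕ, (∀ v ∈ Z, d v = 0) ∧
    ∀ v, v ∉ Z → (∃ z ∈ Z, H.Reachable v z) → d v ≠ 0 ∧ ∃ p, H.Adj v p ∧ d p < d v := by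
  let A : V → Set ℕ := fun v => {n | ∃ z ∈ Z, ∃ w : H.Walk v z, w.length = n}
  refine ⟨fun v => sInf (A v), fun v hv => ?_, fun v hv ⟨z, hz, ⟨w⟩⟩ => ?_⟩
  · exact Nat.sInf_eq_zero.2 (Or.inl ⟨v, hv, SimpleGraph.Walk.nil, rfl⟩)
  · have hne : (A v).Nonempty := ⟨w.length, z, hz, w, rfl⟩
    obtain ⟨z', hz', w', hw'⟩ := Nat.sInf_mem hne
    cases w' with
    | nil => exact absurd hz' hv
    | @cons _ p _ h q =>
      have h1 : sInf (A p) ≤ q.length := Nat.sInf_le ⟨z', hz', q, rfl⟩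
      rw [SimpleGraph.Walk.length_cons] at hw'
      refine ⟨?_, p, h, ?_⟩
      · show sInf (A v) ≠ 0
        omega
      · show sInf (A p) < sInf (A v)
        omega

/-- The smaller depth of the two ends of an edge. -/
def md (d : V → ℕ) : Sym2 V → ℕ :=
  Sym2.lift ⟨fun a b => min (d a) (d b), fun _ _ => min_comm _ _⟩

theorem md_mk (d : V → ℕ) (a b : V) : md d s(a, b) = min (d a) (d b) := rfl

theorem md_le {d : V → ℕ} {e : Sym2 V} {v : V} (h : v ∈ e) : md d e ≤ d v := by
  obtain ⟨w, rfl⟩ := h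
  rw [md_mk]
  exact min_le_left _ _

theorem md_ne_zero {d : V → ℕ} {e : Sym2 V} (h : ∀ v ∈ e, d v ≠ 0) : md d e ≠ 0 := by
  induction e with | _ u v
  rw [md_mk]
  have h1 := h u (Sym2.mem_mk_left _ _)
  have h2 := h v (Sym2.mem_mk_right _ _)
  omega

theorem exists_rank [Fintype V] (d : V → ℕ) : ∃ r : Sym2 V → ℕ, Function.Injective r ∧
    ∀ e f, md d f < md d e → r e < r f := by
  let D := Finset.univ.sup (md d)
  let K := Fintype.card (Sym2 V)
  let idx : Sym2 V → Fin K := Fintype.equivFin (Sym2 V)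
  have hD : ∀ e, md d e ≤ D := fun e => Finset.le_sup (Finset.mem_univ e)
  have hlt : ∀ e f, md d f < md d e →
      (D - md d e) * K + idx e < (D - md d f) * K + idx f := by
    intro e f h
    have h1 := hD e
    have h2 : D - md d e + 1 ≤ D - md d f := by omega
    have h3 := Nat.mul_le_mul_right K h2
    have h4 := (idx e).2
    rw [Nat.add_mul, one_mul] at h3
    omega
  refine ⟨fun e => (D - md d e) * K + idx e, fun e f h => ?_, hlt⟩
  rcases lt_trichotomy (md d e) (md d f) with h' | h' | h'
  · have := hlt f e h'
    simp only at h
    omega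
  · simp only [h', add_right_inj] at h
    exact (Fintype.equivFin (Sym2 V)).injective (Fin.ext h)
  · have := hlt e f h'
    simp only at h
    omega

namespace Frame

variable (F : Frame G)

theorem later {d : V → ℕ} {u v p : V} (he : F.N.Adj u v) (huv : d u ≤ d v)
    (hp : G.Adj u p) (hd : d p < d u) :
    ∀ f ∈ F.inc p, F.cf s(u, v) f ∧ md d f < md d s(u, v) := by
  intro f hf
  rw [F.mem_inc] at hf
  have h1 : md d f < md d s(u, v) := by
    have := md_le (d := d) hf.2
    rw [md_mk]
    omega
  exact ⟨⟨he, hf.1, fun h => by rw [h] at h1; exact lt_irrefl _ h1,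
    u, Sym2.mem_mk_left _ _, p, hf.2, Or.inr hp⟩, h1⟩

theorem exists_later {d : V → ℕ} (hd : ∀ v, d v ≠ 0 → ∃ p, G.Adj v p ∧ d p < d v)
    {e : Sym2 V} (he : e ∈ F.N.edgeSet) (h0 : md d e ≠ 0) :
    ∃ p, ∀ f ∈ F.inc p, F.cf e f ∧ md d f < md d e := by
  induction e with | _ u v
  have he' : F.N.Adj u v := he
  rw [md_mk] at h0
  rcases le_total (d u) (d v) with h | h
  · obtain ⟨p, hp, hpd⟩ := hd u (by omega)
    exact ⟨p, F.later he' h hp hpd⟩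
  · obtain ⟨p, hp, hpd⟩ := hd v (by omega)
    rw [Sym2.eq_swap]
    exact ⟨p, F.later he'.symm h hp hpd⟩

variable [Fintype V]

theorem flow {d : V → ℕ} (hd : ∀ v, d v ≠ 0 → ∃ p, G.Adj v p ∧ d p < d v) :
    ∃ c, F.PropOn {e | e ∈ F.N.edgeSet ∧ md d e ≠ 0} c := by
  obtain ⟨r, hr, hrd⟩ := exists_rank d
  obtain ⟨c, -, hc⟩ := greedy F.cf F.cf_irrefl (fun e f => F.cf_symm) ∅
    (Finset.univ.filter fun e => e ∈ F.N.edgeSet ∧ md d e ≠ 0) (by simp) r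
    (fun e _ f _ h => hr h) (fun _ => 0) (by simp) (by
      intro e he
      simp only [Finset.mem_filter, Finset.mem_univ, true_and] at he
      obtain ⟨p, hp⟩ := F.exists_later hd he.1 he.2
      refine (Finset.card_le_card (t := F.nb e \ F.inc p) ?_).trans ?_
      · intro f hf
        simp only [Finset.mem_filter, Finset.mem_univ, true_and, Set.mem_empty_iff_false,
          false_or] at hf
        rw [Finset.mem_sdiff, F.mem_nb]
        refine ⟨hf.1, fun hfp => ?_⟩
        have := hrd _ _ (hp f hfp).2
        omega
      · have h3 : F.inc p ⊆ F.nb e := fun f hf => F.mem_nb.2 (hp f hf).1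
        rw [Finset.card_sdiff_of_subset h3, F.card_inc]
        have := F.card_nb e
        omega)
  exact ⟨c, fun e he f hf => hc e (Or.inr (by simpa using he)) f (Or.inr (by simpa using hf))⟩

/-- In a connected graph all edges avoiding a nonempty set of vertices can be coloured. -/
theorem flow_connected (hG : G.Connected) {Z : Set V} (hZ : Z.Nonempty) :
    ∃ c, F.PropOn {e | e ∈ F.N.edgeSet ∧ ∀ v ∈ e, v ∉ Z} c := by
  obtain ⟨d, hd0, hd⟩ := exists_depth G Z
  obtain ⟨z, hz⟩ := hZ
  have hd' : ∀ v, v ∉ Z → d v ≠ 0 ∧ ∃ p, G.Adj v p ∧ d p < d v :=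
    fun v hv => hd v hv ⟨z, hz, hG.preconnected v z⟩
  obtain ⟨c, hc⟩ := F.flow (d := d) (fun v hv => (hd' v fun h => hv (hd0 v h)).2)
  exact ⟨c, hc.mono fun e he => ⟨he.1, md_ne_zero fun v hv => (hd' v (he.2 v hv)).1⟩⟩

end Frame

/-- A permutation carrying two disjoint sets into two prescribed disjoint sets. -/
theorem exists_perm {α : Type} [Fintype α] {C D T U : Finset α} (hCD : Disjoint C D)
    (hTU : Disjoint T U) (hC : C.card ≤ T.card) (hD : D.card ≤ U.card) :
    ∃ π : Equiv.Perm α, (∀ x ∈ C, π x ∈ T) ∧ ∀ x ∈ D, π x ∈ U := by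
  obtain ⟨T', hT', hTc⟩ := Finset.exists_subset_card_eq hC
  obtain ⟨U', hU', hUc⟩ := Finset.exists_subset_card_eq hD
  let f := Finset.equivOfCardEq hTc.symm
  let g := Finset.equivOfCardEq hUc.symm
  let h : α → α := fun x => if hx : x ∈ C then f ⟨x, hx⟩ else
    if hx : x ∈ D then g ⟨x, hx⟩ else x
  have hhC : ∀ x (hx : x ∈ C), h x = f ⟨x, hx⟩ := fun x hx => dif_pos hx
  have hhD : ∀ x (hx : x ∈ D), h x = g ⟨x, hx⟩ := fun x hx => by
    have : x ∉ C := Finset.disjoint_right.1 hCD hx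
    simp only [h, this, hx, dif_neg, dif_pos, not_false_iff]
  have hCT : ∀ x ∈ C, h x ∈ T := fun x hx => by rw [hhC x hx]; exact hT' (f ⟨x, hx⟩).2
  have hDU : ∀ x ∈ D, h x ∈ U := fun x hx => by rw [hhD x hx]; exact hU' (g ⟨x, hx⟩).2
  have hinj : Set.InjOn h (C ∪ D : Finset α) := by
    intro x hx y hy hxy
    rw [Finset.mem_coe, Finset.mem_union] at hx hy
    rcases hx with hx | hx <;> rcases hy with hy | hy
    · rw [hhC x hx, hhC y hy] at hxy
      exact congrArg Subtype.val (f.injective (Subtype.ext hxy))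
    · have := hDU y hy
      rw [← hxy] at this
      exact absurd this (Finset.disjoint_left.1 hTU (hCT x hx))
    · have := hCT y hy
      rw [← hxy] at this
      exact absurd (hDU x hx) (Finset.disjoint_left.1 hTU this)
    · rw [hhD x hx, hhD y hy] at hxy
      exact congrArg Subtype.val (g.injective (Subtype.ext hxy))
  obtain ⟨e, he⟩ := Finset.exists_equiv_extend_of_card_eq (t := (Finset.univ : Finset α))
    (α := α) (by simp) (s := C ∪ D) (f := h) (by simp) hinj
  refine ⟨e.trans (Equiv.subtypeUnivEquiv Finset.mem_univ), fun x hx => ?_, fun x hx => ?_⟩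
  · have := he x (Finset.mem_union_left _ hx)
    simp only [Equiv.trans_apply, Equiv.subtypeUnivEquiv_apply, this]
    exact hCT x hx
  · have := he x (Finset.mem_union_right _ hx)
    simp only [Equiv.trans_apply, Equiv.subtypeUnivEquiv_apply, this]
    exact hDU x hx

theorem exists_perm_into {α : Type} [Fintype α] {C T : Finset α} (hC : C.card ≤ T.card) :
    ∃ π : Equiv.Perm α, ∀ x ∈ C, π x ∈ T := by
  obtain ⟨π, h, -⟩ := exists_perm (C := C) (D := ∅) (T := T) (U := ∅) (by simp) (by simp) hC
    le_rfl
  exact ⟨π, h⟩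

/-- A permutation making `C` disjoint from `A` and `D` disjoint from `B` for at most
two-element sets of seven colours. -/
theorem exists_perm_avoid {A B C D : Finset (Fin 7)} (hA : A.card ≤ 2) (hB : B.card ≤ 2)
    (hC : C.card ≤ 2) (hD : D.card ≤ 2) :
    ∃ π : Equiv.Perm (Fin 7), (∀ x ∈ C, π x ∉ A) ∧ ∀ x ∈ D, π x ∉ B := by
  have hAB := Finset.card_union_add_card_inter A B
  have hCD := Finset.card_union_add_card_inter C D
  have hcompl : ((A ∪ B)ᶜ).card = 7 - (A ∪ B).card := by
    rw [Finset.card_compl, Fintype.card_fin]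
  by_cases h : (C ∪ D).card ≤ ((A ∪ B)ᶜ).card
  · obtain ⟨π, hπ⟩ := exists_perm_into h
    refine ⟨π, fun x hx hxA => ?_, fun x hx hxB => ?_⟩
    · exact Finset.mem_compl.1 (hπ x (Finset.mem_union_left _ hx)) (Finset.mem_union_left _ hxA)
    · exact Finset.mem_compl.1 (hπ x (Finset.mem_union_right _ hx))
        (Finset.mem_union_right _ hxB)
  · have h1 : (A ∩ B).card = 0 := by omega
    have h2 : (C ∩ D).card = 0 := by omega
    rw [Finset.card_eq_zero, ← Finset.disjoint_iff_inter_eq_empty] at h1 h2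
    obtain ⟨π, hπ1, hπ2⟩ := exists_perm (C := C) (D := D) (T := B) (U := A) h2 h1.symm
      (by omega) (by omega)
    exact ⟨π, fun x hx => Finset.disjoint_right.1 h1 (hπ1 x hx),
      fun x hx => Finset.disjoint_left.1 h1 (hπ2 x hx)⟩

theorem exists_frame {m : V → V} (hm : ∀ v, m (m v) = v) (ha : ∀ v, m v ≠ v → G.Adj v (m v))
    (hdeg : ∀ v, (G.neighborSet v \ {m v}).ncard = 2) : ∃ F : Frame G, F.mt = m := by
  refine ⟨⟨m, hm, ha, fun v => ?_⟩, rfl⟩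
  obtain ⟨a, b, hab, h⟩ := Set.ncard_eq_two.1 (hdeg v)
  refine ⟨a, b, hab, fun w => ?_⟩
  have := Set.ext_iff.1 h w
  simpa using this

namespace Frame

variable (F : Frame G)

/-- The edges outside the matching that avoid `Z`. -/
def off (Z : Set V) : Set (Sym2 V) := {e | e ∈ F.N.edgeSet ∧ ∀ v ∈ e, v ∉ Z}

theorem notMem_off {Z : Set V} {e : Sym2 V} {v : V} (hv : v ∈ e) (hZ : v ∈ Z) :
    e ∉ F.off Z := fun h => h.2 v hv hZ

theorem good_of_off {Z : Set V} {T : Set (Sym2 V)} (hT : ∀ v ∈ Z, ∀ e ∈ F.inc v, e ∈ T)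
    {c : Sym2 V → Fin 7} (hc : F.PropOn (F.off Z ∪ T) c) : F.Good := by
  refine ⟨c, hc.mono fun e he => ?_⟩
  by_cases h : ∀ v ∈ e, v ∉ Z
  · exact Or.inl ⟨he, h⟩
  · push Not at h
    obtain ⟨v, hv, hvZ⟩ := h
    exact Or.inr (hT v hvZ e (F.mem_inc.2 ⟨he, hv⟩))

variable [Fintype V]

theorem extend {S : Set (Sym2 V)} {e : Sym2 V} (h : ∃ c, F.PropOn S c)
    (hav : ∀ c, e ∉ S → 0 < (F.av S c e).card) : ∃ c, F.PropOn (insert e S) c := by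
  obtain ⟨c, hc⟩ := h
  by_cases he : e ∈ S
  · rw [Set.insert_eq_of_mem he]; exact ⟨c, hc⟩
  · obtain ⟨c', -, hc'⟩ := F.exists_insert hc he (hav c he)
    exact ⟨c', hc'⟩

theorem extend_of_two {S : Set (Sym2 V)} {e f₁ f₂ : Sym2 V} (h : ∃ c, F.PropOn S c)
    (h₁ : F.cf e f₁) (h₂ : F.cf e f₂) (hne : f₁ ≠ f₂) (r₁ : f₁ ∉ S) (r₂ : f₂ ∉ S) :
    ∃ c, F.PropOn (insert e S) c :=
  F.extend h fun _ _ => F.card_av_of_redundant h₁ h₂ hne (Or.inl r₁) (Or.inl r₂)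

theorem card_av_of_card_nb {S : Set (Sym2 V)} {c : Sym2 V → Fin 7} {e : Sym2 V}
    (h : (F.nb e).card ≤ 6) : 0 < (F.av S c e).card := by
  have h1 := F.card_av_of_image (S := S) (c := c) (e := e) ((F.nb e).image c)
    fun f _ hf => Finset.mem_image_of_mem _ (F.mem_nb.2 hf)
  have h2 : ((F.nb e).image c).card ≤ (F.nb e).card := Finset.card_image_le
  omega

theorem card_nb_of_mt_eq {x v : V} (hx : F.mt x = x) (h : F.N.Adj x v) :
    (F.nb s(x, v)).card ≤ 6 := by
  have h1 : F.nb s(x, v) ⊆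
      {s(x, F.oth v x), s(F.oth v x, F.oth x (F.oth v x))} ∪ F.side v x := by
    intro f hf
    have hne := (F.mem_nb.1 hf).2.2.1
    have := F.nb_subset x v hf
    rw [side, hx, F.inc_eq h] at this
    simp only [Finset.mem_union, Finset.mem_insert, Finset.mem_singleton] at this ⊢
    have := hne.symm
    tauto
  have h2 := Finset.card_le_card h1
  have h3 := Finset.card_union_le
    {s(x, F.oth v x), s(F.oth v x, F.oth x (F.oth v x))} (F.side v x)
  have h4 := F.card_side v x
  have h5 := Finset.card_le_two (a := s(x, F.oth v x))
    (b := s(F.oth v x, F.oth x (F.oth v x)))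
  omega

theorem good_of_mt_eq (hG : G.Connected) {x : V} (hx : F.mt x = x) : F.Good := by
  have h0 := F.flow_connected hG (Z := {x}) ⟨x, rfl⟩
  have h1 := F.extend (e := s(x, F.n1 x)) h0 fun c _ =>
    F.card_av_of_card_nb (F.card_nb_of_mt_eq hx (F.N_adj_n1 x))
  obtain ⟨c, hc⟩ := F.extend (e := s(x, F.n2 x)) h1 fun c _ =>
    F.card_av_of_card_nb (F.card_nb_of_mt_eq hx (F.N_adj_n2 x))
  refine F.good_of_off (Z := {x}) (T := F.inc x) ?_ (hc.mono ?_)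
  · rintro v rfl e he
    exact he
  · rintro e (he | he)
    · exact Or.inr (Or.inr he)
    · simp only [inc, Finset.coe_insert, Finset.coe_singleton, Set.mem_insert_iff,
        Set.mem_singleton_iff] at he
      rcases he with rfl | rfl
      · exact Or.inr (Or.inl rfl)
      · exact Or.inl rfl

theorem card_nb_triangle {a b c : V} (hne : a ≠ b) (hab : F.mt a = b) (hbc : F.N.Adj b c)
    (hca : F.N.Adj c a) : (F.nb s(b, c)).card ≤ 6 := by
  have hba : F.mt b = a := F.mt_eq_comm.1 hab
  have hoth : F.oth b c = a := (F.eq_oth hbc.symm hca hne).symm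
  have h1 : F.nb s(b, c) ⊆ {s(b, F.oth c b), s(F.oth c b, F.oth b (F.oth c b)), s(a, c),
      s(a, F.oth c a)} ∪ F.inc (F.mt c) := by
    intro f hf
    have := F.nb_subset b c hf
    rw [side, side, hba, hoth, F.inc_eq hca.symm] at this
    simp only [Finset.mem_union, Finset.mem_insert, Finset.mem_singleton] at this ⊢
    rw [Sym2.eq_swap (a := c) (b := a)] at this
    tauto
  have h2 := Finset.card_le_card h1
  have h3 := Finset.card_union_le {s(b, F.oth c b), s(F.oth c b, F.oth b (F.oth c b)), s(a, c),
      s(a, F.oth c a)} (F.inc (F.mt c))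
  have h4 := F.card_inc (F.mt c)
  have h5 := Finset.card_le_four (a := s(b, F.oth c b))
    (b := s(F.oth c b, F.oth b (F.oth c b))) (c := s(a, c)) (d := s(a, F.oth c a))
  omega

theorem good_of_triangle (hG : G.Connected) {a b c : V} (hne : a ≠ b) (hab : F.mt a = b)
    (hbc : F.N.Adj b c) (hca : F.N.Adj c a) : F.Good := by
  have hba : F.mt b = a := F.mt_eq_comm.1 hab
  have hadj : G.Adj a b := by
    have := F.adj_mt a (by rw [hab]; exact hne.symm)
    rwa [hab] at this
  have ha := F.oth_ne c a
  have hb := F.oth_ne c b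
  have hNa := F.N_adj_oth c a
  have hNb := F.N_adj_oth c b
  have hab' : F.oth c a ≠ b := fun h => hNa.2 (by rw [h, hab])
  have hba' : F.oth c b ≠ a := fun h => hNb.2 (by rw [h, hba])
  have hac := hca.1.ne
  have hbc' := hbc.1.ne
  have hoa := hNa.1.ne
  have hob := hNb.1.ne
  have h0 := F.flow_connected hG (Z := {a, b, c}) ⟨a, by simp⟩
  have h1 := F.extend_of_two (e := s(a, F.oth c a)) (f₁ := s(b, c)) (f₂ := s(c, a)) h0
    (F.cf_mk hNa hbc (by grind [Sym2.eq_iff]) (by tauto))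
    (F.cf_mk hNa hca (by grind [Sym2.eq_iff]) (by tauto))
    (by grind [Sym2.eq_iff]) (F.notMem_off (v := b) (by simp) (by simp))
    (F.notMem_off (v := c) (by simp) (by simp))
  have h2 := F.extend_of_two (e := s(b, F.oth c b)) (f₁ := s(b, c)) (f₂ := s(c, a)) h1
    (F.cf_mk hNb hbc (by grind [Sym2.eq_iff]) (by tauto))
    (F.cf_mk hNb hca (by grind [Sym2.eq_iff]) (by tauto))
    (by grind [Sym2.eq_iff])
    (by
      rintro (h | h)
      · grind [Sym2.eq_iff]
      · exact F.notMem_off (v := b) (by simp) (by simp) h)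
    (by
      rintro (h | h)
      · grind [Sym2.eq_iff]
      · exact F.notMem_off (v := c) (by simp) (by simp) h)
  have h3 := F.extend (e := s(b, c)) h2 fun c _ =>
    F.card_av_of_card_nb (F.card_nb_triangle hne hab hbc hca)
  obtain ⟨col, hcol⟩ := F.extend (e := s(a, c)) h3 fun _ _ =>
    F.card_av_of_card_nb (F.card_nb_triangle hne.symm hba hca.symm hbc.symm)
  refine F.good_of_off (Z := {a, b, c}) (T := {s(a, c), s(b, c), s(b, F.oth c b),
    s(a, F.oth c a)}) ?_ (hcol.mono ?_)
  · rintro v (rfl | rfl | rfl) e he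
    · rw [F.inc_eq hca.symm] at he
      simp only [Finset.mem_insert, Finset.mem_singleton] at he
      simp only [Set.mem_insert_iff, Set.mem_singleton_iff]
      tauto
    · rw [F.inc_eq hbc] at he
      simp only [Finset.mem_insert, Finset.mem_singleton] at he
      simp only [Set.mem_insert_iff, Set.mem_singleton_iff]
      tauto
    · rw [F.inc_eq hca, ← F.eq_oth hca hbc.symm hne.symm] at he
      simp only [Finset.mem_insert, Finset.mem_singleton] at he
      simp only [Set.mem_insert_iff, Set.mem_singleton_iff]
      rw [Sym2.eq_swap (a := v), Sym2.eq_swap (a := v)] at he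
      tauto
  · intro e he
    simp only [Set.mem_union, Set.mem_insert_iff, Set.mem_singleton_iff] at he ⊢
    change e ∈ F.off {a, b, c} ∨ _ at he
    tauto

/-- Colouring all edges on one side of a cut when a matching edge crosses it. -/
theorem side_colouring (hG : G.Connected) {A : Set V} {a c : V} (hac : F.mt a = c)
    (hc : c ∉ A) :
    ∃ col, F.PropOn {e | e ∈ F.N.edgeSet ∧ ∀ v ∈ e, v ∈ A} col := by
  obtain ⟨col, hcol⟩ := F.flow_connected hG (Z := {a, c}) ⟨a, by simp⟩
  let S : Set (Sym2 V) := {e | (e ∈ F.N.edgeSet ∧ ∀ v ∈ e, v ∈ A) ∧ a ∉ e}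
  have hS : S ⊆ F.off {a, c} := by
    rintro e ⟨⟨he, heA⟩, hae⟩
    refine ⟨he, ?_⟩
    rintro v hv (rfl | rfl)
    exacts [hae hv, hc (heA _ hv)]
  have key : ∀ T : Set (Sym2 V), (∃ col, F.PropOn (S ∪ T) col) → (∀ e ∈ T, c ∉ e) →
      ∀ e ∈ F.inc a, c ∉ e → ∃ col, F.PropOn (S ∪ insert e T) col := by
    intro T hT hTc e he hce
    rw [Set.union_insert]
    have hadj : G.Adj a c ∨ a = c := by
      by_cases h : a = c
      · exact Or.inr h
      · exact Or.inl (hac ▸ F.adj_mt a (by rw [hac]; exact fun h' => h h'.symm))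
    have hcf : ∀ f ∈ F.inc c, F.cf e f := by
      intro f hf
      rw [F.mem_inc] at he hf
      exact ⟨he.1, hf.1, fun h => hce (h ▸ hf.2), a, he.2, c, hf.2, hadj.symm⟩
    have hno : ∀ f ∈ F.inc c, f ∉ S ∪ T := by
      intro f hf
      rw [F.mem_inc] at hf
      rintro (h | h)
      exacts [hc (h.1.2 c hf.2), hTc f h hf.2]
    have m1 : s(c, F.n1 c) ∈ F.inc c := by simp [inc]
    have m2 : s(c, F.n2 c) ∈ F.inc c := by simp [inc]
    exact F.extend_of_two hT (hcf _ m1) (hcf _ m2)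
      (fun h => F.n1_ne_n2 c (Sym2.congr_right.1 h)) (hno _ m1) (hno _ m2)
  by_cases haA : a ∈ A
  · have hca : c ≠ a := fun h => hc (h ▸ haA)
    have hcn : ∀ v, F.N.Adj a v → c ∉ s(a, v) := by
      intro v hv h
      rcases Sym2.mem_iff.1 h with h | h
      · exact hca h
      · exact hv.2 (by rw [hac, h])
    have h1 := key ∅ ⟨col, by rw [Set.union_empty]; exact hcol.mono hS⟩ (by simp)
      s(a, F.n1 a) (by simp [inc]) (hcn _ (F.N_adj_n1 a))
    obtain ⟨col', h2⟩ := key _ h1 (by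
      rintro e (rfl | h)
      · exact hcn _ (F.N_adj_n1 a)
      · exact absurd h (by simp)) s(a, F.n2 a) (by simp [inc]) (hcn _ (F.N_adj_n2 a))
    refine ⟨col', h2.mono fun e he => ?_⟩
    by_cases hae : a ∈ e
    · right
      have : e ∈ F.inc a := F.mem_inc.2 ⟨he.1, hae⟩
      simp only [inc, Finset.mem_insert, Finset.mem_singleton] at this
      rcases this with rfl | rfl
      · exact Or.inr (Or.inl rfl)
      · exact Or.inl rfl
    · exact Or.inl ⟨he, hae⟩
  · exact ⟨col, hcol.mono fun e he => hS ⟨he, fun h => haA (he.2 a h)⟩⟩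

/-- If the only edges crossing a cut are two matching edges, the two sides can be coloured
separately. -/
theorem good_of_two_cut (hG : G.Connected) {A : Set V} {a b c d : V} (hac : F.mt a = c)
    (ha : a ∈ A) (hc : c ∉ A) (hbd : F.mt b = d)
    (hcut : ∀ u w, u ∈ A → w ∉ A → G.Adj u w → (u = a ∧ w = c) ∨ (u = b ∧ w = d)) :
    F.Good := by
  obtain ⟨cA, hA⟩ := F.side_colouring hG hac hc
  obtain ⟨cB, hB⟩ := F.side_colouring hG (A := Aᶜ) (F.mt_eq_comm.1 hac) (fun h => h ha)
  have hle : ∀ (f : Sym2 V → Fin 7) v, ((F.inc v).image f).card ≤ 2 := fun f v =>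
    Finset.card_image_le.trans (F.card_inc v).le
  obtain ⟨π, h1, h2⟩ := exists_perm_avoid (hle cA a) (hle cA b) (hle cB c) (hle cB d)
  have hNcut : ∀ u w, u ∈ A → w ∉ A → ¬ F.N.Adj u w := by
    intro u w hu hw h
    rcases hcut u w hu hw h.1 with ⟨rfl, rfl⟩ | ⟨rfl, rfl⟩
    exacts [h.2 hac.symm, h.2 hbd.symm]
  have hside : ∀ e ∈ F.N.edgeSet, (∀ v ∈ e, v ∈ A) ∨ ∀ v ∈ e, v ∉ A := by
    intro e he
    induction e with | _ u v
    have he' : F.N.Adj u v := he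
    by_cases hu : u ∈ A <;> by_cases hv : v ∈ A
    · left; intro w hw; rcases Sym2.mem_iff.1 hw with rfl | rfl <;> assumption
    · exact absurd he' (hNcut u v hu hv)
    · exact absurd he'.symm (hNcut v u hv hu)
    · right; intro w hw; rcases Sym2.mem_iff.1 hw with rfl | rfl <;> assumption
  let col : Sym2 V → Fin 7 := fun e => if ∀ v ∈ e, v ∈ A then cA e else π (cB e)
  have hne : ∀ e : Sym2 V, (∀ v ∈ e, v ∉ A) → ¬ ∀ v ∈ e, v ∈ A := by
    intro e h h'
    induction e with | _ u v
    exact h u (Sym2.mem_mk_left _ _) (h' u (Sym2.mem_mk_left _ _))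
  have cross : ∀ e f, (∀ v ∈ e, v ∈ A) → (∀ v ∈ f, v ∉ A) → F.cf e f → cA e ≠ π (cB f) := by
    rintro e f he hf ⟨he', hf', -, u, hu, w, hw, huw⟩ heq
    rcases huw with rfl | huw
    · exact hf u hw (he u hu)
    rcases hcut u w (he u hu) (hf w hw) huw with ⟨rfl, rfl⟩ | ⟨rfl, rfl⟩
    · refine h1 (cB f) (Finset.mem_image_of_mem _ (F.mem_inc.2 ⟨hf', hw⟩)) ?_
      rw [← heq]
      exact Finset.mem_image_of_mem _ (F.mem_inc.2 ⟨he', hu⟩)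
    · refine h2 (cB f) (Finset.mem_image_of_mem _ (F.mem_inc.2 ⟨hf', hw⟩)) ?_
      rw [← heq]
      exact Finset.mem_image_of_mem _ (F.mem_inc.2 ⟨he', hu⟩)
  refine ⟨col, fun e he f hf hef => ?_⟩
  rcases hside e he with h | h <;> rcases hside f hf with h' | h'
  · simp only [col, if_pos h, if_pos h']
    exact hA e ⟨he, h⟩ f ⟨hf, h'⟩ hef
  · simp only [col, if_pos h, if_neg (hne f h')]
    exact cross e f h h' hef
  · simp only [col, if_pos h', if_neg (hne e h)]
    exact (cross f e h' h (F.cf_symm hef)).symm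
  · simp only [col, if_neg (hne e h), if_neg (hne f h')]
    exact fun hh => hB e ⟨he, h⟩ f ⟨hf, h'⟩ hef (π.injective hh)

end Frame

/-- Choosing an element subject to two exclusions and two conditional exclusions. -/
theorem pick (L : Finset (Fin 7)) (x y : Fin 7) (p q : Prop) (u v : Fin 7)
    (h : 2 + (if p then 1 else 0) + (if q then 1 else 0) < L.card) :
    ∃ z ∈ L, z ≠ x ∧ z ≠ y ∧ (p → z ≠ u) ∧ (q → z ≠ v) := by
  have h1 := Finset.card_le_two (a := x) (b := y)
  have h2 : (if p then {u} else ∅ : Finset (Fin 7)).card = if p then 1 else 0 := by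
    split_ifs <;> simp
  have h3 : (if q then {v} else ∅ : Finset (Fin 7)).card = if q then 1 else 0 := by
    split_ifs <;> simp
  have h4 := Finset.card_union_le ({x, y} : Finset (Fin 7)) (if p then {u} else ∅)
  have h5 := Finset.card_union_le ({x, y} ∪ if p then {u} else ∅ : Finset (Fin 7))
    (if q then {v} else ∅)
  obtain ⟨z, hz, hz'⟩ := Finset.exists_mem_notMem_of_card_lt_card
    (s := {x, y} ∪ (if p then {u} else ∅) ∪ (if q then {v} else ∅)) (t := L) (by omega)
  refine ⟨z, hz, ?_, ?_, ?_, ?_⟩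
  · rintro rfl; exact hz' (by simp)
  · rintro rfl; exact hz' (by simp)
  · rintro hp rfl; exact hz' (by simp [hp])
  · rintro hq rfl; exact hz' (by simp [hq])

theorem pick_two {L : Finset (Fin 7)} (h : 2 < L.card) (x y : Fin 7) :
    ∃ z ∈ L, z ≠ x ∧ z ≠ y := by
  obtain ⟨z, h1, h2, h3, -⟩ := pick L x y False False x y (by simpa using h)
  exact ⟨z, h1, h2, h3⟩

theorem pick_four {L : Finset (Fin 7)} (h : 4 < L.card) (x y u v : Fin 7) :
    ∃ z ∈ L, z ≠ x ∧ z ≠ y ∧ z ≠ u ∧ z ≠ v := by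
  simpa using pick L x y True True u v (by simpa using h)

theorem pick_three {L : Finset (Fin 7)} (h : 3 < L.card) (x y u : Fin 7) :
    ∃ z ∈ L, z ≠ x ∧ z ≠ y ∧ z ≠ u := by
  obtain ⟨z, h1, h2, h3, h4, -⟩ := pick L x y True False u u (by simpa using h)
  exact ⟨z, h1, h2, h3, h4 trivial⟩

theorem pick_five {L : Finset (Fin 7)} (h : 5 < L.card) (x y u v w : Fin 7) :
    ∃ z ∈ L, z ≠ x ∧ z ≠ y ∧ z ≠ u ∧ z ≠ v ∧ z ≠ w := by
  have h1 := Finset.pred_card_le_card_erase (s := L) (a := w)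
  obtain ⟨z, hz, h2⟩ := pick_four (L := L.erase w) (by omega) x y u v
  exact ⟨z, Finset.mem_of_mem_erase hz, h2.1, h2.2.1, h2.2.2.1, h2.2.2.2,
    Finset.ne_of_mem_erase hz⟩

/-- Colouring around a 4-cycle when the pendant edges `1` and `3` are not in conflict. -/
theorem four_lists {L₁ L₂ L₃ L₄ A B : Finset (Fin 7)} {p : Prop} (h₁ : 3 ≤ L₁.card)
    (h₂ : 3 ≤ L₂.card) (h₃ : 3 ≤ L₃.card) (h₄ : 3 + (if p then 1 else 0) ≤ L₄.card)
    (hA : 5 ≤ A.card) (hB : 5 ≤ B.card) :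
    ∃ x₁ ∈ L₁, ∃ x₂ ∈ L₂, ∃ x₃ ∈ L₃, ∃ x₄ ∈ L₄, ∃ a ∈ A, ∃ b ∈ B,
      x₁ ≠ x₂ ∧ x₁ ≠ x₄ ∧ x₃ ≠ x₂ ∧ x₃ ≠ x₄ ∧ (p → x₂ ≠ x₄) ∧ a ≠ b ∧
      a ≠ x₁ ∧ a ≠ x₂ ∧ a ≠ x₃ ∧ a ≠ x₄ ∧ b ≠ x₁ ∧ b ≠ x₂ ∧ b ≠ x₃ ∧ b ≠ x₄ := by
  have key : ∀ L₁ L₃ : Finset (Fin 7), 3 ≤ L₁.card → 3 ≤ L₃.card → ∀ y ∈ L₁, y ∉ B →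
      ∃ x₁ ∈ L₁, ∃ x₂ ∈ L₂, ∃ x₃ ∈ L₃, ∃ x₄ ∈ L₄, ∃ a ∈ A, ∃ b ∈ B,
      x₁ ≠ x₂ ∧ x₁ ≠ x₄ ∧ x₃ ≠ x₂ ∧ x₃ ≠ x₄ ∧ (p → x₂ ≠ x₄) ∧ a ≠ b ∧
      a ≠ x₁ ∧ a ≠ x₂ ∧ a ≠ x₃ ∧ a ≠ x₄ ∧ b ≠ x₁ ∧ b ≠ x₂ ∧ b ≠ x₃ ∧ b ≠ x₄ := by
    intro L₁ L₃ h₁ h₃ y hy hyB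
    obtain ⟨x₂, m₂, d₂, -⟩ := pick_two (L := L₂) (by omega) y y
    obtain ⟨x₄, m₄, d₄, -, e₄, -⟩ := pick L₄ y y p False x₂ x₂ (by
      simp only [if_false]; omega)
    obtain ⟨x₃, m₃, d₃, e₃⟩ := pick_two (L := L₃) (by omega) x₂ x₄
    obtain ⟨a, ma, a₁, a₂, a₃, a₄⟩ := pick_four (L := A) (by omega) y x₂ x₃ x₄
    obtain ⟨b, mb, b₁, b₂, b₃, b₄⟩ := pick_four (L := B) (by omega) a x₂ x₃ x₄
    exact ⟨y, hy, x₂, m₂, x₃, m₃, x₄, m₄, a, ma, b, mb, d₂.symm, d₄.symm, d₃, e₃,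
      fun h => (e₄ h).symm, b₁.symm, a₁, a₂, a₃, a₄, fun h => hyB (h ▸ mb), b₂, b₃, b₄⟩
  by_cases hc : ∃ α ∈ L₁, α ∈ L₃
  · obtain ⟨α, hα, hα'⟩ := hc
    obtain ⟨x₂, m₂, d₂, -⟩ := pick_two (L := L₂) (by omega) α α
    obtain ⟨x₄, m₄, d₄, -, e₄, -⟩ := pick L₄ α α p False x₂ x₂ (by
      simp only [if_false]; omega)
    obtain ⟨a, ma, a₁, a₂, a₃, a₄⟩ := pick_four (L := A) (by omega) α x₂ x₄ x₄
    obtain ⟨b, mb, b₁, b₂, b₃, b₄⟩ := pick_four (L := B) (by omega) a x₂ α x₄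
    exact ⟨α, hα, x₂, m₂, α, hα', x₄, m₄, a, ma, b, mb, d₂.symm, d₄.symm, d₂.symm, d₄.symm,
      fun h => (e₄ h).symm, b₁.symm, a₁, a₂, a₁, a₄, b₃, b₂, b₃, b₄⟩
  by_cases hB6 : 6 ≤ B.card
  · obtain ⟨x₁, m₁⟩ := Finset.card_pos.1 (show 0 < L₁.card by omega)
    obtain ⟨x₂, m₂, d₂, -⟩ := pick_two (L := L₂) (by omega) x₁ x₁
    obtain ⟨x₄, m₄, d₄, -, e₄, -⟩ := pick L₄ x₁ x₁ p False x₂ x₂ (by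
      simp only [if_false]; omega)
    obtain ⟨x₃, m₃, d₃, e₃⟩ := pick_two (L := L₃) (by omega) x₂ x₄
    obtain ⟨a, ma, a₁, a₂, a₃, a₄⟩ := pick_four (L := A) (by omega) x₁ x₂ x₃ x₄
    obtain ⟨b, mb, b₀, b₁, b₂, b₃, b₄⟩ := pick_five (L := B) (by omega) a x₁ x₂ x₃ x₄
    exact ⟨x₁, m₁, x₂, m₂, x₃, m₃, x₄, m₄, a, ma, b, mb, d₂.symm, d₄.symm, d₃, e₃,
      fun h => (e₄ h).symm, b₀.symm, a₁, a₂, a₃, a₄, b₁, b₂, b₃, b₄⟩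
  · have hdis : Disjoint L₁ L₃ := Finset.disjoint_left.2 fun x hx hx' => hc ⟨x, hx, hx'⟩
    obtain ⟨y, hy, hyB⟩ := Finset.exists_mem_notMem_of_card_lt_card
      (s := B) (t := L₁ ∪ L₃) (by rw [Finset.card_union_of_disjoint hdis]; omega)
    rcases Finset.mem_union.1 hy with hy | hy
    · exact key L₁ L₃ h₁ h₃ y hy hyB
    · obtain ⟨x₁, m₁, x₂, m₂, x₃, m₃, x₄, m₄, a, ma, b, mb, q⟩ := key L₃ L₁ h₃ h₁ y hy hyB
      exact ⟨x₃, m₃, x₂, m₂, x₁, m₁, x₄, m₄, a, ma, b, mb, by tauto⟩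

/-- Colouring around a 4-cycle when all six edges conflict pairwise. -/
theorem six_lists {L₁ L₂ L₃ L₄ A B : Finset (Fin 7)} (h₁ : 4 ≤ L₁.card)
    (h₂ : 4 ≤ L₂.card) (h₃ : 4 ≤ L₃.card) (h₄ : 4 ≤ L₄.card)
    (hA : 5 ≤ A.card) (hB : 5 ≤ B.card) (hAB : 6 ≤ B.card ∨ ∃ y ∈ A, y ∉ B) :
    ∃ x₁ ∈ L₁, ∃ x₂ ∈ L₂, ∃ x₃ ∈ L₃, ∃ x₄ ∈ L₄, ∃ a ∈ A, ∃ b ∈ B,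
      x₁ ≠ x₂ ∧ x₁ ≠ x₃ ∧ x₁ ≠ x₄ ∧ x₃ ≠ x₂ ∧ x₃ ≠ x₄ ∧ x₂ ≠ x₄ ∧ a ≠ b ∧
      a ≠ x₁ ∧ a ≠ x₂ ∧ a ≠ x₃ ∧ a ≠ x₄ ∧ b ≠ x₁ ∧ b ≠ x₂ ∧ b ≠ x₃ ∧ b ≠ x₄ := by
  obtain ⟨x₁, m₁⟩ := Finset.card_pos.1 (show 0 < L₁.card by omega)
  obtain ⟨x₂, m₂, d₂, -⟩ := pick_two (L := L₂) (by omega) x₁ x₁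
  obtain ⟨x₃, m₃, d₃, e₃⟩ := pick_two (L := L₃) (by omega) x₁ x₂
  obtain ⟨x₄, m₄, d₄, e₄, f₄⟩ := pick_three (L := L₄) (by omega) x₁ x₂ x₃
  refine ⟨x₁, m₁, x₂, m₂, x₃, m₃, x₄, m₄, ?_⟩
  suffices h : ∃ a ∈ A, ∃ b ∈ B, a ≠ b ∧
      a ≠ x₁ ∧ a ≠ x₂ ∧ a ≠ x₃ ∧ a ≠ x₄ ∧ b ≠ x₁ ∧ b ≠ x₂ ∧ b ≠ x₃ ∧ b ≠ x₄ by
    obtain ⟨a, ma, b, mb, q⟩ := h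
    exact ⟨a, ma, b, mb, d₂.symm, d₃.symm, d₄.symm, e₃, f₄.symm, e₄.symm, q⟩
  obtain ⟨a, ma, a₁, a₂, a₃, a₄⟩ := pick_four (L := A) (by omega) x₁ x₂ x₃ x₄
  rcases hAB with hB6 | ⟨y, hyA, hyB⟩
  · obtain ⟨b, mb, b₀, q⟩ := pick_five (L := B) (by omega) a x₁ x₂ x₃ x₄
    exact ⟨a, ma, b, mb, b₀.symm, a₁, a₂, a₃, a₄, q⟩
  · by_cases hy : y ≠ x₁ ∧ y ≠ x₂ ∧ y ≠ x₃ ∧ y ≠ x₄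
    · obtain ⟨b, mb, q⟩ := pick_four (L := B) (by omega) x₁ x₂ x₃ x₄
      exact ⟨y, hyA, b, mb, fun h => hyB (h ▸ mb), hy.1, hy.2.1, hy.2.2.1, hy.2.2.2, q⟩
    · have hor : y = x₁ ∨ y = x₂ ∨ y = x₃ ∨ y = x₄ := by tauto
      have hb : ∃ b ∈ B, b ≠ a ∧ b ≠ x₁ ∧ b ≠ x₂ ∧ b ≠ x₃ ∧ b ≠ x₄ := by
        rcases hor with rfl | rfl | rfl | rfl
        · obtain ⟨b, mb, q⟩ := pick_four (L := B) (by omega) a x₂ x₃ x₄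
          exact ⟨b, mb, q.1, fun h => hyB (h ▸ mb), q.2⟩
        · obtain ⟨b, mb, q⟩ := pick_four (L := B) (by omega) a x₁ x₃ x₄
          exact ⟨b, mb, q.1, q.2.1, fun h => hyB (h ▸ mb), q.2.2⟩
        · obtain ⟨b, mb, q⟩ := pick_four (L := B) (by omega) a x₁ x₂ x₄
          exact ⟨b, mb, q.1, q.2.1, q.2.2.1, fun h => hyB (h ▸ mb), q.2.2.2⟩
        · obtain ⟨b, mb, q⟩ := pick_four (L := B) (by omega) a x₁ x₂ x₃
          exact ⟨b, mb, q.1, q.2.1, q.2.2.1, q.2.2.2, fun h => hyB (h ▸ mb)⟩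
      obtain ⟨b, mb, b₀, q⟩ := hb
      exact ⟨a, ma, b, mb, b₀.symm, a₁, a₂, a₃, a₄, q⟩

/-- Distinct representatives for six sets, two pairs of which are disjoint. -/
theorem sdr_two_pairs {X X' Y Y' A B : Finset (Fin 7)} (hX : 3 ≤ X.card) (hX' : 3 ≤ X'.card)
    (hY : 3 ≤ Y.card) (hY' : 3 ≤ Y'.card) (hA : 3 ≤ A.card) (hB : 3 ≤ B.card)
    (hXX : Disjoint X X') (hYY : Disjoint Y Y')
    (hAB : Disjoint A B ∨ 4 ≤ A.card ∧ 4 ≤ B.card) :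
    ∃ f : Fin 6 → Fin 7, Function.Injective f ∧ f 0 ∈ X ∧ f 1 ∈ X' ∧ f 2 ∈ Y ∧ f 3 ∈ Y' ∧
      f 4 ∈ A ∧ f 5 ∈ B := by
  let L : Fin 6 → Finset (Fin 7) := ![X, X', Y, Y', A, B]
  have h3 : ∀ i, 3 ≤ (L i).card := by
    intro i; fin_cases i <;> assumption
  have hsub : ∀ (s : Finset (Fin 6)) i, i ∈ s → (L i) ⊆ s.biUnion L :=
    fun s i hi => Finset.subset_biUnion_of_mem L hi
  have hpair : ∀ (s : Finset (Fin 6)) i j, i ∈ s → j ∈ s → Disjoint (L i) (L j) →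
      6 ≤ (s.biUnion L).card := by
    intro s i j hi hj hd
    have := Finset.card_le_card (Finset.union_subset (hsub s i hi) (hsub s j hj))
    rw [Finset.card_union_of_disjoint hd] at this
    have h1 := h3 i
    have h2 := h3 j
    omega
  have hle6 : ∀ s : Finset (Fin 6), s.card ≤ 6 := fun s => by
    simpa using Finset.card_le_univ s
  have hall : ∀ s : Finset (Fin 6), s.card ≤ (s.biUnion L).card := by
    intro s
    by_cases h01 : (0 : Fin 6) ∈ s ∧ (1 : Fin 6) ∈ s
    · exact (hle6 s).trans (hpair s 0 1 h01.1 h01.2 hXX)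
    by_cases h23 : (2 : Fin 6) ∈ s ∧ (3 : Fin 6) ∈ s
    · exact (hle6 s).trans (hpair s 2 3 h23.1 h23.2 hYY)
    have hs : s.card ≤ 4 ∧ (3 < s.card → (4 : Fin 6) ∈ s ∧ (5 : Fin 6) ∈ s) := by
      revert h01 h23; revert s; decide
    rcases Nat.lt_or_ge 3 s.card with h | h
    · obtain ⟨m4, m5⟩ := hs.2 h
      rcases hAB with hd | ⟨hA, -⟩
      · exact (hle6 s).trans (hpair s 4 5 m4 m5 hd)
      · exact hs.1.trans (hA.trans (Finset.card_le_card (hsub s 4 m4)))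
    · rcases s.eq_empty_or_nonempty with rfl | ⟨i, hi⟩
      · simp
      · exact h.trans ((h3 i).trans (Finset.card_le_card (hsub s i hi)))
  obtain ⟨f, hf, hfL⟩ := (Finset.all_card_le_biUnion_card_iff_exists_injective L).1 hall
  exact ⟨f, hf, hfL 0, hfL 1, hfL 2, hfL 3, hfL 4, hfL 5⟩

/-- Colouring around a 5-cycle meeting the matching in one edge. -/
theorem five_lists_one {X X' Y Y' A B : Finset (Fin 7)} (hX : 3 ≤ X.card)
    (hX' : 3 ≤ X'.card) (hY : 3 ≤ Y.card) (hY' : 3 ≤ Y'.card) (hA : 4 ≤ A.card)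
    (hB : 4 ≤ B.card) :
    ∃ x ∈ X, ∃ x' ∈ X', ∃ y ∈ Y, ∃ y' ∈ Y', ∃ a ∈ A, ∃ b ∈ B,
      x ≠ y ∧ x ≠ y' ∧ x' ≠ y ∧ x' ≠ y' ∧ a ≠ b ∧
      a ≠ x ∧ a ≠ x' ∧ a ≠ y ∧ a ≠ y' ∧ b ≠ x ∧ b ≠ x' ∧ b ≠ y ∧ b ≠ y' := by
  have one : ∀ X X' Y Y' : Finset (Fin 7), 3 ≤ Y.card → 3 ≤ Y'.card →
      ∀ α ∈ X, α ∈ X' → (∀ β ∈ Y, β ∈ Y' → β = α) →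
      ∃ x ∈ X, ∃ x' ∈ X', ∃ y ∈ Y, ∃ y' ∈ Y', ∃ a ∈ A, ∃ b ∈ B,
      x ≠ y ∧ x ≠ y' ∧ x' ≠ y ∧ x' ≠ y' ∧ a ≠ b ∧
      a ≠ x ∧ a ≠ x' ∧ a ≠ y ∧ a ≠ y' ∧ b ≠ x ∧ b ≠ x' ∧ b ≠ y ∧ b ≠ y' := by
    intro X X' Y Y' hY hY' α hα hα' hβ
    refine ⟨α, hα, α, hα', ?_⟩
    suffices h : ∃ y ∈ Y, ∃ y' ∈ Y', y ≠ α ∧ y' ≠ α ∧ (4 < A.card ∨ α ∉ A ∨ y ∉ A ∨ y' ∉ A) by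
      obtain ⟨y, my, y', my', h1, h2, h3⟩ := h
      obtain ⟨b, mb, b1, b2, b3⟩ := pick_three (L := B) (by omega) α y y'
      have : ∃ a ∈ A, a ≠ α ∧ a ≠ b ∧ a ≠ y ∧ a ≠ y' := by
        rcases h3 with h3 | h3 | h3 | h3
        · exact pick_four h3 α b y y'
        · obtain ⟨a, ma, q⟩ := pick_three (L := A) (by omega) b y y'
          exact ⟨a, ma, fun h => h3 (h ▸ ma), q⟩
        · obtain ⟨a, ma, a1, a2, a3⟩ := pick_three (L := A) (by omega) α b y'
          exact ⟨a, ma, a1, a2, fun h => h3 (h ▸ ma), a3⟩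
        · obtain ⟨a, ma, a1, a2, a3⟩ := pick_three (L := A) (by omega) α b y
          exact ⟨a, ma, a1, a2, a3, fun h => h3 (h ▸ ma)⟩
      obtain ⟨a, ma, a1, a2, a3, a4⟩ := this
      exact ⟨y, my, y', my', a, ma, b, mb, h1.symm, h2.symm, h1.symm, h2.symm, a2, a1, a1, a3,
        a4, b1, b1, b2, b3⟩
    obtain ⟨y0, my0, d0, -⟩ := pick_two (L := Y) (by omega) α α
    obtain ⟨y1, my1, d1, -⟩ := pick_two (L := Y') (by omega) α α
    by_cases h4 : 4 < A.card
    · exact ⟨y0, my0, y1, my1, d0, d1, Or.inl h4⟩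
    by_cases hy : ∃ y ∈ Y, y ≠ α ∧ y ∉ A
    · obtain ⟨y, m, d, hA⟩ := hy
      exact ⟨y, m, y1, my1, d, d1, Or.inr (Or.inr (Or.inl hA))⟩
    by_cases hy' : ∃ y ∈ Y', y ≠ α ∧ y ∉ A
    · obtain ⟨y, m, d, hA⟩ := hy'
      exact ⟨y0, my0, y, m, d0, d, Or.inr (Or.inr (Or.inr hA))⟩
    push Not at hy hy'
    refine ⟨y0, my0, y1, my1, d0, d1, Or.inr (Or.inl fun hαA => h4 ?_)⟩
    have hsub : Y.erase α ∪ Y'.erase α ⊆ A.erase α := by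
      intro y hm
      simp only [Finset.mem_union, Finset.mem_erase] at hm ⊢
      rcases hm with ⟨h1, h2⟩ | ⟨h1, h2⟩
      exacts [⟨h1, hy y h2 h1⟩, ⟨h1, hy' y h2 h1⟩]
    have hd : Disjoint (Y.erase α) (Y'.erase α) := by
      rw [Finset.disjoint_left]
      intro y h1 h2
      rw [Finset.mem_erase] at h1 h2
      exact h1.1 (hβ y h1.2 h2.2)
    have h1 := Finset.card_le_card hsub
    rw [Finset.card_union_of_disjoint hd, Finset.card_erase_of_mem hαA] at h1
    have h2 := Finset.pred_card_le_card_erase (s := Y) (a := α)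
    have h3 := Finset.pred_card_le_card_erase (s := Y') (a := α)
    omega
  by_cases hx : ∃ α ∈ X, α ∈ X'
  · obtain ⟨α, hα, hα'⟩ := hx
    by_cases hy : ∃ β ∈ Y, β ∈ Y' ∧ β ≠ α
    · obtain ⟨β, hβ, hβ', hne⟩ := hy
      obtain ⟨a, ma, a1, a2⟩ := pick_two (L := A) (by omega) α β
      obtain ⟨b, mb, b0, b1, b2⟩ := pick_three (L := B) (by omega) a α β
      exact ⟨α, hα, α, hα', β, hβ, β, hβ', a, ma, b, mb, hne.symm, hne.symm, hne.symm,
        hne.symm, b0.symm, a1, a1, a2, a2, b1, b1, b2, b2⟩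
    · push Not at hy
      exact one X X' Y Y' hY hY' α hα hα' hy
  by_cases hy : ∃ α ∈ Y, α ∈ Y'
  · obtain ⟨α, hα, hα'⟩ := hy
    obtain ⟨y, my, y', my', x, mx, x', mx', a, ma, b, mb, q⟩ := one Y Y' X X' hX hX' α hα hα'
      fun β h h' => absurd ⟨β, h, h'⟩ hx
    exact ⟨x, mx, x', mx', y, my, y', my', a, ma, b, mb, by tauto⟩
  · obtain ⟨f, hf, h0, h1, h2, h3, h4, h5⟩ := sdr_two_pairs hX hX' hY hY'
      (show 3 ≤ A.card by omega) (show 3 ≤ B.card by omega)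
      (Finset.disjoint_left.2 fun x h h' => hx ⟨x, h, h'⟩)
      (Finset.disjoint_left.2 fun x h h' => hy ⟨x, h, h'⟩) (Or.inr ⟨hA, hB⟩)
    refine ⟨f 0, h0, f 1, h1, f 2, h2, f 3, h3, f 4, h4, f 5, h5, ?_⟩
    simp [hf.eq_iff]

/-- Colouring the octahedron from lists of three colours. -/
theorem octahedron_lists {X X' Y Y' Z Z' : Finset (Fin 7)} (hX : 3 ≤ X.card)
    (hX' : 3 ≤ X'.card) (hY : 3 ≤ Y.card) (hY' : 3 ≤ Y'.card) (hZ : 3 ≤ Z.card)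
    (hZ' : 3 ≤ Z'.card) :
    ∃ x ∈ X, ∃ x' ∈ X', ∃ y ∈ Y, ∃ y' ∈ Y', ∃ z ∈ Z, ∃ z' ∈ Z',
      x ≠ y ∧ x ≠ y' ∧ x ≠ z ∧ x ≠ z' ∧ x' ≠ y ∧ x' ≠ y' ∧ x' ≠ z ∧ x' ≠ z' ∧
      y ≠ z ∧ y ≠ z' ∧ y' ≠ z ∧ y' ≠ z' := by
  have one : ∀ X X' Y Y' Z Z' : Finset (Fin 7), 3 ≤ Y.card → 3 ≤ Y'.card → 3 ≤ Z.card →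
      3 ≤ Z'.card → (∃ α ∈ X, α ∈ X') →
      ∃ x ∈ X, ∃ x' ∈ X', ∃ y ∈ Y, ∃ y' ∈ Y', ∃ z ∈ Z, ∃ z' ∈ Z',
      x ≠ y ∧ x ≠ y' ∧ x ≠ z ∧ x ≠ z' ∧ x' ≠ y ∧ x' ≠ y' ∧ x' ≠ z ∧ x' ≠ z' ∧
      y ≠ z ∧ y ≠ z' ∧ y' ≠ z ∧ y' ≠ z' := by
    rintro X X' Y Y' Z Z' hY hY' hZ hZ' ⟨α, hα, hα'⟩
    refine ⟨α, hα, α, hα', ?_⟩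
    suffices h : ∃ y ∈ Y, ∃ y' ∈ Y', ∃ z ∈ Z, ∃ z' ∈ Z', y ≠ α ∧ y' ≠ α ∧ z ≠ α ∧ z' ≠ α ∧
        y ≠ z ∧ y ≠ z' ∧ y' ≠ z ∧ y' ≠ z' by
      obtain ⟨y, my, y', my', z, mz, z', mz', h1, h2, h3, h4, q⟩ := h
      exact ⟨y, my, y', my', z, mz, z', mz', h1.symm, h2.symm, h3.symm, h4.symm, h1.symm,
        h2.symm, h3.symm, h4.symm, q⟩
    by_cases hy : ∃ β ∈ Y, β ∈ Y' ∧ β ≠ α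
    · obtain ⟨β, hβ, hβ', hne⟩ := hy
      obtain ⟨z, mz, z1, z2⟩ := pick_two (L := Z) (by omega) α β
      obtain ⟨z', mz', z1', z2'⟩ := pick_two (L := Z') (by omega) α β
      exact ⟨β, hβ, β, hβ', z, mz, z', mz', hne, hne, z1, z1', z2.symm, z2'.symm, z2.symm,
        z2'.symm⟩
    push Not at hy
    obtain ⟨z, mz, dz, -⟩ := pick_two (L := Z) (by omega) α α
    have key : ∀ Y Y' : Finset (Fin 7), 3 ≤ Y.card → 3 ≤ Y'.card → z ∉ Y' →
        ∃ y ∈ Y, ∃ y' ∈ Y', ∃ z' ∈ Z', y ≠ α ∧ y' ≠ α ∧ z' ≠ α ∧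
        y ≠ z ∧ y ≠ z' ∧ y' ≠ z ∧ y' ≠ z' := by
      intro Y Y' hY hY' hz
      obtain ⟨y, my, y1, y2⟩ := pick_two (L := Y) (by omega) α z
      obtain ⟨z', mz', z1, z2⟩ := pick_two (L := Z') (by omega) α y
      obtain ⟨y', my', y3, y4⟩ := pick_two (L := Y') (by omega) α z'
      exact ⟨y, my, y', my', z', mz', y1, y3, z1, y2, z2.symm, fun h => hz (h ▸ my'), y4⟩
    by_cases hz : z ∈ Y'
    · have hzY : z ∉ Y := fun h => dz (hy z h hz)
      obtain ⟨y', my', y, my, z', mz', q⟩ := key Y' Y hY' hY hzY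
      exact ⟨y, my, y', my', z, mz, z', mz', by tauto⟩
    · obtain ⟨y, my, y', my', z', mz', q⟩ := key Y Y' hY hY' hz
      exact ⟨y, my, y', my', z, mz, z', mz', by tauto⟩
  by_cases hx : ∃ α ∈ X, α ∈ X'
  · exact one X X' Y Y' Z Z' hY hY' hZ hZ' hx
  by_cases hy : ∃ α ∈ Y, α ∈ Y'
  · obtain ⟨y, my, y', my', x, mx, x', mx', z, mz, z', mz', q⟩ :=
      one Y Y' X X' Z Z' hX hX' hZ hZ' hy
    exact ⟨x, mx, x', mx', y, my, y', my', z, mz, z', mz', by tauto⟩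
  by_cases hz : ∃ α ∈ Z, α ∈ Z'
  · obtain ⟨z, mz, z', mz', x, mx, x', mx', y, my, y', my', q⟩ :=
      one Z Z' X X' Y Y' hX hX' hY hY' hz
    exact ⟨x, mx, x', mx', y, my, y', my', z, mz, z', mz', by tauto⟩
  obtain ⟨f, hf, h0, h1, h2, h3, h4, h5⟩ := sdr_two_pairs hX hX' hY hY' hZ hZ'
    (Finset.disjoint_left.2 fun x h h' => hx ⟨x, h, h'⟩)
    (Finset.disjoint_left.2 fun x h h' => hy ⟨x, h, h'⟩)
    (Or.inl (Finset.disjoint_left.2 fun x h h' => hz ⟨x, h, h'⟩))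
  refine ⟨f 0, h0, f 1, h1, f 2, h2, f 3, h3, f 4, h4, f 5, h5, ?_⟩
  simp [hf.eq_iff]

section FiveLists

variable {T₁ T₂ T₃ T₄ A B C : Finset (Fin 7)} {p q r : Prop}

/-- The colouring problem around a 5-cycle meeting the matching in two edges. -/
def FiveLists (T₁ T₂ T₃ T₄ A B C : Finset (Fin 7)) (p q r : Prop) : Prop :=
  ∃ t₁ ∈ T₁, ∃ t₂ ∈ T₂, ∃ t₃ ∈ T₃, ∃ t₄ ∈ T₄, ∃ a ∈ A, ∃ b ∈ B, ∃ c ∈ C,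
    (a ≠ b ∧ a ≠ c ∧ a ≠ t₁ ∧ a ≠ t₂ ∧ a ≠ t₃ ∧ a ≠ t₄) ∧
    (b ≠ c ∧ b ≠ t₁ ∧ b ≠ t₃ ∧ b ≠ t₄ ∧ c ≠ t₁ ∧ c ≠ t₂ ∧ c ≠ t₄) ∧
    (t₁ ≠ t₂ ∧ t₂ ≠ t₃ ∧ t₃ ≠ t₄) ∧ (p → t₁ ≠ t₃) ∧ (q → t₁ ≠ t₄) ∧ (r → t₂ ≠ t₄)

theorem FiveLists.mirror (h : FiveLists T₄ T₃ T₂ T₁ A C B r q p) :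
    FiveLists T₁ T₂ T₃ T₄ A B C p q r := by
  obtain ⟨t₄, m₄, t₃, m₃, t₂, m₂, t₁, m₁, a, ma, c, mc, b, mb, h1, h2, h3, h4, h5, h6⟩ := h
  exact ⟨t₁, m₁, t₂, m₂, t₃, m₃, t₄, m₄, a, ma, b, mb, c, mc, by grind, by grind, by grind,
    fun h => (h6 h).symm, fun h => (h5 h).symm, fun h => (h4 h).symm⟩

theorem FiveLists.of_four (hA : 5 ≤ A.card) {t₁ t₂ t₃ t₄ b c : Fin 7} (m₁ : t₁ ∈ T₁)
    (m₂ : t₂ ∈ T₂) (m₃ : t₃ ∈ T₃) (m₄ : t₄ ∈ T₄) (mb : b ∈ B) (mc : c ∈ C)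
    (u v w x : Fin 7)
    (hb : b ≠ c ∧ b ≠ t₁ ∧ b ≠ t₃ ∧ b ≠ t₄ ∧ c ≠ t₁ ∧ c ≠ t₂ ∧ c ≠ t₄)
    (ht : t₁ ≠ t₂ ∧ t₂ ≠ t₃ ∧ t₃ ≠ t₄) (hp : p → t₁ ≠ t₃) (hq : q → t₁ ≠ t₄)
    (hr : r → t₂ ≠ t₄)
    (hu : ∀ z, z = b ∨ z = c ∨ z = t₁ ∨ z = t₂ ∨ z = t₃ ∨ z = t₄ →
      z ∈ A → z = u ∨ z = v ∨ z = w ∨ z = x) :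
    FiveLists T₁ T₂ T₃ T₄ A B C p q r := by
  obtain ⟨a, ma, a1, a2, a3, a4⟩ := pick_four (L := A) (by omega) u v w x
  refine ⟨t₁, m₁, t₂, m₂, t₃, m₃, t₄, m₄, a, ma, b, mb, c, mc, ?_, hb, ht, hp, hq, hr⟩

  grind

theorem FiveLists.of_common (hA : 5 ≤ A.card) (hA' : A.card < 6) (hB : 4 ≤ B.card)
    (h₁ : 3 + (if p then 1 else 0) + (if q then 1 else 0) ≤ T₁.card)
    (h₂ : 3 + (if r then 1 else 0) ≤ T₂.card)
    (h₄ : 3 + (if q then 1 else 0) + (if r then 1 else 0) ≤ T₄.card)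
    {α : Fin 7} (hα : α ∈ C) (hα' : α ∈ T₃) : FiveLists T₁ T₂ T₃ T₄ A B C p q r := by
  by_cases hβ : ∃ β ∈ B, β ∈ T₂ ∧ β ≠ α
  · obtain ⟨β, hβ, hβ', hne⟩ := hβ
    obtain ⟨t₁, m₁, a1, a2, -, -⟩ := pick T₁ α β False False α α (by
      simp only [if_false]; omega)
    obtain ⟨t₄, m₄, b1, b2, b3, -⟩ := pick T₄ α β q False t₁ α (by
      simp only [if_false]; omega)
    exact .of_four hA m₁ hβ' hα' m₄ hβ hα α β t₁ t₄ (by grind) (by grind) (by grind)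
      (fun h => (b3 h).symm) (by grind) (by grind)
  push Not at hβ
  by_cases hαA : α ∈ A
  · obtain ⟨y, hy, hyA⟩ : ∃ y ∈ B ∪ T₂, y ∉ A := by
      refine Finset.exists_mem_notMem_of_card_lt_card ?_
      have h1 := Finset.card_union_add_card_inter B T₂
      have h2 : (B ∩ T₂).card ≤ ({α} : Finset (Fin 7)).card :=
        Finset.card_le_card fun z hz => by
          rw [Finset.mem_inter] at hz
          exact Finset.mem_singleton.2 (hβ z hz.1 hz.2)
      rw [Finset.card_singleton] at h2
      omega
    have hyα : y ≠ α := fun h => hyA (h ▸ hαA)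
    obtain ⟨t₁, m₁, a1, a2, -, -⟩ := pick T₁ α y False False α α (by
      simp only [if_false]; omega)
    rcases Finset.mem_union.1 hy with hy | hy
    · obtain ⟨t₄, m₄, b1, b2, b3, -⟩ := pick T₄ α y q False t₁ α (by
        simp only [if_false]; omega)
      obtain ⟨t₂, m₂, c1, c2, c3, -⟩ := pick T₂ α t₁ r False t₄ α (by
        simp only [if_false]; omega)
      exact .of_four hA m₁ m₂ hα' m₄ hy hα α t₁ t₂ t₄ (by grind) (by grind) (by grind)
        (fun h => (b3 h).symm) (by grind) (by grind)
    · obtain ⟨t₄, m₄, b1, -, b2, b3⟩ := pick T₄ α α q r t₁ y (by omega)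
      obtain ⟨b, mb, c1, c2, c3⟩ := pick_three (L := B) (by omega) α t₁ t₄
      exact .of_four hA m₁ hy hα' m₄ mb hα α b t₁ t₄ (by grind) (by grind) (by grind)
        (fun h => (b2 h).symm) (fun h => (b3 h).symm)
        (by grind)
  · obtain ⟨t₄, m₄, b1, -⟩ := pick T₄ α α False False α α (by
      simp only [if_false]; omega)
    obtain ⟨t₁, m₁, a1, -, a2, -⟩ := pick T₁ α α q False t₄ α (by
      simp only [if_false]; omega)
    obtain ⟨t₂, m₂, c1, c2, c3, -⟩ := pick T₂ α t₁ r False t₄ α (by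
      simp only [if_false]; omega)
    obtain ⟨b, mb, d1, d2, d3⟩ := pick_three (L := B) (by omega) α t₁ t₄
    exact .of_four hA m₁ m₂ hα' m₄ mb hα b t₁ t₂ t₄ (by grind) (by grind) (by grind)
      (by grind) (by grind) (by grind)

theorem FiveLists.of_split (hA : 5 ≤ A.card) (hB : 4 ≤ B.card)
    (h₁ : 3 + (if p then 1 else 0) + (if q then 1 else 0) ≤ T₁.card)
    (h₂ : 3 + (if r then 1 else 0) ≤ T₂.card)
    (h₄ : 3 + (if q then 1 else 0) + (if r then 1 else 0) ≤ T₄.card)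
    {y y' : Fin 7} (hyA : y ∉ A) (hyA' : y' ∉ A) (hy : y ∈ C) (hy' : y' ∈ T₃)
    (hBT : ∀ z ∈ B, z ∉ T₂) : FiveLists T₁ T₂ T₃ T₄ A B C p q r := by
  obtain ⟨t₄, m₄, a1, a2, -⟩ := pick T₄ y y' False False y y (by
    simp only [if_false]; omega)
  have fin : ∀ {t₁ t₂ b : Fin 7}, t₁ ∈ T₁ → t₂ ∈ T₂ → b ∈ B → t₁ ≠ y → t₁ ≠ t₂ →
      (p → t₁ ≠ y') → (q → t₁ ≠ t₄) → t₂ ≠ y → t₂ ≠ y' → (r → t₂ ≠ t₄) →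
      b ≠ y → b ≠ y' → b ≠ t₁ → b ≠ t₄ → FiveLists T₁ T₂ T₃ T₄ A B C p q r := by
    intro t₁ t₂ b m₁ m₂ mb b1 b2 b3 b4 c1 c2 c3 d1 d2 d3 d4
    exact .of_four hA m₁ m₂ hy' m₄ mb hy t₁ t₂ t₄ b (by grind) (by grind) b3 b4 c3
      (by grind)
  by_cases hb : y ∈ B
  · by_cases hb' : y' ∈ B
    · obtain ⟨b, mb, b1, b2, b3⟩ := pick_three (L := B) (by omega) y y' t₄
      obtain ⟨t₁, m₁, c1, c2, c3, c4⟩ := pick T₁ y b p q y' t₄ (by omega)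
      obtain ⟨t₂, m₂, d1, -, d2, -⟩ := pick T₂ t₁ t₁ r False t₄ y (by
        simp only [if_false]; omega)
      exact fin m₁ m₂ mb c1 d1.symm c3 c4 (fun h => hBT y hb (h ▸ m₂))
        (fun h => hBT y' hb' (h ▸ m₂)) d2 b1 b2 c2.symm b3
    · obtain ⟨t₁, m₁, c1, -, c3, c4⟩ := pick T₁ y y p q y' t₄ (by omega)
      obtain ⟨t₂, m₂, d1, d2, d3, -⟩ := pick T₂ t₁ y' r False t₄ y (by
        simp only [if_false]; omega)
      obtain ⟨b, mb, b1, b2, b3⟩ := pick_three (L := B) (by omega) y t₁ t₄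
      exact fin m₁ m₂ mb c1 d1.symm c3 c4 (fun h => hBT y hb (h ▸ m₂)) d2 d3 b1
        (fun h => hb' (h ▸ mb)) b2 b3
  · by_cases hb' : y' ∈ B
    · obtain ⟨t₁, m₁, c1, -, c3, c4⟩ := pick T₁ y y p q y' t₄ (by omega)
      obtain ⟨t₂, m₂, d1, d2, d3, -⟩ := pick T₂ t₁ y r False t₄ y (by
        simp only [if_false]; omega)
      obtain ⟨b, mb, b1, b2, b3⟩ := pick_three (L := B) (by omega) y' t₁ t₄
      exact fin m₁ m₂ mb c1 d1.symm c3 c4 d2 (fun h => hBT y' hb' (h ▸ m₂)) d3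
        (fun h => hb (h ▸ mb)) b1 b2 b3
    · obtain ⟨t₂, m₂, d1, d2, d3, -⟩ := pick T₂ y y' r False t₄ y (by
        simp only [if_false]; omega)
      obtain ⟨t₁, m₁, c1, c2, c3, c4⟩ := pick T₁ y t₂ p q y' t₄ (by omega)
      obtain ⟨b, mb, b1, b2⟩ := pick_two (L := B) (by omega) t₁ t₄
      exact fin m₁ m₂ mb c1 c2 c3 c4 d1 d2 d3 (fun h => hb (h ▸ mb))
        (fun h => hb' (h ▸ mb)) b1 b2

theorem FiveLists.of_left (hA : 5 ≤ A.card) (hB : 4 ≤ B.card)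
    (h₁ : 3 + (if p then 1 else 0) + (if q then 1 else 0) ≤ T₁.card)
    (h₂ : 3 + (if r then 1 else 0) ≤ T₂.card) (h₃ : 3 + (if p then 1 else 0) ≤ T₃.card)
    (h₄ : 3 + (if q then 1 else 0) + (if r then 1 else 0) ≤ T₄.card)
    {y y' : Fin 7} (hne : y ≠ y') (hyA : y ∉ A) (hyA' : y' ∉ A) (hy : y ∈ C) (hy' : y' ∈ C)
    (hBT : ∀ z ∈ B, z ∉ T₂) (hCT : ∀ z ∈ C, z ∉ T₃)
    (h : y ∈ B ∧ y' ∈ B ∨ y ∈ T₂ ∧ y' ∈ T₂) : FiveLists T₁ T₂ T₃ T₄ A B C p q r := by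
  obtain ⟨t₁, m₁, a1, a2, -⟩ := pick T₁ y y' False False y y (by
    simp only [if_false]; omega)
  rcases h with ⟨hb, hb'⟩ | ⟨hb, hb'⟩
  · obtain ⟨t₄, m₄, b1, b2, b3, -⟩ := pick T₄ y y' q False t₁ y (by
      simp only [if_false]; omega)
    obtain ⟨t₂, m₂, d1, -, d2, -⟩ := pick T₂ t₁ t₁ r False t₄ y (by
      simp only [if_false]; omega)
    obtain ⟨t₃, m₃, c1, c2, c3, -⟩ := pick T₃ t₂ t₄ p False t₁ y (by
      simp only [if_false]; omega)
    have e1 : y ≠ t₂ := fun h => hBT y hb (h ▸ m₂)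
    have e2 : y' ≠ t₃ := fun h => hCT y' hy' (h ▸ m₃)
    exact .of_four hA m₁ m₂ m₃ m₄ hb' hy t₁ t₂ t₃ t₄ (by grind) (by grind)
      (fun h => (c3 h).symm) (fun h => (b3 h).symm) d2
      (by grind)
  · obtain ⟨t₄, m₄, b1, -, b2, b3⟩ := pick T₄ y y q r t₁ y' (by omega)
    obtain ⟨t₃, m₃, c1, -, c3, -⟩ := pick T₃ t₄ t₄ p False t₁ y (by
      simp only [if_false]; omega)
    obtain ⟨b, mb, d1, d2, d3⟩ := pick_three (L := B) (by omega) t₁ t₃ t₄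
    have e1 : b ≠ y := fun h => hBT b mb (h ▸ hb)
    have e2 : y' ≠ t₃ := fun h => hCT y' hy' (h ▸ m₃)
    exact .of_four hA m₁ hb' m₃ m₄ mb hy t₁ t₃ t₄ b (by grind) (by grind)
      (fun h => (c3 h).symm) (fun h => (b2 h).symm) (fun h => (b3 h).symm)
      (by grind)

theorem FiveLists.of_right (hA : 5 ≤ A.card) (hB : 4 ≤ B.card) (hC : 4 ≤ C.card)
    (h₁ : 3 + (if p then 1 else 0) + (if q then 1 else 0) ≤ T₁.card)
    (h₄ : 3 + (if q then 1 else 0) + (if r then 1 else 0) ≤ T₄.card)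
    {y y' : Fin 7} (hne : y ≠ y') (hyA : y ∉ A) (hyA' : y' ∉ A) (hy : y ∈ T₃) (hy' : y' ∈ T₂)
    (hyB : y ∉ B) (hyC : y' ∉ C) : FiveLists T₁ T₂ T₃ T₄ A B C p q r := by
  obtain ⟨t₁, m₁, a1, -, a2, -⟩ := pick T₁ y' y' p False y y (by
    simp only [if_false]; omega)
  obtain ⟨t₄, m₄, b1, -, b2, b3⟩ := pick T₄ y y q r t₁ y' (by omega)
  obtain ⟨c, mc, c1, c2⟩ := pick_two (L := C) (by omega) t₁ t₄
  obtain ⟨b, mb, d1, d2, d3⟩ := pick_three (L := B) (by omega) c t₁ t₄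
  have e1 : b ≠ y := fun h => hyB (h ▸ mb)
  have e2 : c ≠ y' := fun h => hyC (h ▸ mc)
  exact .of_four hA m₁ hy' hy m₄ mb mc t₁ t₄ b c (by grind) (by grind)
    a2 (fun h => (b2 h).symm) (fun h => (b3 h).symm)
    (by grind)

/-- Colouring around a 5-cycle meeting the matching in two edges. -/
theorem five_lists_two (hA : 5 ≤ A.card) (hB : 4 ≤ B.card) (hC : 4 ≤ C.card)
    (h₁ : 3 + (if p then 1 else 0) + (if q then 1 else 0) ≤ T₁.card)
    (h₂ : 3 + (if r then 1 else 0) ≤ T₂.card) (h₃ : 3 + (if p then 1 else 0) ≤ T₃.card)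
    (h₄ : 3 + (if q then 1 else 0) + (if r then 1 else 0) ≤ T₄.card) :
    FiveLists T₁ T₂ T₃ T₄ A B C p q r := by
  obtain ⟨A', hsub, hA'⟩ := Finset.exists_subset_card_eq hA
  suffices h : FiveLists T₁ T₂ T₃ T₄ A' B C p q r by
    obtain ⟨t₁, m₁, t₂, m₂, t₃, m₃, t₄, m₄, a, ma, h⟩ := h
    exact ⟨t₁, m₁, t₂, m₂, t₃, m₃, t₄, m₄, a, hsub ma, h⟩
  by_cases hCT : ∃ α ∈ C, α ∈ T₃
  · obtain ⟨α, h, h'⟩ := hCT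
    exact .of_common hA'.ge (by omega) hB h₁ h₂ h₄ h h'
  by_cases hBT : ∃ α ∈ B, α ∈ T₂
  · obtain ⟨α, h, h'⟩ := hBT
    exact .mirror (.of_common hA'.ge (by omega) hC (by omega) (by omega) (by omega) h h')
  push Not at hCT hBT
  have cover : ∀ {X Y : Finset (Fin 7)}, 4 ≤ X.card → 3 ≤ Y.card → (∀ z ∈ X, z ∉ Y) →
      ∀ z, z ∈ X ∨ z ∈ Y := by
    intro X Y hX hY hXY z
    have h1 := Finset.card_union_of_disjoint (Finset.disjoint_left.2 fun z h => hXY z h)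
    have h2 : X ∪ Y = Finset.univ := by
      refine Finset.eq_univ_of_card _ (le_antisymm (Finset.card_le_univ _) ?_)
      rw [h1, Fintype.card_fin]
      omega
    exact Finset.mem_union.1 (h2 ▸ Finset.mem_univ z)
  obtain ⟨y, y', hne, hY⟩ := Finset.card_eq_two.1 (show A'ᶜ.card = 2 by
    rw [Finset.card_compl, hA', Fintype.card_fin])
  have hy : y ∉ A' := Finset.mem_compl.1 (hY ▸ by simp)
  have hy' : y' ∉ A' := Finset.mem_compl.1 (hY ▸ by simp)
  have c1 := cover hC (show 3 ≤ T₃.card by omega) hCT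
  have c2 := cover hB (show 3 ≤ T₂.card by omega) hBT
  have s1 : ∀ {u u'}, u ∉ A' → u' ∉ A' → u ∈ C → u' ∈ T₃ →
      FiveLists T₁ T₂ T₃ T₄ A' B C p q r := fun h1 h2 h3 h4 =>
    .of_split hA'.ge hB h₁ h₂ h₄ h1 h2 h3 h4 hBT
  have s2 : ∀ {u u'}, u ∉ A' → u' ∉ A' → u ∈ B → u' ∈ T₂ →
      FiveLists T₁ T₂ T₃ T₄ A' B C p q r := fun h1 h2 h3 h4 =>
    .mirror (.of_split hA'.ge hC (by omega) (by omega) (by omega) h1 h2 h3 h4 hCT)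
  rcases c1 y with a1 | a1 <;> rcases c1 y' with a2 | a2
  · rcases c2 y with b1 | b1 <;> rcases c2 y' with b2 | b2
    · exact .of_left hA'.ge hB h₁ h₂ h₃ h₄ hne hy hy' a1 a2 hBT hCT (Or.inl ⟨b1, b2⟩)
    · exact s2 hy hy' b1 b2
    · exact s2 hy' hy b2 b1
    · exact .of_left hA'.ge hB h₁ h₂ h₃ h₄ hne hy hy' a1 a2 hBT hCT (Or.inr ⟨b1, b2⟩)
  · exact s1 hy hy' a1 a2
  · exact s1 hy' hy a2 a1
  · rcases c2 y with b1 | b1 <;> rcases c2 y' with b2 | b2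
    · exact .mirror (.of_left hA'.ge hC (by omega) (by omega) (by omega) (by omega) hne hy hy'
        b1 b2 hCT hBT (Or.inr ⟨a1, a2⟩))
    · exact s2 hy hy' b1 b2
    · exact s2 hy' hy b2 b1
    · exact .of_right hA'.ge hB hC h₁ h₄ hne hy hy' a1 b2 (fun h => hBT y h b1)
        (fun h => hCT y' h a2)

end FiveLists

namespace Frame

variable (F : Frame G)

theorem inc_pair {u v w : V} (hu : F.N.Adj v u) (hw : F.N.Adj v w) (h : w ≠ u) :
    F.inc v = {s(v, u), s(v, w)} := by
  rw [F.inc_eq hu, ← F.eq_oth hu hw h]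

theorem side_pair {u v w p : V} (hv : F.N.Adj u v) (hw : F.N.Adj u w) (h : w ≠ v)
    (hp : F.N.Adj w p) (h' : p ≠ u) :
    F.side u v = {s(u, w), s(w, p)} ∪ F.inc (F.mt u) := by
  rw [side, ← F.eq_oth hv hw h, ← F.eq_oth hw.symm hp h']

variable [Fintype V]

theorem card_av_list {S : Set (Sym2 V)} {c : Sym2 V → Fin 7} {e : Sym2 V}
    (l : List (Sym2 V)) (hn : l.Nodup) (hl : ∀ f ∈ l, F.cf e f ∧ f ∉ S) :
    l.length ≤ (F.av S c e).card + 1 := by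
  rw [← List.toFinset_card_of_nodup hn]
  exact F.card_av _ fun f hf => hl f (List.mem_toFinset.1 hf)

/-- Completing a colouring of the edges off `Z` by a list of coloured edges touching `Z`. -/
theorem good_of_list {Z : Set V} {c : Sym2 V → Fin 7} (hc : F.PropOn (F.off Z) c)
    (l : List (Sym2 V × Fin 7)) (hl : ∀ p ∈ l, p.1 ∉ F.off Z ∧ p.2 ∈ F.av (F.off Z) c p.1)
    (hcov : ∀ v ∈ Z, ∀ e ∈ F.inc v, e ∈ l.map Prod.fst)
    (hp : l.Pairwise fun p q => F.cf p.1 q.1 → p.2 ≠ q.2) : F.Good := by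
  have hp' : ∀ p ∈ l, ∀ q ∈ l, F.cf p.1 q.1 → p.2 ≠ q.2 := by
    intro p hpl q hql
    have hsymm : Std.Symm fun p q : Sym2 V × Fin 7 => F.cf p.1 q.1 → p.2 ≠ q.2 :=
      ⟨fun _ _ h h' => (h (F.cf_symm h')).symm⟩
    exact hp.forall_of_forall (fun p _ h => absurd h (F.cf_irrefl _)) hpl hql
  let T : Set (Sym2 V) := {e | ∃ x, (e, x) ∈ l}
  let g : Sym2 V → Fin 7 := fun e => if h : ∃ x, (e, x) ∈ l then h.choose else 0
  have hg : ∀ e ∈ T, (e, g e) ∈ l := fun e he => by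
    have : g e = he.choose := dif_pos he
    rw [this]
    exact he.choose_spec
  refine F.good_of_off (Z := Z) (T := T) (fun v hv e he => by
    obtain ⟨p, hp, rfl⟩ := List.mem_map.1 (hcov v hv e he)
    exact ⟨p.2, hp⟩)
    (F.propOn_union hc (fun e he => (hl _ (hg e he)).1) (fun e he => (hl _ (hg e he)).2)
      fun e he f hf hef => hp' _ (hg e he) _ (hg f hf) hef)

end Frame

/-- A 4-cycle `a b c d` meeting the matching in `ab` and `cd`, with the outer neighbours
`wa, …` and second neighbours `pa, …` of its vertices. -/
structure FourCycle {V : Type} {G : SimpleGraph V} (F : Frame G)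
    (a b c d wa wb wc wd pa pb pc pd : V) : Prop where
  cliqueFree : ∀ x y z, G.Adj x y → G.Adj y z → ¬ G.Adj x z
  ab : G.Adj a b
  cd : G.Adj c d
  mt_a : F.mt a = b
  mt_c : F.mt c = d
  bc : F.N.Adj b c
  da : F.N.Adj d a
  awa : F.N.Adj a wa
  wa_ne : wa ≠ d
  bwb : F.N.Adj b wb
  wb_ne : wb ≠ c
  cwc : F.N.Adj c wc
  wc_ne : wc ≠ b
  dwd : F.N.Adj d wd
  wd_ne : wd ≠ a
  wpa : F.N.Adj wa pa
  pa_ne : pa ≠ a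
  wpb : F.N.Adj wb pb
  pb_ne : pb ≠ b
  wpc : F.N.Adj wc pc
  pc_ne : pc ≠ c
  wpd : F.N.Adj wd pd
  pd_ne : pd ≠ d

namespace FourCycle

variable {F : Frame G}
  {a b c d wa wb wc wd pa pb pc pd : V}

theorem rot (h : FourCycle F a b c d wa wb wc wd pa pb pc pd) :
    FourCycle F c d a b wc wd wa wb pc pd pa pb :=
  ⟨h.cliqueFree, h.cd, h.ab, h.mt_c, h.mt_a, h.da, h.bc, h.cwc, h.wc_ne, h.dwd, h.wd_ne, h.awa,
    h.wa_ne,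
    h.bwb, h.wb_ne, h.wpc, h.pc_ne, h.wpd, h.pd_ne, h.wpa, h.pa_ne, h.wpb, h.pb_ne⟩

theorem refl (h : FourCycle F a b c d wa wb wc wd pa pb pc pd) :
    FourCycle F b a d c wb wa wd wc pb pa pd pc :=
  ⟨h.cliqueFree, h.ab.symm, h.cd.symm, F.mt_eq_comm.1 h.mt_a, F.mt_eq_comm.1 h.mt_c, h.da.symm,
    h.bc.symm, h.bwb, h.wb_ne, h.awa, h.wa_ne, h.dwd, h.wd_ne, h.cwc, h.wc_ne, h.wpb,
    h.pb_ne, h.wpa, h.pa_ne, h.wpd, h.pd_ne, h.wpc, h.pc_ne⟩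

theorem distinct (h : FourCycle F a b c d wa wb wc wd pa pb pc pd) :
    a ≠ b ∧ a ≠ c ∧ a ≠ d ∧ b ≠ c ∧ b ≠ d ∧ c ≠ d := by
  have hac : a ≠ c := by
    rintro rfl
    exact h.bc.2 (F.mt_eq_comm.1 h.mt_a).symm
  have hbd : b ≠ d := by
    rintro rfl
    exact hac ((F.mt_eq_comm.1 h.mt_a).symm.trans (F.mt_eq_comm.1 h.mt_c))
  exact ⟨h.ab.ne, hac, h.da.1.ne.symm, h.bc.1.ne, hbd, h.cd.ne⟩

theorem wa_outside (h : FourCycle F a b c d wa wb wc wd pa pb pc pd) :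
    wa ≠ a ∧ wa ≠ b ∧ wa ≠ c ∧ wa ≠ d ∧ wa ≠ wb ∧ wa ≠ wd := by
  refine ⟨h.awa.1.ne.symm, ?_, ?_, h.wa_ne, ?_, ?_⟩
  · rintro rfl
    exact h.awa.2 h.mt_a.symm
  · rintro rfl
    exact h.cliqueFree _ _ _ h.ab h.bc.1 h.awa.1
  · rintro rfl
    exact h.cliqueFree _ _ _ h.ab h.bwb.1 h.awa.1
  · rintro rfl
    exact h.cliqueFree _ _ _ h.da.1.symm h.dwd.1 h.awa.1

theorem adj_iff (h : FourCycle F a b c d wa wb wc wd pa pb pc pd) {w : V} :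
    G.Adj a w ↔ w = b ∨ w = d ∨ w = wa := by
  constructor
  · intro hw
    rcases F.adj_cases hw with rfl | hw
    · exact Or.inl h.mt_a
    · rw [F.eq_oth h.da.symm h.awa h.wa_ne]
      exact Or.inr (F.eq_or_eq_oth h.da.symm hw)
  · rintro (rfl | rfl | rfl)
    exacts [h.ab, h.da.1.symm, h.awa.1]

theorem notMem_off {v w : V} (hv : v = a ∨ v = b ∨ v = c ∨ v = d) :
    s(v, w) ∉ F.off {a, b, c, d} :=
  F.notMem_off (v := v) (by simp) (by simp [hv])

theorem notMem_off' {v w : V} (hv : v = a ∨ v = b ∨ v = c ∨ v = d) :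
    s(w, v) ∉ F.off {a, b, c, d} :=
  F.notMem_off (v := v) (by simp) (by simp [hv])

/-- The conflicts of the cycle edge `bc` outside the cycle. -/
theorem eq_of_cf_bc (h : FourCycle F a b c d wa wb wc wd pa pb pc pd) {f : Sym2 V}
    (hf : f ∈ F.off {a, b, c, d}) (hcf : F.cf s(b, c) f) : f = s(wb, pb) ∨ f = s(wc, pc) := by
  have hs := F.mem_side_of_cf hcf
  rw [F.side_pair h.bc h.bwb h.wb_ne h.wpb h.pb_ne,
    F.side_pair h.bc.symm h.cwc h.wc_ne h.wpc h.pc_ne, F.mt_eq_comm.1 h.mt_a, h.mt_c,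
    F.inc_pair h.da.symm h.awa h.wa_ne, F.inc_pair h.da h.dwd h.wd_ne] at hs
  simp only [Finset.mem_union, Finset.mem_insert, Finset.mem_singleton] at hs
  rcases hs with ((hs | hs) | hs | hs) | (hs | hs) | hs | hs
  · exact absurd (hs ▸ hf) (notMem_off (by simp))
  · exact Or.inl hs
  · exact absurd (hs ▸ hf) (notMem_off (by simp))
  · exact absurd (hs ▸ hf) (notMem_off (by simp))
  · exact absurd (hs ▸ hf) (notMem_off (by simp))
  · exact Or.inr hs
  · exact absurd (hs ▸ hf) (notMem_off (by simp))
  · exact absurd (hs ▸ hf) (notMem_off (by simp))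

theorem eq_of_cf_da (h : FourCycle F a b c d wa wb wc wd pa pb pc pd) {f : Sym2 V}
    (hf : f ∈ F.off {a, b, c, d}) (hcf : F.cf s(d, a) f) : f = s(wa, pa) ∨ f = s(wd, pd) := by
  refine (h.rot.eq_of_cf_bc ?_ hcf).symm
  convert hf using 2
  ext x; simp; tauto

/-- The frame obtained by switching the matching along the 4-cycle. -/
theorem exists_switch (h : FourCycle F a b c d wa wb wc wd pa pb pc pd) :
    ∃ F' : Frame G, FourCycle F' d a b c wd wa wb wc pd pa pb pc ∧
      (∀ v, v ≠ a → v ≠ b → v ≠ c → v ≠ d → F'.mt v = F.mt v) := by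
  have hd := h.distinct
  have hb := F.mt_eq_comm.1 h.mt_a
  have hdc := F.mt_eq_comm.1 h.mt_c
  have hm : ∀ v, v ≠ a → v ≠ b → v ≠ c → v ≠ d →
      F.mt v ≠ a ∧ F.mt v ≠ b ∧ F.mt v ≠ c ∧ F.mt v ≠ d := by
    intro v va vb vc vd
    refine ⟨fun h' => ?_, fun h' => ?_, fun h' => ?_, fun h' => ?_⟩ <;>
      have := F.mt_eq_comm.1 h' <;> grind [h.mt_a, h.mt_c]
  let m : V → V := fun v => if v = a then d else if v = b then c else if v = c then b else
    if v = d then a else F.mt v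
  have e1 : m a = d := by grind
  have e2 : m b = c := by grind
  have e3 : m c = b := by grind
  have e4 : m d = a := by grind
  have e5 : ∀ v, v ≠ a → v ≠ b → v ≠ c → v ≠ d → m v = F.mt v := by grind
  have hcase : ∀ v, v = a ∨ v = b ∨ v = c ∨ v = d ∨ v ≠ a ∧ v ≠ b ∧ v ≠ c ∧ v ≠ d := by grind
  have outer : ∀ {x y : V}, (x ≠ a ∧ x ≠ b ∧ x ≠ c ∧ x ≠ d) → F.N.Adj x y →
      (G.Adj x y ∧ y ≠ m x) := by
    rintro x y ⟨xa, xb, xc, xd⟩ hxy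
    rw [e5 x xa xb xc xd]
    exact hxy
  let F' : Frame G := {
    mt := m
    mt_mt := by
      intro v
      rcases hcase v with rfl | rfl | rfl | rfl | ⟨va, vb, vc, vd⟩
      · rw [e1, e4]
      · rw [e2, e3]
      · rw [e3, e2]
      · rw [e4, e1]
      · obtain ⟨h1, h2, h3, h4⟩ := hm v va vb vc vd
        rw [e5 v va vb vc vd, e5 _ h1 h2 h3 h4, F.mt_mt]
    adj_mt := by
      intro v hv
      rcases hcase v with rfl | rfl | rfl | rfl | ⟨va, vb, vc, vd⟩
      · rw [e1]; exact h.da.1.symm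
      · rw [e2]; exact h.bc.1
      · rw [e3]; exact h.bc.1.symm
      · rw [e4]; exact h.da.1
      · rw [e5 v va vb vc vd] at hv ⊢
        exact F.adj_mt v hv
    two := by
      intro v
      rcases hcase v with rfl | rfl | rfl | rfl | ⟨va, vb, vc, vd⟩
      · exact ⟨b, wa, h.wa_outside.2.1.symm, fun w => by
          rw [e1, h.adj_iff]; grind [h.wa_ne]⟩
      · exact ⟨a, wb, h.refl.wa_outside.2.1.symm, fun w => by
          rw [e2, h.refl.adj_iff]; grind [h.wb_ne]⟩
      · exact ⟨d, wc, h.rot.wa_outside.2.1.symm, fun w => by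
          rw [e3, h.rot.adj_iff]; grind [h.wc_ne]⟩
      · exact ⟨c, wd, h.rot.refl.wa_outside.2.1.symm, fun w => by
          rw [e4, h.rot.refl.adj_iff]; grind [h.wd_ne]⟩
      · rw [e5 v va vb vc vd]
        exact F.two v }
  have hwa := h.wa_outside
  have hwb := h.refl.wa_outside
  have hwc := h.rot.wa_outside
  have hwd := h.rot.refl.wa_outside
  refine ⟨F', ⟨h.cliqueFree, h.da.1, h.bc.1, e4, e2, ⟨h.ab, ?_⟩, ⟨h.cd, ?_⟩, ⟨h.dwd.1, ?_⟩, ?_,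
    ⟨h.awa.1, ?_⟩, ?_, ⟨h.bwb.1, ?_⟩, ?_, ⟨h.cwc.1, ?_⟩, ?_, outer (by tauto) h.wpd, h.pd_ne,
    outer (by tauto) h.wpa, h.pa_ne, outer (by tauto) h.wpb, h.pb_ne, outer (by tauto) h.wpc,
    h.pc_ne⟩, e5⟩
  all_goals (try change _ ≠ m _); grind

variable [Fintype V]

theorem card_av_pendant (h : FourCycle F a b c d wa wb wc wd pa pb pc pd)
    (col : Sym2 V → Fin 7) : 3 + (if F.cf s(a, wa) s(c, wc) then 1 else 0) ≤
      (F.av (F.off {a, b, c, d}) col s(a, wa)).card := by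
  have hd := h.distinct
  have hw := h.wa_outside
  have hwb := h.refl.wa_outside
  have hwc := h.rot.wa_outside
  have hwd := h.rot.refl.wa_outside
  have h1 : F.cf s(a, wa) s(b, c) :=
    F.cf_mk h.awa h.bc (by grind [Sym2.eq_iff]) (by simp [h.ab])
  have h2 : F.cf s(a, wa) s(d, a) :=
    F.cf_mk h.awa h.da (by grind [Sym2.eq_iff]) (by simp)
  have h3 : F.cf s(a, wa) s(b, wb) :=
    F.cf_mk h.awa h.bwb (by grind [Sym2.eq_iff]) (by simp [h.ab])
  have h4 : F.cf s(a, wa) s(d, wd) :=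
    F.cf_mk h.awa h.dwd (by grind [Sym2.eq_iff]) (by simp [h.da.1.symm])
  by_cases h5 : F.cf s(a, wa) s(c, wc)
  · have := F.card_av_list (S := F.off {a, b, c, d}) (c := col)
      [s(b, c), s(d, a), s(b, wb), s(d, wd), s(c, wc)] (by simp; grind [Sym2.eq_iff]) (by
        simp only [List.mem_cons, List.not_mem_nil, or_false]
        rintro f (rfl | rfl | rfl | rfl | rfl)
        exacts [⟨h1, notMem_off (by simp)⟩, ⟨h2, notMem_off (by simp)⟩,
          ⟨h3, notMem_off (by simp)⟩, ⟨h4, notMem_off (by simp)⟩, ⟨h5, notMem_off (by simp)⟩])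
    simpa [h5] using this
  · have := F.card_av_list (S := F.off {a, b, c, d}) (c := col)
      [s(b, c), s(d, a), s(b, wb), s(d, wd)] (by simp; grind [Sym2.eq_iff]) (by
        simp only [List.mem_cons, List.not_mem_nil, or_false]
        rintro f (rfl | rfl | rfl | rfl)
        exacts [⟨h1, notMem_off (by simp)⟩, ⟨h2, notMem_off (by simp)⟩,
          ⟨h3, notMem_off (by simp)⟩, ⟨h4, notMem_off (by simp)⟩])
    simpa [h5] using this

theorem five_le_card_av_bc (h : FourCycle F a b c d wa wb wc wd pa pb pc pd)
    (col : Sym2 V → Fin 7) : 5 ≤ (F.av (F.off {a, b, c, d}) col s(b, c)).card := by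
  have h1 := F.card_av_of_image (c := col) {col s(wb, pb), col s(wc, pc)} fun f hf hcf => by
    rcases h.eq_of_cf_bc hf hcf with rfl | rfl <;> simp
  have h2 := Finset.card_le_two (a := col s(wb, pb)) (b := col s(wc, pc))
  omega

theorem good_of_lists (h : FourCycle F a b c d wa wb wc wd pa pb pc pd) {col : Sym2 V → Fin 7}
    (hc : F.PropOn (F.off {a, b, c, d}) col) {x₁ x₂ x₃ x₄ y z : Fin 7}
    (m₁ : x₁ ∈ F.av (F.off {a, b, c, d}) col s(a, wa))
    (m₂ : x₂ ∈ F.av (F.off {a, b, c, d}) col s(b, wb))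
    (m₃ : x₃ ∈ F.av (F.off {a, b, c, d}) col s(c, wc))
    (m₄ : x₄ ∈ F.av (F.off {a, b, c, d}) col s(d, wd))
    (my : y ∈ F.av (F.off {a, b, c, d}) col s(b, c))
    (mz : z ∈ F.av (F.off {a, b, c, d}) col s(d, a))
    (h₁ : x₁ ≠ x₂ ∧ x₂ ≠ x₃ ∧ x₃ ≠ x₄ ∧ x₁ ≠ x₄) (h₂ : F.cf s(a, wa) s(c, wc) → x₁ ≠ x₃)
    (h₃ : F.cf s(b, wb) s(d, wd) → x₂ ≠ x₄)
    (h₄ : x₁ ≠ y ∧ x₂ ≠ y ∧ x₃ ≠ y ∧ x₄ ≠ y ∧ x₁ ≠ z ∧ x₂ ≠ z ∧ x₃ ≠ z ∧ x₄ ≠ z ∧ y ≠ z) :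
    F.Good := by
  refine F.good_of_list hc [(s(a, wa), x₁), (s(b, wb), x₂), (s(c, wc), x₃), (s(d, wd), x₄),
    (s(b, c), y), (s(d, a), z)] ?_ ?_ ?_
  · simp only [List.mem_cons, List.not_mem_nil, or_false]
    rintro p (rfl | rfl | rfl | rfl | rfl | rfl)
    exacts [⟨notMem_off (by simp), m₁⟩, ⟨notMem_off (by simp), m₂⟩,
      ⟨notMem_off (by simp), m₃⟩, ⟨notMem_off (by simp), m₄⟩, ⟨notMem_off (by simp), my⟩,
      ⟨notMem_off (by simp), mz⟩]
  · have ia := F.inc_pair h.da.symm h.awa h.wa_ne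
    have ib := F.inc_pair h.bc h.bwb h.wb_ne
    have ic := F.inc_pair h.bc.symm h.cwc h.wc_ne
    have id := F.inc_pair h.da h.dwd h.wd_ne
    rw [Sym2.eq_swap] at ia ic
    rintro v (rfl | rfl | rfl | rfl) e he
    all_goals
      simp only [ia, ib, ic, id, Finset.mem_insert, Finset.mem_singleton] at he
      rcases he with rfl | rfl <;> simp only [List.map_cons, List.mem_cons, true_or, or_true]
  · simp only [List.pairwise_cons, List.mem_cons, List.not_mem_nil, or_false, List.Pairwise.nil]
    simp
    grind

theorem card_av_pendants (h : FourCycle F a b c d wa wb wc wd pa pb pc pd)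
    (col : Sym2 V → Fin 7) :
    3 + (if F.cf s(a, wa) s(c, wc) then 1 else 0) ≤
      (F.av (F.off {a, b, c, d}) col s(a, wa)).card ∧
    3 + (if F.cf s(b, wb) s(d, wd) then 1 else 0) ≤
      (F.av (F.off {a, b, c, d}) col s(b, wb)).card ∧
    3 + (if F.cf s(a, wa) s(c, wc) then 1 else 0) ≤
      (F.av (F.off {a, b, c, d}) col s(c, wc)).card ∧
    3 + (if F.cf s(b, wb) s(d, wd) then 1 else 0) ≤
      (F.av (F.off {a, b, c, d}) col s(d, wd)).card := by
  have h2 := h.refl.card_av_pendant col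
  have h3 := h.rot.card_av_pendant col
  have h4 := h.rot.refl.card_av_pendant col
  rw [show ({b, a, d, c} : Set V) = {a, b, c, d} by grind] at h2
  rw [show ({c, d, a, b} : Set V) = {a, b, c, d} by grind, F.cf_comm] at h3
  rw [show ({d, c, b, a} : Set V) = {a, b, c, d} by grind, F.cf_comm] at h4
  exact ⟨h.card_av_pendant col, h2, h3, h4⟩

theorem five_le_card_av_da (h : FourCycle F a b c d wa wb wc wd pa pb pc pd)
    (col : Sym2 V → Fin 7) : 5 ≤ (F.av (F.off {a, b, c, d}) col s(d, a)).card := by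
  have := h.rot.five_le_card_av_bc col
  rwa [show ({c, d, a, b} : Set V) = {a, b, c, d} by grind] at this

theorem good_of_not_cf (h : FourCycle F a b c d wa wb wc wd pa pb pc pd) (hG : G.Connected)
    (hn : ¬ F.cf s(a, wa) s(c, wc)) : F.Good := by
  obtain ⟨col, hc⟩ := F.flow_connected hG (Z := {a, b, c, d}) ⟨a, by simp⟩
  obtain ⟨l₁, l₂, l₃, l₄⟩ := h.card_av_pendants col
  obtain ⟨x₁, m₁, x₂, m₂, x₃, m₃, x₄, m₄, y, my, z, mz, q⟩ := four_lists (le_of_add_le_left l₁)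
    (le_of_add_le_left l₂) (le_of_add_le_left l₃) l₄ (h.five_le_card_av_bc col)
    (h.five_le_card_av_da col)
  exact h.good_of_lists hc m₁ m₂ m₃ m₄ my mz (by grind) (fun h => absurd h hn) (by grind)
    (by grind)

theorem good_of_cf (h : FourCycle F a b c d wa wb wc wd pa pb pc pd)
    (h₁ : F.cf s(a, wa) s(c, wc)) (h₂ : F.cf s(b, wb) s(d, wd)) {col : Sym2 V → Fin 7}
    (hc : F.PropOn (F.off {a, b, c, d}) col)
    (hB : 6 ≤ (F.av (F.off {a, b, c, d}) col s(d, a)).card ∨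
      ∃ y ∈ F.av (F.off {a, b, c, d}) col s(b, c),
        y ∉ F.av (F.off {a, b, c, d}) col s(d, a)) : F.Good := by
  obtain ⟨l₁, l₂, l₃, l₄⟩ := h.card_av_pendants col
  rw [if_pos h₁] at l₁ l₃
  rw [if_pos h₂] at l₂ l₄
  obtain ⟨x₁, m₁, x₂, m₂, x₃, m₃, x₄, m₄, y, my, z, mz, q⟩ := six_lists l₁ l₂ l₃ l₄
    (h.five_le_card_av_bc col) (h.five_le_card_av_da col) hB
  exact h.good_of_lists hc m₁ m₂ m₃ m₄ my mz (by grind) (by grind) (by grind) (by grind)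

theorem good_of_eq (h : FourCycle F a b c d wa wb wc wd pa pb pc pd) (hG : G.Connected)
    (hw : wa = wc) : F.Good := by
  by_cases h₁ : F.cf s(a, wa) s(c, wc)
  swap
  · exact h.good_of_not_cf hG h₁
  by_cases h₂ : F.cf s(b, wb) s(d, wd)
  swap
  · exact h.refl.good_of_not_cf hG h₂
  obtain ⟨col, hc⟩ := F.flow_connected hG (Z := {a, b, c, d}) ⟨a, by simp⟩
  refine h.good_of_cf h₁ h₂ hc (Or.inl ?_)
  have h3 := F.card_av_of_image (S := F.off {a, b, c, d}) (e := s(d, a)) (c := col)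
    {col s(wd, pd)} fun f hf hcf => by
      rcases h.eq_of_cf_da hf hcf with rfl | rfl
      · have : pa = c := by
          rw [F.eq_oth h.awa.symm h.wpa h.pa_ne]
          exact (F.eq_oth h.awa.symm (hw ▸ h.cwc.symm) h.distinct.2.1.symm).symm
        exact absurd hf (this ▸ notMem_off' (by simp))
      · simp
  rw [Finset.card_singleton] at h3
  omega

theorem good_of_mt_eq (h : FourCycle F a b c d wa wb wc wd pa pb pc pd) (hG : G.Connected)
    (hw : F.mt wa = wc) : ∃ F' : Frame G, F'.Good := by
  by_cases h₁ : F.cf s(a, wa) s(c, wc)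
  swap
  · exact ⟨F, h.good_of_not_cf hG h₁⟩
  by_cases h₂ : F.cf s(b, wb) s(d, wd)
  swap
  · exact ⟨F, h.refl.good_of_not_cf hG h₂⟩
  by_cases hwbd : wb = wd
  · exact ⟨F, h.refl.good_of_eq hG hwbd⟩
  obtain ⟨col, hc⟩ := F.flow_connected hG (Z := {a, b, c, d}) ⟨a, by simp⟩
  change F.PropOn (F.off {a, b, c, d}) col at hc
  by_cases hB : 6 ≤ (F.av (F.off {a, b, c, d}) col s(d, a)).card ∨
      ∃ y ∈ F.av (F.off {a, b, c, d}) col s(b, c), y ∉ F.av (F.off {a, b, c, d}) col s(d, a)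
  · exact ⟨F, h.good_of_cf h₁ h₂ hc hB⟩
  push Not at hB
  by_cases hac : wa = wc
  · exact ⟨F, h.good_of_eq hG hac⟩
  have hadj : G.Adj wa wc := by
    have := F.adj_mt wa (by rw [hw]; exact Ne.symm hac)
    rwa [hw] at this
  have hwa := h.wa_outside
  have hwb := h.refl.wa_outside
  have hwc := h.rot.wa_outside
  have hwd := h.rot.refl.wa_outside
  have oa : s(wa, pa) ∈ F.off {a, b, c, d} := by
    refine ⟨h.wpa, ?_⟩
    have e1 : pa ≠ b := fun e => by have := h.refl.adj_iff.1 (e ▸ h.wpa.1.symm); tauto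
    have e2 : pa ≠ c := fun e => by have := h.rot.adj_iff.1 (e ▸ h.wpa.1.symm); tauto
    have e3 : pa ≠ d := fun e => by have := h.rot.refl.adj_iff.1 (e ▸ h.wpa.1.symm); tauto
    simp [h.pa_ne, hwa, e1, e2, e3]
  have oc : s(wc, pc) ∈ F.off {a, b, c, d} := by
    refine ⟨h.wpc, ?_⟩
    have e1 : pc ≠ b := fun e => by have := h.refl.adj_iff.1 (e ▸ h.wpc.1.symm); tauto
    have e2 : pc ≠ a := fun e => by have := h.adj_iff.1 (e ▸ h.wpc.1.symm); tauto
    have e3 : pc ≠ d := fun e => by have := h.rot.refl.adj_iff.1 (e ▸ h.wpc.1.symm); tauto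
    simp [h.pc_ne, hwc, e1, e2, e3]
  have hpc : pa ≠ wc := fun e => h.wpa.2 (e.trans hw.symm)
  have hqac : col s(wa, pa) ≠ col s(wc, pc) :=
    hc _ oa _ oc (F.cf_mk h.wpa h.wpc (by grind [Sym2.eq_iff]) (by simp [hadj]))
  have hqab : col s(wa, pa) = col s(wb, pb) := by
    have h3 : col s(wa, pa) ∉ F.av (F.off {a, b, c, d}) col s(d, a) := fun hm =>
      F.mem_av.1 hm _ oa (F.cf_mk h.da h.wpa (by grind [Sym2.eq_iff]) (by simp [h.awa.1])) rfl
    have h4 : col s(wa, pa) ∉ F.av (F.off {a, b, c, d}) col s(b, c) := fun hm => h3 (hB.2 _ hm)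
    rw [F.mem_av] at h4
    push Not at h4
    obtain ⟨f, hf, hcf, hcol⟩ := h4
    rcases h.eq_of_cf_bc hf hcf with rfl | rfl
    · exact hcol.symm
    · exact absurd hcol.symm hqac
  obtain ⟨F', h', hmt⟩ := h.exists_switch
  have hoff : ∀ e ∈ F'.off {b, c, d, a}, e ∈ F.off {a, b, c, d} := by
    rintro e ⟨he, heZ⟩
    induction e with | _ x y =>
    have hx := heZ x (by simp)
    have hy := heZ y (by simp)
    simp only [Set.mem_insert_iff, Set.mem_singleton_iff, not_or] at hx hy
    refine ⟨⟨he.1, ?_⟩, by simp; tauto⟩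
    rw [← hmt x (by tauto) (by tauto) (by tauto) (by tauto)]
    exact he.2
  have hc' : F'.PropOn (F'.off {b, c, d, a}) col := fun e he f hf hef =>
    hc e (hoff e he) f (hoff f hf) ⟨(hoff e he).1, (hoff f hf).1, hef.2.2⟩
  have hr := h'.rot
  refine ⟨F', hr.good_of_cf (F'.cf_mk_iff.2 ⟨hr.awa, hr.cwc, (F.cf_mk_iff.1 h₂).2.2⟩)
    (F'.cf_symm (F'.cf_mk_iff.2 ⟨hr.dwd, hr.bwb, (F.cf_mk_iff.1 h₁).2.2⟩)) hc' (Or.inl ?_)⟩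
  have h3 := F'.card_av_of_image (S := F'.off {b, c, d, a}) (e := s(a, b)) (c := col)
    {col s(wa, pa)} fun f hf hcf => by
      rcases hr.eq_of_cf_da hf hcf with rfl | rfl
      · simp [hqab]
      · simp
  rw [Finset.card_singleton] at h3
  omega

/-- A frame containing a suitable 4-cycle can be coloured, possibly after switching. -/
theorem exists_good (h : FourCycle F a b c d wa wb wc wd pa pb pc pd) (hG : G.Connected)
    (hw : wa = wc ∨ wb = wd ∨ ¬ G.Adj wa wc ∨ ¬ G.Adj wb wd ∨ F.mt wa = wc) :
    ∃ F' : Frame G, F'.Good := by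
  have key : ∀ {a b c d wa wb wc wd pa pb pc pd},
      FourCycle F a b c d wa wb wc wd pa pb pc pd → wa ≠ wc → ¬ G.Adj wa wc → F.Good := by
    intro a b c d wa wb wc wd pa pb pc pd h hne hn
    have hwa := h.wa_outside
    have hwc := h.rot.wa_outside
    refine h.good_of_not_cf hG fun hcf => ?_
    have h1 := (F.cf_mk_iff.1 hcf).2.2.2
    rw [h.adj_iff, h.adj_iff, G.adj_comm wa c, h.rot.adj_iff] at h1
    have := h.distinct
    grind
  rcases hw with hw | hw | hw | hw | hw
  · exact ⟨F, h.good_of_eq hG hw⟩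
  · exact ⟨F, h.refl.good_of_eq hG hw⟩
  · by_cases hac : wa = wc
    · exact ⟨F, h.good_of_eq hG hac⟩
    · exact ⟨F, key h hac hw⟩
  · by_cases hbd : wb = wd
    · exact ⟨F, h.refl.good_of_eq hG hbd⟩
    · exact ⟨F, key h.refl hbd hw⟩
  · exact h.good_of_mt_eq hG hw

end FourCycle

namespace Frame

variable (F : Frame G)

theorem exists_N_ne (v u : V) : ∃ w, F.N.Adj v w ∧ w ≠ u :=
  ⟨F.oth u v, F.N_adj_oth u v, F.oth_ne u v⟩

variable [Fintype V]

/-- A 5-cycle in which `a b` is the only matching edge. -/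
theorem good_of_fiveCycle_one (hG : G.Connected)
    (h3 : ∀ x y z, G.Adj x y → G.Adj y z → ¬ G.Adj x z)
    (h4 : ∀ x y z w, G.Adj x y → G.Adj y z → G.Adj z w → G.Adj w x → x = z ∨ y = w)
    {a b c d e w x : V} (ha : F.mt a = b) (hab : G.Adj a b) (hbc : F.N.Adj b c)
    (hcd : F.N.Adj c d) (hde : F.N.Adj d e) (hea : F.N.Adj e a) (haw : F.N.Adj a w) (hw : w ≠ e)
    (hbx : F.N.Adj b x) (hx : x ≠ c) : F.Good := by
  have hb := F.mt_eq_comm.1 ha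
  have e1 : a ≠ c := by rintro rfl; exact hbc.2 hb.symm
  have e2 : b ≠ d := by rintro rfl; exact h3 _ _ _ hab hde.1 hea.1.symm
  have e3 : c ≠ e := by rintro rfl; exact h3 _ _ _ hab hbc.1 hea.1.symm
  have e4 : a ≠ d := by rintro rfl; exact h3 _ _ _ hab hbc.1 hcd.1.symm
  have e5 : b ≠ e := by rintro rfl; exact hea.2 hb.symm
  have e6 := hab.ne
  have e7 := hbc.1.ne
  have e8 := hcd.1.ne
  have e9 := hde.1.ne
  have e10 := hea.1.ne
  have w1 : w ≠ a := haw.1.ne.symm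
  have w2 : w ≠ b := fun h => haw.2 (h.trans ha.symm)
  have w3 : w ≠ c := by rintro rfl; exact h3 _ _ _ hab hbc.1 haw.1
  have w4 : w ≠ d := by rintro rfl; exact h3 _ _ _ hde.1 hea.1 haw.1.symm
  have x1 : x ≠ b := hbx.1.ne.symm
  have x2 : x ≠ a := fun h => hbx.2 (h.trans hb.symm)
  have x3 : x ≠ d := by rintro rfl; exact h3 _ _ _ hbc.1 hcd.1 hbx.1
  have x4 : x ≠ e := by rintro rfl; exact h3 _ _ _ hab hbx.1 hea.1.symm
  have nac : ¬ G.Adj a c := h3 _ _ _ hab hbc.1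
  have nad : ¬ G.Adj a d := h3 _ _ _ hea.1.symm hde.1.symm
  have nbd : ¬ G.Adj b d := h3 _ _ _ hbc.1 hcd.1
  have nbe : ¬ G.Adj b e := h3 _ _ _ hab.symm hea.1.symm
  have nwc : ¬ G.Adj w c := fun h => by grind [h4 _ _ _ _ haw.1 h hbc.1.symm hab.symm]
  have nwd : ¬ G.Adj w d := fun h => by grind [h4 _ _ _ _ haw.1 h hde.1 hea.1]
  have nxd : ¬ G.Adj x d := fun h => by grind [h4 _ _ _ _ hbx.1 h hcd.1.symm hbc.1.symm]
  have nxe : ¬ G.Adj x e := fun h => by grind [h4 _ _ _ _ hbx.1 h hea.1 hab]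
  have off : ∀ {v u : V}, (v = a ∨ v = b ∨ v = c ∨ v = d ∨ v = e) →
      s(v, u) ∉ F.off {a, b, c, d, e} :=
    fun {v u} hv => F.notMem_off (v := v) (by simp) (by simp [hv])
  obtain ⟨col, hc⟩ := F.flow_connected hG (Z := {a, b, c, d, e}) ⟨a, by simp⟩
  change F.PropOn (F.off {a, b, c, d, e}) col at hc
  have obc := off (v := b) (u := c) (by simp)
  have ocd := off (v := c) (u := d) (by simp)
  have ode := off (v := d) (u := e) (by simp)
  have oea := off (v := e) (u := a) (by simp)
  have oaw := off (v := a) (u := w) (by simp)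
  have obx := off (v := b) (u := x) (by simp)
  have c1 : F.cf s(c, d) s(b, c) := F.cf_mk hcd hbc (by grind [Sym2.eq_iff]) (by simp)
  have c2 : F.cf s(c, d) s(d, e) := F.cf_mk hcd hde (by grind [Sym2.eq_iff]) (by simp)
  have c3 : F.cf s(c, d) s(b, x) := F.cf_mk hcd hbx (by grind [Sym2.eq_iff]) (by simp [hbc.1.symm])
  have c4 : F.cf s(c, d) s(e, a) := F.cf_mk hcd hea (by grind [Sym2.eq_iff]) (by simp [hde.1])
  have c5 : F.cf s(a, w) s(e, a) := F.cf_mk haw hea (by grind [Sym2.eq_iff]) (by simp)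
  have c6 : F.cf s(a, w) s(b, x) := F.cf_mk haw hbx (by grind [Sym2.eq_iff]) (by simp [hab])
  have c7 : F.cf s(a, w) s(b, c) := F.cf_mk haw hbc (by grind [Sym2.eq_iff]) (by simp [hab])
  have c8 : F.cf s(a, w) s(d, e) := F.cf_mk haw hde (by grind [Sym2.eq_iff]) (by simp [hea.1.symm])
  have c9 : F.cf s(b, c) s(b, x) := F.cf_mk hbc hbx (by grind [Sym2.eq_iff]) (by simp)
  have c10 : F.cf s(b, c) s(e, a) := F.cf_mk hbc hea (by grind [Sym2.eq_iff]) (by simp [hab.symm])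
  have c11 : F.cf s(b, c) s(d, e) := F.cf_mk hbc hde (by grind [Sym2.eq_iff]) (by simp [hcd.1])
  have c12 : F.cf s(e, a) s(d, e) := F.cf_mk hea hde (by grind [Sym2.eq_iff]) (by simp)
  have c13 : F.cf s(e, a) s(b, x) := F.cf_mk hea hbx (by grind [Sym2.eq_iff]) (by simp [hab])
  have n1 : ¬ F.cf s(c, d) s(a, w) := by
    rw [F.cf_mk_iff]
    grind [G.adj_comm]
  have n2 : ¬ F.cf s(d, e) s(b, x) := by
    rw [F.cf_mk_iff]
    grind [G.adj_comm]
  have l1 := F.card_av_list (S := F.off {a, b, c, d, e}) (c := col) (e := s(c, d))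
    [s(b, c), s(d, e), s(b, x), s(e, a)] (by simp; grind [Sym2.eq_iff]) (by
      simp only [List.forall_mem_cons]
      exact ⟨⟨c1, obc⟩, ⟨c2, ode⟩, ⟨c3, obx⟩, ⟨c4, oea⟩, by simp⟩)
  have l2 := F.card_av_list (S := F.off {a, b, c, d, e}) (c := col) (e := s(a, w))
    [s(e, a), s(b, x), s(b, c), s(d, e)] (by simp; grind [Sym2.eq_iff]) (by
      simp only [List.forall_mem_cons]
      exact ⟨⟨c5, oea⟩, ⟨c6, obx⟩, ⟨c7, obc⟩, ⟨c8, ode⟩, by simp⟩)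
  have l3 := F.card_av_list (S := F.off {a, b, c, d, e}) (c := col) (e := s(b, x))
    [s(a, w), s(b, c), s(c, d), s(e, a)] (by simp; grind [Sym2.eq_iff]) (by
      simp only [List.forall_mem_cons]
      exact ⟨⟨F.cf_symm c6, oaw⟩, ⟨F.cf_symm c9, obc⟩, ⟨F.cf_symm c3, ocd⟩,
        ⟨F.cf_symm c13, oea⟩, by simp⟩)
  have l4 := F.card_av_list (S := F.off {a, b, c, d, e}) (c := col) (e := s(d, e))
    [s(a, w), s(b, c), s(c, d), s(e, a)] (by simp; grind [Sym2.eq_iff]) (by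
      simp only [List.forall_mem_cons]
      exact ⟨⟨F.cf_symm c8, oaw⟩, ⟨F.cf_symm c11, obc⟩, ⟨F.cf_symm c2, ocd⟩,
        ⟨F.cf_symm c12, oea⟩, by simp⟩)
  have l5 := F.card_av_list (S := F.off {a, b, c, d, e}) (c := col) (e := s(b, c))
    [s(a, w), s(b, x), s(c, d), s(d, e), s(e, a)] (by simp; grind [Sym2.eq_iff]) (by
      simp only [List.forall_mem_cons]
      exact ⟨⟨F.cf_symm c7, oaw⟩, ⟨c9, obx⟩, ⟨F.cf_symm c1, ocd⟩, ⟨c11, ode⟩, ⟨c10, oea⟩,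
        by simp⟩)
  have l6 := F.card_av_list (S := F.off {a, b, c, d, e}) (c := col) (e := s(e, a))
    [s(a, w), s(b, x), s(c, d), s(d, e), s(b, c)] (by simp; grind [Sym2.eq_iff]) (by
      simp only [List.forall_mem_cons]
      exact ⟨⟨F.cf_symm c5, oaw⟩, ⟨c13, obx⟩, ⟨F.cf_symm c4, ocd⟩, ⟨c12, ode⟩,
        ⟨F.cf_symm c10, obc⟩, by simp⟩)
  simp only [List.length_cons, List.length_nil] at l1 l2 l3 l4 l5 l6
  obtain ⟨p, mp, p', mp', q, mq, q', mq', r, mr, s, ms, hh⟩ := five_lists_one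
    (by omega : 3 ≤ (F.av (F.off {a, b, c, d, e}) col s(c, d)).card)
    (by omega : 3 ≤ (F.av (F.off {a, b, c, d, e}) col s(a, w)).card)
    (by omega : 3 ≤ (F.av (F.off {a, b, c, d, e}) col s(d, e)).card)
    (by omega : 3 ≤ (F.av (F.off {a, b, c, d, e}) col s(b, x)).card)
    (by omega : 4 ≤ (F.av (F.off {a, b, c, d, e}) col s(b, c)).card)
    (by omega : 4 ≤ (F.av (F.off {a, b, c, d, e}) col s(e, a)).card)
  refine F.good_of_list hc [(s(c, d), p), (s(a, w), p'), (s(d, e), q), (s(b, x), q'),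
    (s(b, c), r), (s(e, a), s)] ?_ ?_ ?_
  · simp only [List.mem_cons, List.not_mem_nil, or_false]
    rintro p (rfl | rfl | rfl | rfl | rfl | rfl)
    exacts [⟨ocd, mp⟩, ⟨oaw, mp'⟩, ⟨ode, mq⟩, ⟨obx, mq'⟩, ⟨obc, mr⟩, ⟨oea, ms⟩]
  · have ia := F.inc_pair hea.symm haw hw
    have ib := F.inc_pair hbc hbx hx
    have ic := F.inc_pair hbc.symm hcd e2.symm
    have id := F.inc_pair hcd.symm hde e3.symm
    have ie := F.inc_pair hde.symm hea e4
    rw [Sym2.eq_swap] at ia ic id ie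
    rintro v (rfl | rfl | rfl | rfl | rfl) e he
    all_goals
      simp only [ia, ib, ic, id, ie, Finset.mem_insert, Finset.mem_singleton] at he
      rcases he with rfl | rfl <;> simp only [List.map_cons, List.mem_cons, true_or, or_true]
  · simp only [List.pairwise_cons, List.mem_cons, List.not_mem_nil, or_false, List.Pairwise.nil]
    simp
    grind

set_option maxHeartbeats 1000000 in
/-- A 5-cycle in which `a b` and `c d` are matching edges. -/
theorem good_of_fiveCycle_two (hG : G.Connected)
    (h3 : ∀ x y z, G.Adj x y → G.Adj y z → ¬ G.Adj x z)
    (h4 : ∀ x y z w, G.Adj x y → G.Adj y z → G.Adj z w → G.Adj w x → x = z ∨ y = w)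
    {a b c d e w x y z : V} (ha : F.mt a = b) (hab : G.Adj a b) (hbc : F.N.Adj b c)
    (hc' : F.mt c = d) (hcd : G.Adj c d) (hde : F.N.Adj d e) (hea : F.N.Adj e a)
    (haw : F.N.Adj a w) (hw : w ≠ e) (hbx : F.N.Adj b x) (hx : x ≠ c)
    (hcy : F.N.Adj c y) (hy : y ≠ b) (hdz : F.N.Adj d z) (hz : z ≠ e) : F.Good := by
  have hb := F.mt_eq_comm.1 ha
  have hd := F.mt_eq_comm.1 hc'
  have e1 : a ≠ c := by rintro rfl; exact hbc.2 hb.symm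
  have e2 : b ≠ d := by rintro rfl; exact h3 _ _ _ hab hde.1 hea.1.symm
  have e3 : c ≠ e := by rintro rfl; exact h3 _ _ _ hab hbc.1 hea.1.symm
  have e4 : a ≠ d := by rintro rfl; exact h3 _ _ _ hab hbc.1 hcd.symm
  have e5 : b ≠ e := by rintro rfl; exact hea.2 hb.symm
  have e6 := hab.ne
  have e7 := hbc.1.ne
  have e8 := hcd.ne
  have e9 := hde.1.ne
  have e10 := hea.1.ne
  have w1 : w ≠ a := haw.1.ne.symm
  have w2 : w ≠ b := fun h => haw.2 (h.trans ha.symm)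
  have w3 : w ≠ c := by rintro rfl; exact h3 _ _ _ hab hbc.1 haw.1
  have w4 : w ≠ d := by rintro rfl; exact h3 _ _ _ hde.1 hea.1 haw.1.symm
  have x1 : x ≠ b := hbx.1.ne.symm
  have x2 : x ≠ a := fun h => hbx.2 (h.trans hb.symm)
  have x3 : x ≠ d := by rintro rfl; exact h3 _ _ _ hbc.1 hcd hbx.1
  have x4 : x ≠ e := by rintro rfl; exact h3 _ _ _ hab hbx.1 hea.1.symm
  have y1 : y ≠ c := hcy.1.ne.symm
  have y2 : y ≠ d := fun h => hcy.2 (h.trans hc'.symm)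
  have y3 : y ≠ a := by rintro rfl; exact h3 _ _ _ hab hbc.1 hcy.1.symm
  have y4 : y ≠ e := by rintro rfl; exact h3 _ _ _ hcd hde.1 hcy.1
  have z1 : z ≠ d := hdz.1.ne.symm
  have z2 : z ≠ c := fun h => hdz.2 (h.trans hd.symm)
  have z3 : z ≠ b := by rintro rfl; exact h3 _ _ _ hbc.1 hcd hdz.1.symm
  have z4 : z ≠ a := by rintro rfl; exact h3 _ _ _ hde.1 hea.1 hdz.1
  have wx : w ≠ x := by rintro rfl; exact h3 _ _ _ hab hbx.1 haw.1
  have off : ∀ {v u : V}, (v = a ∨ v = b ∨ v = c ∨ v = d ∨ v = e) →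
      s(v, u) ∉ F.off {a, b, c, d, e} :=
    fun {v u} hv => F.notMem_off (v := v) (by simp) (by simp [hv])
  obtain ⟨col, hc⟩ := F.flow_connected hG (Z := {a, b, c, d, e}) ⟨a, by simp⟩
  change F.PropOn (F.off {a, b, c, d, e}) col at hc
  have obc := off (v := b) (u := c) (by simp)
  have ode := off (v := d) (u := e) (by simp)
  have oea := off (v := e) (u := a) (by simp)
  have oaw := off (v := a) (u := w) (by simp)
  have obx := off (v := b) (u := x) (by simp)
  have ocy := off (v := c) (u := y) (by simp)
  have odz := off (v := d) (u := z) (by simp)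
  have c1 : F.cf s(b, c) s(b, x) := F.cf_mk hbc hbx (by grind [Sym2.eq_iff]) (by simp)
  have c2 : F.cf s(b, c) s(c, y) := F.cf_mk hbc hcy (by grind [Sym2.eq_iff]) (by simp)
  have c3 : F.cf s(b, c) s(a, w) := F.cf_mk hbc haw (by grind [Sym2.eq_iff]) (by simp [hab.symm])
  have c4 : F.cf s(b, c) s(d, z) := F.cf_mk hbc hdz (by grind [Sym2.eq_iff]) (by simp [hcd])
  have c5 : F.cf s(b, c) s(d, e) := F.cf_mk hbc hde (by grind [Sym2.eq_iff]) (by simp [hcd])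
  have c6 : F.cf s(b, c) s(e, a) := F.cf_mk hbc hea (by grind [Sym2.eq_iff]) (by simp [hab.symm])
  have c7 : F.cf s(d, e) s(e, a) := F.cf_mk hde hea (by grind [Sym2.eq_iff]) (by simp)
  have c8 : F.cf s(d, e) s(d, z) := F.cf_mk hde hdz (by grind [Sym2.eq_iff]) (by simp)
  have c9 : F.cf s(d, e) s(c, y) := F.cf_mk hde hcy (by grind [Sym2.eq_iff]) (by simp [hcd.symm])
  have c10 : F.cf s(d, e) s(a, w) := F.cf_mk hde haw (by grind [Sym2.eq_iff]) (by simp [hea.1])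
  have c11 : F.cf s(e, a) s(a, w) := F.cf_mk hea haw (by grind [Sym2.eq_iff]) (by simp)
  have c12 : F.cf s(e, a) s(b, x) := F.cf_mk hea hbx (by grind [Sym2.eq_iff]) (by simp [hab])
  have c13 : F.cf s(e, a) s(d, z) := F.cf_mk hea hdz (by grind [Sym2.eq_iff]) (by simp [hde.1.symm])
  have c14 : F.cf s(a, w) s(b, x) := F.cf_mk haw hbx (by grind [Sym2.eq_iff]) (by simp [hab])
  have c15 : F.cf s(b, x) s(c, y) := F.cf_mk hbx hcy (by grind [Sym2.eq_iff]) (by simp [hbc.1])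
  have c16 : F.cf s(c, y) s(d, z) := F.cf_mk hcy hdz (by grind [Sym2.eq_iff]) (by simp [hcd])
  have n1 : ¬ F.cf s(d, e) s(b, x) := by
    have nbd : ¬ G.Adj b d := h3 _ _ _ hbc.1 hcd
    have nbe : ¬ G.Adj b e := h3 _ _ _ hab.symm hea.1.symm
    have nxd : ¬ G.Adj x d := fun h => by grind [h4 _ _ _ _ hbx.1 h hcd.symm hbc.1.symm]
    have nxe : ¬ G.Adj x e := fun h => by grind [h4 _ _ _ _ hbx.1 h hea.1 hab]
    rw [F.cf_mk_iff]
    grind [G.adj_comm]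
  have n2 : ¬ F.cf s(e, a) s(c, y) := by
    have nac : ¬ G.Adj a c := h3 _ _ _ hab hbc.1
    have nce : ¬ G.Adj c e := h3 _ _ _ hcd hde.1
    have nya : ¬ G.Adj y a := fun h => by grind [h4 _ _ _ _ hcy.1 h hab hbc.1]
    have nye : ¬ G.Adj y e := fun h => by grind [h4 _ _ _ _ hcy.1 h hde.1.symm hcd.symm]
    rw [F.cf_mk_iff]
    grind [G.adj_comm]
  have la := F.card_av_list (S := F.off {a, b, c, d, e}) (c := col) (e := s(b, c))
    [s(b, x), s(c, y), s(a, w), s(d, z), s(d, e), s(e, a)] (by simp; grind [Sym2.eq_iff]) (by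
      simp only [List.forall_mem_cons]
      exact ⟨⟨c1, obx⟩, ⟨c2, ocy⟩, ⟨c3, oaw⟩, ⟨c4, odz⟩, ⟨c5, ode⟩, ⟨c6, oea⟩, by simp⟩)
  have lb := F.card_av_list (S := F.off {a, b, c, d, e}) (c := col) (e := s(d, e))
    [s(e, a), s(b, c), s(d, z), s(c, y), s(a, w)] (by simp; grind [Sym2.eq_iff]) (by
      simp only [List.forall_mem_cons]
      exact ⟨⟨c7, oea⟩, ⟨F.cf_symm c5, obc⟩, ⟨c8, odz⟩, ⟨c9, ocy⟩, ⟨c10, oaw⟩, by simp⟩)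
  have lc := F.card_av_list (S := F.off {a, b, c, d, e}) (c := col) (e := s(e, a))
    [s(d, e), s(b, c), s(a, w), s(b, x), s(d, z)] (by simp; grind [Sym2.eq_iff]) (by
      simp only [List.forall_mem_cons]
      exact ⟨⟨F.cf_symm c7, ode⟩, ⟨F.cf_symm c6, obc⟩, ⟨c11, oaw⟩, ⟨c12, obx⟩, ⟨c13, odz⟩,
        by simp⟩)
  have pend : ∀ (f f₁ f₂ f₃ f₄ g g' : Sym2 V), [f₁, f₂, f₃, f₄, g, g'].Nodup →
      F.cf f f₁ ∧ F.cf f f₂ ∧ F.cf f f₃ ∧ F.cf f f₄ → (∀ h ∈ [f₁, f₂, f₃, f₄, g, g'],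
        h ∈ [s(b, c), s(d, e), s(e, a), s(a, w), s(b, x), s(c, y), s(d, z)]) →
      3 + (if F.cf f g then 1 else 0) + (if F.cf f g' then 1 else 0) ≤
        (F.av (F.off {a, b, c, d, e}) col f).card := by
    intro f f₁ f₂ f₃ f₄ g g' hn hcf hm
    have ho : ∀ h ∈ [f₁, f₂, f₃, f₄, g, g'], h ∉ F.off {a, b, c, d, e} := by
      intro h hh
      have hm := hm h hh
      simp only [List.mem_cons, List.not_mem_nil, or_false] at hm
      rcases hm with rfl | rfl | rfl | rfl | rfl | rfl | rfl
      exacts [obc, ode, oea, oaw, obx, ocy, odz]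
    clear hm
    simp only [List.mem_cons, List.not_mem_nil, or_false, forall_eq_or_imp, forall_eq] at ho
    simp only [List.nodup_cons, List.mem_cons, List.not_mem_nil, or_false] at hn
    have key : ∀ l : List (Sym2 V), l.Nodup → (∀ h ∈ l, F.cf f h ∧ h ∉ F.off {a, b, c, d, e}) →
      l.length ≤ (F.av (F.off {a, b, c, d, e}) col f).card + 1 := fun l => F.card_av_list l
    split_ifs with h h' h'
    · have := key [f₁, f₂, f₃, f₄, g, g'] (by simp; grind only) (by simp; grind only)
      simpa using this
    · have := key [f₁, f₂, f₃, f₄, g] (by simp; grind only) (by simp; grind only)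
      simpa using this
    · have := key [f₁, f₂, f₃, f₄, g'] (by simp; grind only) (by simp; grind only)
      simpa using this
    · have := key [f₁, f₂, f₃, f₄] (by simp; grind only) (by simp; grind only)
      simpa using this
  have l1 := pend s(a, w) s(e, a) s(b, x) s(b, c) s(d, e) s(c, y) s(d, z)
    (by simp; grind [Sym2.eq_iff]) ⟨F.cf_symm c11, c14, F.cf_symm c3, F.cf_symm c10⟩ (by simp)
  have l2 := pend s(b, x) s(b, c) s(a, w) s(c, y) s(e, a) s(d, z) s(d, e)
    (by simp; grind [Sym2.eq_iff]) ⟨F.cf_symm c1, F.cf_symm c14, c15, F.cf_symm c12⟩ (by simp)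
  have l3 := pend s(c, y) s(b, c) s(b, x) s(d, z) s(d, e) s(a, w) s(e, a)
    (by simp; grind [Sym2.eq_iff]) ⟨F.cf_symm c2, F.cf_symm c15, c16, F.cf_symm c9⟩ (by simp)
  have l4 := pend s(d, z) s(d, e) s(e, a) s(c, y) s(b, c) s(a, w) s(b, x)
    (by simp; grind [Sym2.eq_iff]) ⟨F.cf_symm c8, F.cf_symm c13, F.cf_symm c16, F.cf_symm c4⟩
    (by simp)
  rw [F.cf_comm (e := s(c, y)) (f := s(a, w))] at l3
  rw [F.cf_comm (e := s(d, z)) (f := s(a, w)), F.cf_comm (e := s(d, z)) (f := s(b, x))] at l4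
  simp only [List.length_cons, List.length_nil] at la lb lc
  obtain ⟨t₁, m₁, t₂, m₂, t₃, m₃, t₄, m₄, p, mp, q, mq, r, mr, hh⟩ := five_lists_two
    (by omega : 5 ≤ (F.av (F.off {a, b, c, d, e}) col s(b, c)).card)
    (by omega : 4 ≤ (F.av (F.off {a, b, c, d, e}) col s(d, e)).card)
    (by omega : 4 ≤ (F.av (F.off {a, b, c, d, e}) col s(e, a)).card) l1
    (le_of_add_le_left l2) (le_of_add_le_left l3) l4
  refine F.good_of_list hc [(s(b, c), p), (s(d, e), q), (s(e, a), r), (s(a, w), t₁),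
    (s(b, x), t₂), (s(c, y), t₃), (s(d, z), t₄)] ?_ ?_ ?_
  · simp only [List.mem_cons, List.not_mem_nil, or_false]
    rintro p (rfl | rfl | rfl | rfl | rfl | rfl | rfl)
    exacts [⟨obc, mp⟩, ⟨ode, mq⟩, ⟨oea, mr⟩, ⟨oaw, m₁⟩, ⟨obx, m₂⟩, ⟨ocy, m₃⟩, ⟨odz, m₄⟩]
  · have ia := F.inc_pair hea.symm haw hw
    have ib := F.inc_pair hbc hbx hx
    have ic := F.inc_pair hbc.symm hcy hy
    have id := F.inc_pair hde hdz hz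
    have ie := F.inc_pair hde.symm hea e4
    rw [Sym2.eq_swap] at ia ic ie
    rintro v (rfl | rfl | rfl | rfl | rfl) e he
    all_goals
      simp only [ia, ib, ic, id, ie, Finset.mem_insert, Finset.mem_singleton] at he
      rcases he with rfl | rfl <;> simp only [List.map_cons, List.mem_cons, true_or, or_true]
  · simp only [List.pairwise_cons, List.mem_cons, List.not_mem_nil, or_false, List.Pairwise.nil]
    simp
    grind

theorem good_of_fiveCycle (hG : G.Connected)
    (h3 : ∀ x y z, G.Adj x y → G.Adj y z → ¬ G.Adj x z)
    (h4 : ∀ x y z w, G.Adj x y → G.Adj y z → G.Adj z w → G.Adj w x → x = z ∨ y = w)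
    {a b c d e : V} (ha : F.mt a = b) (hab : G.Adj a b) (hbc : G.Adj b c)
    (hcd : G.Adj c d) (hde : G.Adj d e) (hea : G.Adj e a) : F.Good := by
  have hb := F.mt_eq_comm.1 ha
  have e1 : a ≠ c := by rintro rfl; exact h3 _ _ _ hcd hde hea.symm
  have e5 : b ≠ e := by rintro rfl; exact h3 _ _ _ hbc hcd hde.symm
  have nbc : F.N.Adj b c := ⟨hbc, fun h => e1 (h.trans hb).symm⟩
  have nea : F.N.Adj e a := F.N.symm.symm _ _ ⟨hea.symm, fun h => e5 (h.trans ha).symm⟩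
  obtain ⟨w, haw, hw⟩ := F.exists_N_ne a e
  obtain ⟨x, hbx, hx⟩ := F.exists_N_ne b c
  by_cases h1 : F.mt c = d
  · have e3 : c ≠ e := by rintro rfl; exact h3 _ _ _ hab hbc hea.symm
    have nde : F.N.Adj d e := ⟨hde, fun h => e3 (h.trans (F.mt_eq_comm.1 h1)).symm⟩
    obtain ⟨y, hcy, hy⟩ := F.exists_N_ne c b
    obtain ⟨z, hdz, hz⟩ := F.exists_N_ne d e
    exact F.good_of_fiveCycle_two hG h3 h4 ha hab nbc h1 hcd nde nea haw hw hbx hx hcy hy hdz hz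
  have ncd : F.N.Adj c d := ⟨hcd, fun h => h1 h.symm⟩
  by_cases h2 : F.mt d = e
  · obtain ⟨y, hdy, hy⟩ := F.exists_N_ne d c
    obtain ⟨z, hez, hz⟩ := F.exists_N_ne e a
    exact F.good_of_fiveCycle_two hG h3 h4 hb hab.symm nea.symm (F.mt_eq_comm.1 h2) hde.symm
      ncd.symm nbc.symm hbx hx haw hw hez hz hdy hy
  have nde : F.N.Adj d e := ⟨hde, fun h => h2 h.symm⟩
  exact F.good_of_fiveCycle_one hG h3 h4 ha hab nbc ncd nde nea haw hw hbx hx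

end Frame

/-- Tutte's theorem in terms of vertex sets. -/
theorem exists_matching_or_odd_sets {W : Type} [Fintype W] (H : SimpleGraph W) :
    (∃ m : W → W, (∀ v, m (m v) = v) ∧ ∀ v, H.Adj v (m v)) ∨
    ∃ (X : Finset W) (ι : Type) (_ : Fintype ι) (A : ι → Finset W),
      X.card < Fintype.card ι ∧ (Odd (Fintype.card ι) ↔ Odd (Fintype.card W - X.card)) ∧
      (∀ i, Odd (A i).card) ∧ (∀ i, ∀ v ∈ A i, v ∉ X) ∧
      (∀ i j, ∀ v ∈ A i, v ∈ A j → i = j) ∧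
      ∀ i, ∀ v ∈ A i, ∀ w, H.Adj v w → w ∈ A i ∨ w ∈ X := by
  by_cases h : ∃ M : H.Subgraph, M.IsPerfectMatching
  · left
    obtain ⟨M, hM⟩ := h
    rw [SimpleGraph.Subgraph.isPerfectMatching_iff] at hM
    choose m hm hm' using hM
    exact ⟨m, fun v => (hm' (m v) v (hm v).symm).symm, fun v => (hm v).adj_sub⟩
  right
  rw [SimpleGraph.tutte] at h
  push Not at h
  obtain ⟨u, hu⟩ := h
  rw [SimpleGraph.IsTutteViolator] at hu
  set K := ((⊤ : H.Subgraph).deleteVerts u).coe with hK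
  have hodd := SimpleGraph.odd_ncard_oddComponents (G := K)
  let ι : Type := K.oddComponents
  let A : ι → Finset W := fun i => Finset.univ.filter fun v => v ∈ Subtype.val '' i.1.supp
  have hA : ∀ i v, v ∈ A i ↔ ∃ h, K.connectedComponentMk ⟨v, h⟩ = i.1 := by
    intro i v
    simp [A, SimpleGraph.ConnectedComponent.mem_supp_iff]
  refine ⟨u.toFinset, ι, inferInstance, A, ?_, ?_, ?_, ?_, ?_, ?_⟩
  · rw [← Set.ncard_eq_toFinset_card', ← Nat.card_eq_fintype_card]
    exact hu
  · rw [← Nat.card_eq_fintype_card]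
    change Odd K.oddComponents.ncard ↔ _
    rw [hodd, ← Set.ncard_eq_toFinset_card']
    have : Nat.card ((⊤ : H.Subgraph).deleteVerts u).verts = Fintype.card W - u.ncard := by
      rw [Nat.card_coe_set_eq, SimpleGraph.Subgraph.deleteVerts_verts,
        SimpleGraph.Subgraph.verts_top,
        Set.ncard_sdiff (Set.subset_univ _), Set.ncard_univ, Nat.card_eq_fintype_card]
    rw [this]
  · intro i
    have h1 : (A i).card = i.1.supp.ncard := by
      rw [← Set.ncard_image_of_injective _ Subtype.val_injective, Set.ncard_eq_toFinset_card']
      congr 1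
      ext v
      simp [A]
    rw [h1]
    exact i.2
  · intro i v hv
    obtain ⟨h, -⟩ := (hA i v).1 hv
    have : v ∈ Set.univ \ u := by simpa using h
    simpa using this.2
  · intro i j v hi hj
    obtain ⟨h, h1⟩ := (hA i v).1 hi
    obtain ⟨h', h2⟩ := (hA j v).1 hj
    exact Subtype.ext (h1.symm.trans h2)
  · intro i v hv w hw
    by_cases hwu : w ∈ u
    · exact Or.inr (by simpa using hwu)
    left
    obtain ⟨h, h1⟩ := (hA i v).1 hv
    have hvu : v ∉ u := by simpa using h
    refine (hA i w).2 ⟨by simpa using hwu, ?_⟩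
    rw [← h1]
    refine (SimpleGraph.ConnectedComponent.sound (SimpleGraph.Adj.reachable ?_)).symm
    rw [hK, SimpleGraph.Subgraph.coe_adj, SimpleGraph.Subgraph.deleteVerts_adj]
    simp [hvu, hwu, hw]

section Boundary

variable [Fintype V] (G)

/-- The ordered pairs of adjacent vertices leaving `A`. -/
noncomputable def bd (A : Set V) : Finset (V × V) :=
  Finset.univ.filter fun p => p.1 ∈ A ∧ p.2 ∉ A ∧ G.Adj p.1 p.2

theorem mem_bd {A : Set V} {p : V × V} : p ∈ bd G A ↔ p.1 ∈ A ∧ p.2 ∉ A ∧ G.Adj p.1 p.2 := by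
  simp [bd]

theorem even_card_inner (A : Set V) :
    Even (Finset.univ.filter fun p : V × V => p.1 ∈ A ∧ p.2 ∈ A ∧ G.Adj p.1 p.2).card := by
  let H : SimpleGraph V :=
    { Adj := fun v w => v ∈ A ∧ w ∈ A ∧ G.Adj v w
      symm := ⟨fun _ _ h => ⟨h.2.1, h.1, h.2.2.symm⟩⟩
      loopless := ⟨fun _ h => h.2.2.ne rfl⟩ }
  have h := H.sum_degrees_eq_twice_card_edges
  have h2 : (Finset.univ.filter fun p : V × V => p.1 ∈ A ∧ p.2 ∈ A ∧ G.Adj p.1 p.2).card =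
      ∑ v, H.degree v := by
    rw [Finset.card_eq_sum_card_fiberwise (f := Prod.fst) (t := Finset.univ) (by simp)]
    refine Finset.sum_congr rfl fun v _ => ?_
    rw [← SimpleGraph.card_neighborFinset_eq_degree]
    refine Finset.card_bij (fun p _ => p.2) ?_ ?_ ?_
    · rintro ⟨x, y⟩ hp
      simp only [Finset.mem_filter, Finset.mem_univ, true_and] at hp
      obtain ⟨hp, rfl⟩ := hp
      rw [SimpleGraph.mem_neighborFinset]
      exact hp
    · rintro ⟨x, y⟩ hp ⟨x', y'⟩ hp' h
      simp only [Finset.mem_filter] at hp hp' h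
      rw [hp.2, hp'.2, h]
    · intro w hw
      rw [SimpleGraph.mem_neighborFinset] at hw
      exact ⟨(v, w), by simpa using hw, rfl⟩
  rw [h2, h]
  exact even_two_mul _

/-- Handshake: the number of edge ends at `A`. -/
theorem card_pairs_eq {A : Finset V} {k : ℕ} (hA : ∀ v ∈ A, (G.neighborSet v).ncard = k) :
    (Finset.univ.filter fun p : V × V => p.1 ∈ A ∧ G.Adj p.1 p.2).card = k * A.card := by
  rw [Finset.card_eq_sum_card_fiberwise (f := Prod.fst) (t := A) (by intro p; simp; tauto),
    mul_comm, ← smul_eq_mul]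
  refine Finset.sum_const_nat fun v hv => ?_
  rw [← hA v hv, Set.ncard_eq_toFinset_card']
  refine Finset.card_bij (fun p _ => p.2) ?_ ?_ ?_
  · rintro ⟨x, y⟩ hp
    simp only [Finset.mem_filter, Finset.mem_univ, true_and] at hp
    obtain ⟨hp, rfl⟩ := hp
    simpa using hp.2
  · rintro ⟨x, y⟩ hp ⟨x', y'⟩ hp' h
    simp only [Finset.mem_filter] at hp hp' h
    rw [hp.2, hp'.2, h]
  · intro w hw
    exact ⟨(v, w), by simpa [hv] using hw, rfl⟩

theorem odd_card_bd {A : Finset V} (hA : ∀ v ∈ A, (G.neighborSet v).ncard = 3) :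
    Odd (bd G A).card ↔ Odd A.card := by
  have h1 := card_pairs_eq G hA
  have h2 := even_card_inner G A
  have h3 : (Finset.univ.filter fun p : V × V => p.1 ∈ A ∧ G.Adj p.1 p.2).card =
      (Finset.univ.filter fun p : V × V => p.1 ∈ A ∧ p.2 ∈ A ∧ G.Adj p.1 p.2).card +
      (bd G A).card := by
    rw [← Finset.card_union_of_disjoint]
    · congr 1
      ext p
      simp [mem_bd]
      tauto
    · rw [Finset.disjoint_left]
      intro p hp hp'
      simp only [Finset.mem_filter] at hp
      exact ((mem_bd G).1 hp').2.1 hp.2.2.1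
  simp only [Finset.mem_coe] at h2
  rw [h1] at h3
  rw [Nat.odd_iff, Nat.odd_iff]
  rw [Nat.even_iff] at h2
  omega

/-- A matching covering the complement of `Y`, when `Y` has few outgoing edges. -/
theorem exists_matching_compl {Y : Finset V} (hY : ∀ v ∉ Y, (G.neighborSet v).ncard = 3)
    (heven : Even Yᶜ.card)
    (hcut : ∀ A : Finset V, A.Nonempty → A ≠ Finset.univ → 2 ≤ (bd G A).card)
    (hbd : (bd G Y).card ≤ 4) :
    ∃ m : V → V, (∀ v, m (m v) = v) ∧ (∀ v ∈ Y, m v = v) ∧ ∀ v ∉ Y, G.Adj v (m v) := by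
  rcases exists_matching_or_odd_sets (G.induce {v | v ∉ Y}) with ⟨m, h1, h2⟩ |
    ⟨X, ι, _, A, hlt, hpar, hodd, hAX, hdisj, hout⟩
  · refine ⟨fun v => if h : v ∉ Y then m ⟨v, h⟩ else v, ?_, ?_, ?_⟩
    · intro v
      by_cases hv : v ∉ Y
      · have : (m ⟨v, hv⟩).1 ∉ Y := (m ⟨v, hv⟩).2
        simp [hv, this, h1]
      · simp [hv]
    · intro v hv
      simp [hv]
    · intro v hv
      simpa [hv] using h2 ⟨v, hv⟩
  exfalso
  let A' : ι → Finset V := fun i => (A i).map (Function.Embedding.subtype _)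
  let X' : Finset V := X.map (Function.Embedding.subtype _)
  have hcard : ∀ i, (A' i).card = (A i).card := fun i => Finset.card_map _
  have hcardX : X'.card = X.card := Finset.card_map _
  have hAY : ∀ i, ∀ v ∈ A' i, v ∉ Y := by
    intro i v hv
    obtain ⟨w, -, rfl⟩ := Finset.mem_map.1 hv
    exact w.2
  have hXY : ∀ v ∈ X', v ∉ Y := by
    intro v hv
    obtain ⟨w, -, rfl⟩ := Finset.mem_map.1 hv
    exact w.2
  have hcompl : Fintype.card {v | v ∉ Y} = Yᶜ.card := by
    rw [← Set.toFinset_card]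
    congr 1
    ext v
    simp
  have hXle : X.card ≤ Yᶜ.card := by
    rw [← hcompl]
    exact Finset.card_le_univ X
  have h3 : ∀ i, 3 ≤ (bd G (A' i)).card := by
    intro i
    have ho : Odd (bd G (A' i)).card :=
      (odd_card_bd G fun v hv => hY v (hAY i v hv)).2 (by rw [hcard]; exact hodd i)
    have h2 : 2 ≤ (bd G (A' i)).card := by
      refine hcut _ (Finset.card_pos.1 (by rw [hcard]; exact (hodd i).pos)) fun h => ?_
      have hYe : Yᶜ = A' i := by
        rw [h]
        ext v
        have := hAY i v (by rw [h]; simp)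
        simp [this]
      rw [hYe, hcard] at heven
      exact (Nat.not_even_iff_odd.2 (hodd i)) heven
    obtain ⟨k, hk⟩ := ho
    omega
  have hsub : Finset.univ.biUnion (fun i => bd G (A' i)) ⊆
      ((Finset.univ.filter fun p : V × V => p.1 ∈ X' ∧ G.Adj p.1 p.2) ∪ bd G Y).map
        (Equiv.prodComm V V).toEmbedding := by
    rintro ⟨v, w⟩ hp
    simp only [Finset.mem_biUnion, Finset.mem_univ, true_and, mem_bd] at hp
    obtain ⟨i, hv, hw, hvw⟩ := hp
    simp only [Finset.mem_map_equiv, Equiv.prodComm_symm, Equiv.prodComm_apply, Prod.swap_prod_mk,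
      Finset.mem_union, Finset.mem_filter, Finset.mem_univ, true_and, mem_bd]
    by_cases hwY : w ∈ Y
    · exact Or.inr ⟨hwY, hAY i v hv, hvw.symm⟩
    · left
      refine ⟨?_, hvw.symm⟩
      obtain ⟨v', hv', rfl⟩ := Finset.mem_map.1 hv
      rcases hout i v' hv' ⟨w, hwY⟩ hvw with h | h
      · exact absurd (Finset.mem_coe.2 (Finset.mem_map.2 ⟨_, h, rfl⟩)) hw
      · exact Finset.mem_map.2 ⟨_, h, rfl⟩
  have hle := Finset.card_le_card hsub
  rw [Finset.card_map] at hle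
  have hle2 := (hle.trans (Finset.card_union_le _ _))
  rw [card_pairs_eq G fun v hv => hY v (hXY v hv), Finset.card_biUnion] at hle2
  · have hsum : 3 * Fintype.card ι ≤ ∑ i, (bd G (A' i)).card := by
      have := Finset.card_nsmul_le_sum Finset.univ (fun i => (bd G (A' i)).card) 3
        fun i _ => h3 i
      rw [smul_eq_mul] at this
      rw [mul_comm]
      exact this
    rw [hcompl, Nat.odd_sub hXle, Nat.odd_iff, Nat.odd_iff] at hpar
    rw [Nat.even_iff] at heven
    rw [Nat.even_iff] at hpar
    omega
  · intro i _ j _ hij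
    change Disjoint _ _
    rw [Finset.disjoint_left]
    intro p hp hp'
    have h1 := ((mem_bd G).1 hp).1
    have h2 := ((mem_bd G).1 hp').1
    obtain ⟨v, hv, hvp⟩ := Finset.mem_map.1 h1
    obtain ⟨v', hv', hvp'⟩ := Finset.mem_map.1 h2
    have : v = v' := Subtype.ext (hvp.trans hvp'.symm)
    subst this
    exact hij (hdisj i j v hv hv')

end Boundary

/-- A choice from the lists `L` colouring the square of the cycle of length `n` together with
the chords from `i` to `i + 3` for `i` satisfying `q`. -/
def RingChoice (n : ℕ) (q : ZMod n → Prop) (L : ZMod n → Finset (Fin 7)) : Prop :=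
  ∃ c : ZMod n → Fin 7,
    ∀ i, c i ∈ L i ∧ c i ≠ c (i + 1) ∧ c i ≠ c (i + 2) ∧ (q i → c i ≠ c (i + 3))

theorem RingChoice.of_shift {n : ℕ} {q : ZMod n → Prop} {L : ZMod n → Finset (Fin 7)}
    (s : ZMod n) (h : RingChoice n (fun i => q (i + s)) fun i => L (i + s)) :
    RingChoice n q L := by
  obtain ⟨c, hc⟩ := h
  refine ⟨fun i => c (i - s), fun i => ?_⟩
  have := hc (i - s)
  simp only [sub_add_cancel, sub_add_eq_add_sub] at this
  exact this

theorem exists_mem_ne_ne {L : Finset (Fin 7)} (h : 3 ≤ L.card) (a b : Fin 7) :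
    ∃ x ∈ L, x ≠ a ∧ x ≠ b := by
  have h1 : 0 < (L \ {a, b}).card := by
    have := Finset.le_card_sdiff {a, b} L
    have := Finset.card_le_two (a := a) (b := b)
    omega
  obtain ⟨x, hx⟩ := Finset.card_pos.1 h1
  simp only [Finset.mem_sdiff, Finset.mem_insert, Finset.mem_singleton, not_or] at hx
  exact ⟨x, hx.1, hx.2⟩

theorem exists_mem_ne_ne_ne {L : Finset (Fin 7)} (h : 3 ≤ L.card) {Q : Prop}
    (hQ : Q → 4 ≤ L.card) (a b d : Fin 7) : ∃ x ∈ L, x ≠ a ∧ x ≠ b ∧ (Q → x ≠ d) := by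
  by_cases hq : Q
  · obtain ⟨x, hx, hxa, hxb⟩ := exists_mem_ne_ne (L := L \ {d}) (by
      have := Finset.le_card_sdiff {d} L
      have := hQ hq
      rw [Finset.card_singleton] at *
      omega) a b
    rw [Finset.mem_sdiff, Finset.mem_singleton] at hx
    exact ⟨x, hx.1, hxa, hxb, fun _ => hx.2⟩
  · obtain ⟨x, hx, hxa, hxb⟩ := exists_mem_ne_ne h a b
    exact ⟨x, hx, hxa, hxb, fun h => absurd h hq⟩

theorem exists_seq {L : ℕ → Finset (Fin 7)} (hL : ∀ i, 3 ≤ (L i).card) {P : ℕ → Prop}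
    (hP : ∀ i, P i → 4 ≤ (L (i + 3)).card) (a b : Fin 7) :
    ∃ c : ℕ → Fin 7, c 0 = a ∧ c 1 = b ∧ (∀ j, c (j + 2) ∈ L (j + 2) ∧
      c (j + 2) ≠ c (j + 1) ∧ c (j + 2) ≠ c j) ∧ ∀ j, P j → c (j + 3) ≠ c j := by
  choose g hg using fun i => exists_mem_ne_ne_ne (hL (i + 3)) (hP i)
  obtain ⟨u, hu, hub, hua⟩ := exists_mem_ne_ne (hL 2) b a
  let p : ℕ → Fin 7 × Fin 7 × Fin 7 :=
    fun m => Nat.rec (a, b, u) (fun j t => (t.2.1, t.2.2, g j t.2.2 t.2.1 t.1)) m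
  have hp : ∀ j, p (j + 1) = ((p j).2.1, (p j).2.2, g j (p j).2.2 (p j).2.1 (p j).1) :=
    fun j => rfl
  have h1 : ∀ j, (p (j + 1)).1 = (p j).2.1 := fun j => by rw [hp]
  have h2 : ∀ j, (p (j + 2)).1 = (p j).2.2 := fun j => by rw [hp (j + 1), hp j]
  have h3 : ∀ j, (p (j + 3)).1 = g j (p j).2.2 (p j).2.1 (p j).1 := fun j => by
    rw [hp (j + 2), hp (j + 1), hp j]
  refine ⟨fun j => (p j).1, rfl, rfl, fun j => ?_, fun j hj => ?_⟩
  · cases j with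
    | zero => exact ⟨hu, hub, hua⟩
    | succ j =>
      have := hg j (p j).2.2 (p j).2.1 (p j).1
      simp only [h1]
      exact ⟨this.1, this.2.1, this.2.2.1⟩
  · have := hg j (p j).2.2 (p j).2.1 (p j).1
    simp only [h3]
    exact this.2.2.2 hj

theorem RingChoice.of_nat {n : ℕ} (hn : 6 ≤ n) {q : ZMod n → Prop}
    {L : ZMod n → Finset (Fin 7)} (c : ℕ → Fin 7)
    (hm : ∀ i < n, c i ∈ L i) (h1 : ∀ i, i + 1 < n → c i ≠ c (i + 1))
    (h2 : ∀ i, i + 2 < n → c i ≠ c (i + 2)) (w1 : c (n - 1) ≠ c 0) (w2 : c (n - 2) ≠ c 0)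
    (w3 : c (n - 1) ≠ c 1)
    (h3 : ∀ i, q (i : ℕ) → i + 3 < n → c i ≠ c (i + 3)) (w4 : q (-3) → c (n - 3) ≠ c 0)
    (hq : ∀ i, q i → i ≠ -1 ∧ i ≠ -2) : RingChoice n q L := by
  have : NeZero n := ⟨by omega⟩
  refine ⟨fun i => c i.val, fun i => ?_⟩
  obtain ⟨m, hmn, rfl⟩ : ∃ m < n, (m : ZMod n) = i :=
    ⟨i.val, ZMod.val_lt i, ZMod.natCast_zmod_val i⟩
  have e1 : ((m : ZMod n) + 1).val = (m + 1) % n := by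
    rw [← ZMod.val_natCast, Nat.cast_add, Nat.cast_one]
  have e2 : ((m : ZMod n) + 2).val = (m + 2) % n := by
    rw [← ZMod.val_natCast, Nat.cast_add, Nat.cast_ofNat]
  have e3 : ((m : ZMod n) + 3).val = (m + 3) % n := by
    rw [← ZMod.val_natCast, Nat.cast_add, Nat.cast_ofNat]
  simp only [e1, e2, e3, ZMod.val_natCast, Nat.mod_eq_of_lt hmn]
  refine ⟨hm m hmn, ?_, ?_, fun hqm => ?_⟩
  · rcases Nat.lt_or_ge (m + 1) n with h | h
    · rw [Nat.mod_eq_of_lt h]; exact h1 m h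
    · obtain rfl : m = n - 1 := by omega
      rw [show n - 1 + 1 = n by omega, Nat.mod_self]; exact w1
  · rcases Nat.lt_or_ge (m + 2) n with h | h
    · rw [Nat.mod_eq_of_lt h]; exact h2 m h
    · rcases (by omega : m = n - 1 ∨ m = n - 2) with rfl | rfl
      · rw [show n - 1 + 2 = 1 + n by omega, Nat.add_mod_right, Nat.mod_eq_of_lt (by omega)]
        exact w3
      · rw [show n - 2 + 2 = n by omega, Nat.mod_self]; exact w2
  · rcases Nat.lt_or_ge (m + 3) n with h | h
    · rw [Nat.mod_eq_of_lt h]; exact h3 m hqm h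
    · have hcast : ∀ j : ℕ, j ≤ n → ((n - j : ℕ) : ZMod n) = -(j : ZMod n) := fun j hj => by
        rw [Nat.cast_sub hj, ZMod.natCast_self, zero_sub]
      rcases (by omega : m = n - 1 ∨ m = n - 2 ∨ m = n - 3) with rfl | rfl | rfl
      · exact absurd (by rw [hcast 1 (by omega), Nat.cast_one]) (hq _ hqm).1
      · exact absurd (by rw [hcast 2 (by omega), Nat.cast_ofNat]) (hq _ hqm).2
      · rw [show n - 3 + 3 = n by omega, Nat.mod_self]
        rw [hcast 3 (by omega), Nat.cast_ofNat] at hqm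
        exact w4 hqm

theorem RingChoice.of_pair {n : ℕ} (hn : 6 ≤ n) {q : ZMod n → Prop}
    {L : ZMod n → Finset (Fin 7)} (hL : ∀ i, 3 ≤ (L i).card)
    (hL' : ∀ i, q i → 4 ≤ (L (i + 3)).card)
    (hq : ∀ i, q i → i ≠ 0 ∧ i ≠ 1 ∧ i ≠ 2 ∧ i ≠ -1 ∧ i ≠ -2)
    {x y : Fin 7} (hx2 : x ∈ L 2) (hx0 : x ∉ L 0) (hy : y ∈ L 3)
    (hxy : x ≠ y) (h1 : 3 ≤ (L 1 \ {x, y}).card) : RingChoice n q L := by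
  obtain ⟨t, t0, t1, ht, ht'⟩ := exists_seq (L := fun i => L ((i + 2 : ℕ) : ZMod n))
    (fun i => hL _) (P := fun i => q ((i + 2 : ℕ) : ZMod n)) (fun i hi => by
      have := hL' _ hi
      rwa [show ((i + 2 : ℕ) : ZMod n) + 3 = ((i + 3 + 2 : ℕ) : ZMod n) by push_cast; ring]
        at this) x y
  obtain ⟨u, hu, hu1, hu2, hu3⟩ := exists_mem_ne_ne_ne (hL 0) (Q := q (-3)) (fun h => by
    have := hL' _ h
    rwa [neg_add_cancel] at this) (t (n - 3)) (t (n - 4)) (t (n - 5))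
  obtain ⟨v, hv, hv1, hv2⟩ := exists_mem_ne_ne h1 u (t (n - 3))
  simp only [Finset.mem_sdiff, Finset.mem_insert, Finset.mem_singleton, not_or] at hv
  have hux : u ≠ x := fun h => hx0 (h ▸ hu)
  let c : ℕ → Fin 7 := fun i => if i = 0 then u else if i = 1 then v else t (i - 2)
  have c0 : c 0 = u := rfl
  have c1 : c 1 = v := rfl
  have c2 : ∀ i, c (i + 2) = t i := fun i => rfl
  have e1 : c (n - 1) = t (n - 3) := by rw [show n - 1 = n - 3 + 2 by omega, c2]
  have e2 : c (n - 2) = t (n - 4) := by rw [show n - 2 = n - 4 + 2 by omega, c2]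
  have e3 : c (n - 3) = t (n - 5) := by rw [show n - 3 = n - 5 + 2 by omega, c2]
  refine RingChoice.of_nat hn c ?_ ?_ ?_ ?_ ?_ ?_ ?_ ?_ fun i hi => (hq i hi).2.2.2
  · rintro (_ | _ | _ | _ | i) hi
    · simpa [c0] using hu
    · simpa [c1] using hv.1
    · rw [c2, t0]; simpa using hx2
    · rw [c2, t1]; simpa using hy
    · rw [c2]; exact (ht i).1
  · rintro (_ | _ | _ | i) hi
    · rw [c0, c1]; exact hv1.symm
    · rw [c1, c2, t0]; exact hv.2.1
    · rw [c2, c2, t0, t1]; exact hxy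
    · rw [c2, c2]; exact (ht i).2.1.symm
  · rintro (_ | _ | i) hi
    · rw [c0, c2, t0]; exact hux
    · rw [c1, c2, t1]; exact hv.2.2
    · rw [c2, c2]; exact (ht i).2.2.symm
  · rw [e1, c0]; exact hu1.symm
  · rw [e2, c0]; exact hu2.symm
  · rw [e1, c1]; exact hv2.symm
  · rintro (_ | _ | i) hqi hi
    · exact absurd Nat.cast_zero (hq _ hqi).1
    · exact absurd (by simp) (hq _ hqi).2.1
    · rw [show i + 1 + 1 + 3 = i + 3 + 2 by ring, c2, c2]; exact (ht' i hqi).symm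
  · intro h
    rw [e3, c0]; exact (hu3 h).symm

theorem RingChoice.of_large {n : ℕ} (hn : 6 ≤ n) {q : ZMod n → Prop}
    {L : ZMod n → Finset (Fin 7)} (hL : ∀ i, 3 ≤ (L i).card)
    (hL' : ∀ i, q i → 4 ≤ (L (i + 3)).card)
    (hq : ∀ i, q i → i ≠ 0 ∧ i ≠ 1 ∧ i ≠ 2 ∧ i ≠ -1 ∧ i ≠ -2)
    (h1 : 5 ≤ (L 1).card) (h2 : 4 ≤ (L 2).card) :
    RingChoice n q L := by
  obtain ⟨x, hx, -, -⟩ := exists_mem_ne_ne (hL 3) 0 0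
  obtain ⟨y, hy, hxy, -⟩ := exists_mem_ne_ne (hL 4) x x
  obtain ⟨t, t0, t1, ht, ht'⟩ := exists_seq (L := fun i => L ((i + 3 : ℕ) : ZMod n))
    (fun i => hL _) (P := fun i => q ((i + 3 : ℕ) : ZMod n)) (fun i hi => by
      have := hL' _ hi
      rwa [show ((i + 3 : ℕ) : ZMod n) + 3 = ((i + 3 + 3 : ℕ) : ZMod n) by push_cast; ring]
        at this) x y
  obtain ⟨u, hu, hu1, hu2⟩ := exists_mem_ne_ne (L := L 2 \ {t (n - 3)}) (by
    have := Finset.le_card_sdiff {t (n - 3)} (L 2)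
    rw [Finset.card_singleton] at this
    omega) x y
  obtain ⟨v, hv, hv1, hv2⟩ := exists_mem_ne_ne (L := L 1 \ {t (n - 3), t (n - 4)}) (by
    have := Finset.le_card_sdiff {t (n - 3), t (n - 4)} (L 1)
    have := Finset.card_le_two (a := t (n - 3)) (b := t (n - 4))
    omega) x u
  simp only [Finset.mem_sdiff, Finset.mem_insert, Finset.mem_singleton, not_or] at hu hv
  let c : ℕ → Fin 7 := fun i => if i = 0 then t (n - 3) else if i = 1 then v else
    if i = 2 then u else t (i - 3)
  have c0 : c 0 = t (n - 3) := rfl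
  have c1 : c 1 = v := rfl
  have c2 : c 2 = u := rfl
  have c3 : ∀ i, c (i + 3) = t i := fun i => rfl
  have e1 : c (n - 1) = t (n - 4) := by rw [show n - 1 = n - 4 + 3 by omega, c3]
  have e2 : c (n - 2) = t (n - 5) := by rw [show n - 2 = n - 5 + 3 by omega, c3]
  have t3 := ht (n - 5)
  rw [show n - 5 + 2 = n - 3 by omega, show n - 5 + 1 = n - 4 by omega,
    show n - 3 + 3 = n by omega] at t3
  refine RingChoice.of_nat hn c ?_ ?_ ?_ ?_ ?_ ?_ ?_ ?_ fun i hi => (hq i hi).2.2.2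
  · rintro (_ | _ | _ | _ | _ | i) hi
    · simpa [c0] using t3.1
    · simpa [c1] using hv.1
    · simpa [c2] using hu.1
    · rw [c3, t0]; simpa using hx
    · rw [c3, t1]; simpa using hy
    · rw [c3]; exact (ht i).1
  · rintro (_ | _ | _ | _ | i) hi
    · rw [c0, c1]; exact fun h => hv.2.1 h.symm
    · rw [c1, c2]; exact hv2
    · rw [c2, c3, t0]; exact hu1
    · rw [c3, c3, t0, t1]; exact hxy.symm
    · rw [c3, c3]; exact (ht i).2.1.symm
  · rintro (_ | _ | _ | i) hi
    · rw [c0, c2]; exact fun h => hu.2 h.symm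
    · rw [c1, c3, t0]; exact hv1
    · rw [c2, c3, t1]; exact hu2
    · rw [c3, c3]; exact (ht i).2.2.symm
  · rw [e1, c0]; exact t3.2.1.symm
  · rw [e2, c0]; exact t3.2.2.symm
  · rw [e1, c1]; exact fun h => hv.2.2 h.symm
  · rintro (_ | _ | _ | i) hqi hi
    · exact absurd Nat.cast_zero (hq _ hqi).1
    · exact absurd (by simp) (hq _ hqi).2.1
    · exact absurd (by norm_num) (hq _ hqi).2.2.1
    · rw [show i + 1 + 1 + 1 + 3 = i + 3 + 3 by ring, c3, c3]; exact (ht' i hqi).symm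
  · intro h
    have e3 : c (n - 3) = t (n - 6) := by rw [show n - 3 = n - 6 + 3 by omega, c3]
    have := ht' (n - 6) (by
      rw [show n - 6 + 3 = n - 3 by omega, Nat.cast_sub (by omega), ZMod.natCast_self, zero_sub]
      exact h)
    rw [show n - 6 + 3 = n - 3 by omega] at this
    rw [e3, c0]; exact this.symm

theorem RingChoice.shift_card {n : ℕ} {q : ZMod n → Prop} {L : ZMod n → Finset (Fin 7)}
    (hL' : ∀ i, q i → 4 ≤ (L (i + 3)).card) (s : ZMod n) :
    ∀ i, q (i + s) → 4 ≤ (L (i + 3 + s)).card := fun i hi => by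
  rw [add_right_comm]
  exact hL' _ hi

theorem RingChoice.shift_ne {n : ℕ} {q : ZMod n → Prop} {b : ZMod n}
    (hq : ∀ i, q i → i ≠ b - 1 ∧ i ≠ b ∧ i ≠ b + 1 ∧ i ≠ b - 2 ∧ i ≠ b - 3) :
    ∀ i, q (i + (b - 1)) → i ≠ 0 ∧ i ≠ 1 ∧ i ≠ 2 ∧ i ≠ -1 ∧ i ≠ -2 := fun i hi => by
  obtain ⟨h0, h1, h2, h3, h4⟩ := hq _ hi
  exact ⟨fun h => h0 (by rw [h]; ring), fun h => h1 (by rw [h]; ring),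
    fun h => h2 (by rw [h]; ring), fun h => h3 (by rw [h]; ring), fun h => h4 (by rw [h]; ring)⟩

/-- Lists cut out by sets of forbidden colours, with the sets at distance two disjoint. -/
theorem RingChoice.of_disjoint {n : ℕ} (hn : 6 ≤ n) {q : ZMod n → Prop}
    {L : ZMod n → Finset (Fin 7)} (hL : ∀ i, 3 ≤ (L i).card)
    (hL' : ∀ i, q i → 4 ≤ (L (i + 3)).card) (b : ZMod n)
    (hq : ∀ i, q i → i ≠ b - 1 ∧ i ≠ b ∧ i ≠ b + 1 ∧ i ≠ b - 2 ∧ i ≠ b - 3)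
    {A₁ A₂ A₃ A₄ : Finset (Fin 7)}
    (hA₁ : A₁.card = 2) (hA₂ : A₂.card = 2) (hA₃ : A₃.card = 2) (hA₄ : A₄.card ≤ 2)
    (h0 : ∀ x ∈ A₁, x ∉ L (b - 1)) (h11 : ∀ x ∈ A₁, x ∉ L b) (h12 : ∀ x ∈ A₂, x ∉ L b)
    (h1 : ∀ x, x ∉ A₁ → x ∉ A₂ → x ∈ L b)
    (h2 : ∀ x, x ∉ A₂ → x ∉ A₃ → x ∈ L (b + 1))
    (h3 : ∀ x, x ∉ A₃ → x ∉ A₄ → x ∈ L (b + 2))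
    (h13 : Disjoint A₁ A₃) (hne : A₂ ≠ A₁) (hne' : A₂ ≠ A₃ ∨ A₄ ≠ A₁) : RingChoice n q L := by
  rw [Finset.disjoint_left] at h13
  suffices ∃ x ∈ A₁, x ∉ A₂ ∧ ∃ y ∈ L (b + 2), x ≠ y ∧ 3 ≤ (L b \ {x, y}).card by
    obtain ⟨x, hx, hx2, y, hy, hxy, hc⟩ := this
    refine RingChoice.of_shift (b - 1) (RingChoice.of_pair hn (fun i => hL _)
      (RingChoice.shift_card hL' _) (RingChoice.shift_ne hq)
      (x := x) (y := y) ?_ ?_ ?_ hxy ?_)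
    · rw [show 2 + (b - 1) = b + 1 by ring]; exact h2 x hx2 (h13 hx)
    · rw [zero_add]; exact h0 x hx
    · rw [show 3 + (b - 1) = b + 2 by ring]; exact hy
    · rw [show 1 + (b - 1) = b by ring]; exact hc
  have hsub : ∀ {A B : Finset (Fin 7)}, A.card = 2 → B.card ≤ 2 → A ⊆ B → A = B :=
    fun hA hB h => Finset.eq_of_subset_of_card_le h (by omega)
  obtain ⟨x, hx, hx2⟩ := Finset.not_subset.1 fun h => hne (hsub hA₁ hA₂.le h).symm
  by_cases hdis : Disjoint A₁ A₂
  · have key : ∀ x ∈ A₁, ∀ y, (y ∈ A₁ ∨ y ∈ A₂) → (L b \ {x, y}).card = (L b).card := by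
      intro x hx y hy
      congr 1
      ext z
      simp only [Finset.mem_sdiff, Finset.mem_insert, Finset.mem_singleton, not_or,
        and_iff_left_iff_imp]
      intro hz
      exact ⟨fun h => h11 x hx (h ▸ hz), fun h => hy.elim (fun hy => h11 y hy (h ▸ hz))
        fun hy => h12 y hy (h ▸ hz)⟩
    rw [Finset.disjoint_left] at hdis
    by_cases hs : A₁ ⊆ A₄
    · have h4 := hsub hA₁ hA₄ hs
      have hne3 : A₂ ≠ A₃ := hne'.resolve_right fun h => h h4.symm
      obtain ⟨y, hy, hy3⟩ := Finset.not_subset.1 fun h => hne3 (hsub hA₂ hA₃.le h)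
      have hy1 : y ∉ A₁ := fun h => hdis h hy
      exact ⟨x, hx, hx2, y, h3 y hy3 (h4 ▸ hy1), fun h => hy1 (h ▸ hx),
        by rw [key x hx y (Or.inr hy)]; exact hL b⟩
    · obtain ⟨y, hy, hy4⟩ := Finset.not_subset.1 hs
      obtain ⟨z, hz, hzy⟩ := Finset.exists_mem_ne (by omega : 1 < A₁.card) y
      exact ⟨z, hz, hdis hz, y, h3 y (h13 hy) hy4, hzy,
        by rw [key z hz y (Or.inl hy)]; exact hL b⟩
  · obtain ⟨y, hy, hxy, -⟩ := exists_mem_ne_ne (hL (b + 2)) x x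
    refine ⟨x, hx, hx2, y, hy, hxy.symm, ?_⟩
    have h4 : (A₁ ∪ A₂).card ≤ 3 := by
      have h5 := Finset.card_union_add_card_inter A₁ A₂
      have h6 : (A₁ ∩ A₂).card ≠ 0 := by
        rw [Finset.card_ne_zero]
        exact Finset.not_disjoint_iff_nonempty_inter.1 hdis
      omega
    have h5 : (A₁ ∪ A₂)ᶜ \ {y} ⊆ L b \ {x, y} := by
      intro z hz
      simp only [Finset.mem_sdiff, Finset.mem_compl, Finset.mem_union, not_or,
        Finset.mem_singleton, Finset.mem_insert] at hz ⊢
      exact ⟨h1 z hz.1.1 hz.1.2, fun h => hz.1.1 (h ▸ hx), hz.2⟩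
    have h6 := Finset.card_le_card h5
    have h7 := Finset.le_card_sdiff {y} (A₁ ∪ A₂)ᶜ
    rw [Finset.card_compl, Fintype.card_fin, Finset.card_singleton] at h7
    omega

theorem RingChoice.of_eq {n : ℕ} (hn : 6 ≤ n) {q : ZMod n → Prop}
    {L : ZMod n → Finset (Fin 7)} (hL : ∀ i, 3 ≤ (L i).card)
    (hL' : ∀ i, q i → 4 ≤ (L (i + 3)).card) (b : ZMod n)
    (hq : ∀ i, q i → i ≠ b - 1 ∧ i ≠ b ∧ i ≠ b + 1 ∧ i ≠ b - 2 ∧ i ≠ b - 3)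
    {A₁ A₂ A₃ : Finset (Fin 7)}
    (hA₂ : A₂.card = 2) (hA₃ : A₃.card = 2)
    (h1 : ∀ x, x ∉ A₁ → x ∉ A₂ → x ∈ L b)
    (h2 : ∀ x, x ∉ A₂ → x ∉ A₃ → x ∈ L (b + 1))
    (h12 : A₁ = A₂) (h23 : ¬ Disjoint A₂ A₃) : RingChoice n q L := by
  subst h12
  refine RingChoice.of_shift (b - 1) (RingChoice.of_large hn (fun i => hL _)
    (RingChoice.shift_card hL' _) (RingChoice.shift_ne hq) ?_ ?_)
  · rw [show 1 + (b - 1) = b by ring]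
    have h3 : A₁ᶜ ⊆ L b := fun x hx => by
      rw [Finset.mem_compl] at hx
      exact h1 x hx hx
    have h4 := Finset.card_le_card h3
    rw [Finset.card_compl, Fintype.card_fin] at h4
    omega
  · rw [show 2 + (b - 1) = b + 1 by ring]
    have h3 : (A₁ ∪ A₃)ᶜ ⊆ L (b + 1) := fun x hx => by
      rw [Finset.mem_compl, Finset.mem_union, not_or] at hx
      exact h2 x hx.1 hx.2
    have h4 := Finset.card_le_card h3
    rw [Finset.card_compl, Fintype.card_fin] at h4
    have h5 := Finset.card_union_add_card_inter A₁ A₃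
    have h6 : (A₁ ∩ A₃).card ≠ 0 := by
      rw [Finset.card_ne_zero]
      exact Finset.not_disjoint_iff_nonempty_inter.1 h23
    omega

theorem RingChoice.six {q : ZMod 6 → Prop} (hq : ∀ i, ¬ q i) {L : ZMod 6 → Finset (Fin 7)}
    (hL : ∀ i, 3 ≤ (L i).card) : RingChoice 6 q L := by
  obtain ⟨x, hx, x', hx', y, hy, y', hy', z, hz, z', hz', h1, h2, h3, h4, h5, h6, h7, h8, h9,
    h10, h11, h12⟩ := octahedron_lists (hL 0) (hL 3) (hL 1) (hL 4) (hL 2) (hL 5)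
  refine ⟨![x, y, z, x', y', z'], fun i => ?_⟩
  suffices ∀ c : ZMod 6 → Fin 7, c i ∈ L i ∧ c i ≠ c (i + 1) ∧ c i ≠ c (i + 2) →
      c i ∈ L i ∧ c i ≠ c (i + 1) ∧ c i ≠ c (i + 2) ∧ (q i → c i ≠ c (i + 3)) from this _ (by
    fin_cases i
    exacts [⟨hx, h1, h3⟩, ⟨hy, h9, h5.symm⟩, ⟨hz, h7.symm, h11.symm⟩, ⟨hx', h6, h8⟩,
      ⟨hy', h12, h2.symm⟩, ⟨hz', h4.symm, h10.symm⟩])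
  exact fun c h => ⟨h.1, h.2.1, h.2.2, fun h' => absurd h' (hq i)⟩

namespace Frame

variable {F : Frame G}

theorem cf_of_mem_inc {v : V} {e f : Sym2 V} (he : e ∈ F.inc v) (hf : f ∈ F.inc v)
    (hne : e ≠ f) : F.cf e f :=
  ⟨(F.mem_inc.1 he).1, (F.mem_inc.1 hf).1, hne, v, (F.mem_inc.1 he).2, v, (F.mem_inc.1 hf).2,
    Or.inl rfl⟩

variable (F) in
/-- The colours at a vertex. -/
noncomputable def cl (c : Sym2 V → Fin 7) (v : V) : Finset (Fin 7) := (F.inc v).image c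

theorem card_cl_le (c : Sym2 V → Fin 7) (v : V) : (F.cl c v).card ≤ 2 :=
  Finset.card_image_le.trans (F.card_inc v).le

theorem PropOn.card_cl {S : Set (Sym2 V)} {c : Sym2 V → Fin 7} (hc : F.PropOn S c) {v : V}
    (hv : ∀ f ∈ F.inc v, f ∈ S) : (F.cl c v).card = 2 := by
  rw [cl, Finset.card_image_of_injOn, F.card_inc]
  intro e he f hf h
  by_contra hne
  exact hc e (hv e he) f (hv f hf) (cf_of_mem_inc he hf hne) h

/-- A cyclic arrangement `E` of all edges meeting `C`, where each position `i` satisfying `r`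
carries a vertex `w i` outside `C` seen exactly by `E (i - 1)` and `E i`, and where `E i`
and `E (i + 3)` are in conflict for `i` satisfying `q`. -/
structure Ring (F : Frame G) (C : Set V) (n : ℕ) (E : ZMod n → Sym2 V) (w : ZMod n → V)
    (r q : ZMod n → Prop) : Prop where
  le : 6 ≤ n
  inj : Function.Injective E
  touch : ∀ i, ∃ v ∈ C, v ∈ E i
  cover : ∀ v ∈ C, ∀ e ∈ F.inc v, ∃ i, E i = e
  cf_one : ∀ i, F.cf (E i) (E (i + 1))
  cf_two : ∀ i, F.cf (E i) (E (i + 2))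
  cf_three : ∀ i, q i → F.cf (E i) (E (i + 3))
  only : ∀ i j, F.cf (E i) (E j) → j = i + 1 ∨ j = i + 2 ∨ i = j + 1 ∨ i = j + 2 ∨
    q i ∧ j = i + 3 ∨ q j ∧ i = j + 3
  gap : ∀ i, q i → ¬ r (i + 1) ∧ ¬ r (i + 2) ∧ ¬ r (i + 3)
  w_inj : ∀ i j, r i → r j → w i = w j → i = j
  mt_mem : ∀ i, r i → F.mt (w i) ∈ C
  adj : ∀ i, r i → r (i + 1) → G.Adj (F.mt (w i)) (F.mt (w (i + 1)))
  mem_off : ∀ i, r i → ∀ f ∈ F.inc (w i), f ∈ F.off C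
  cf_left : ∀ i, r i → ∀ f ∈ F.inc (w i), F.cf (E (i - 1)) f
  cf_right : ∀ i, r i → ∀ f ∈ F.inc (w i), F.cf (E i) f
  comp : ∀ i, r i → r (i + 1) → ∀ f ∈ F.off C, F.cf (E i) f →
    f ∈ F.inc (w i) ∨ f ∈ F.inc (w (i + 1))
  comp_right : ∀ i, r i → ¬ r (i + 1) → ∃ g, ∀ f ∈ F.off C, F.cf (E i) f →
    f ∈ F.inc (w i) ∨ f = g
  comp_left : ∀ i, r i → ¬ r (i - 1) → ∃ g, ∀ f ∈ F.off C, F.cf (E (i - 1)) f →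
    f ∈ F.inc (w i) ∨ f = g

namespace Ring

variable {C : Set V} {n : ℕ} {E : ZMod n → Sym2 V} {w : ZMod n → V} {r q : ZMod n → Prop}

theorem reflect (h : F.Ring C n E w r q) :
    F.Ring C n (fun i => E (-i)) (fun i => w (1 - i)) (fun i => r (1 - i))
      (fun i => q (-i - 3)) where
  le := h.le
  inj := fun i j hij => neg_injective (h.inj hij)
  touch := fun i => h.touch (-i)
  cover := fun v hv e he => by
    obtain ⟨i, hi⟩ := h.cover v hv e he
    exact ⟨-i, by rw [neg_neg]; exact hi⟩
  cf_one := fun i => by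
    have := F.cf_symm (h.cf_one (-(i + 1)))
    rwa [show -(i + 1) + 1 = -i by ring] at this
  cf_two := fun i => by
    have := F.cf_symm (h.cf_two (-(i + 2)))
    rwa [show -(i + 2) + 2 = -i by ring] at this
  cf_three := fun i hi => by
    have := F.cf_symm (h.cf_three _ hi)
    rwa [sub_add_cancel, show -i - 3 = -(i + 3) by ring] at this
  gap := fun i hi => by
    obtain ⟨h1, h2, h3⟩ := h.gap _ hi
    rw [show -i - 3 + 1 = 1 - (i + 3) by ring] at h1
    rw [show -i - 3 + 2 = 1 - (i + 2) by ring] at h2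
    rw [show -i - 3 + 3 = 1 - (i + 1) by ring] at h3
    exact ⟨h3, h2, h1⟩
  only := fun i j hij => by
    rcases h.only _ _ hij with h | h | h | h | ⟨hq, h⟩ | ⟨hq, h⟩
    · exact Or.inr (Or.inr (Or.inl (by linear_combination h)))
    · exact Or.inr (Or.inr (Or.inr (Or.inl (by linear_combination h))))
    · exact Or.inl (by linear_combination h)
    · exact Or.inr (Or.inl (by linear_combination h))
    · refine Or.inr (Or.inr (Or.inr (Or.inr (Or.inr ⟨?_, by linear_combination h⟩))))
      rwa [h, add_sub_cancel_right]
    · refine Or.inr (Or.inr (Or.inr (Or.inr (Or.inl ⟨?_, by linear_combination h⟩))))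
      rwa [h, add_sub_cancel_right]
  w_inj := fun i j hi hj hij => by
    have := h.w_inj _ _ hi hj hij
    linear_combination -this
  mt_mem := fun i hi => h.mt_mem _ hi
  adj := fun i hi hi' => by
    rw [show 1 - (i + 1) = -i by ring] at hi' ⊢
    rw [show 1 - i = -i + 1 by ring] at hi ⊢
    exact (h.adj _ hi' hi).symm
  mem_off := fun i hi => h.mem_off _ hi
  cf_left := fun i hi => by
    rw [show -(i - 1) = 1 - i by ring]
    exact h.cf_right _ hi
  cf_right := fun i hi => by
    rw [show -i = 1 - i - 1 by ring]
    exact h.cf_left _ hi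
  comp := fun i hi hi' f hf hcf => by
    rw [show 1 - (i + 1) = -i by ring] at hi' ⊢
    rw [show 1 - i = -i + 1 by ring] at hi ⊢
    exact (h.comp _ hi' hi f hf hcf).symm
  comp_right := fun i hi hi' => by
    rw [show -i = 1 - i - 1 by ring]
    rw [show 1 - (i + 1) = 1 - i - 1 by ring] at hi'
    exact h.comp_left _ hi hi'
  comp_left := fun i hi hi' => by
    rw [show -(i - 1) = 1 - i by ring]
    rw [show 1 - (i - 1) = 1 - i + 1 by ring] at hi'
    exact h.comp_right _ hi hi'

theorem notMem_off (h : F.Ring C n E w r q) (i : ZMod n) : E i ∉ F.off C := by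
  obtain ⟨v, hv, hvE⟩ := h.touch i
  exact F.notMem_off hvE hv

theorem comp_cl (h : F.Ring C n E w r q) (c : Sym2 V → Fin 7) {i : ZMod n} (hi : r i)
    (hi' : r (i + 1)) :
    ∀ f ∈ F.off C, F.cf (E i) f → c f ∈ F.cl c (w i) ∨ c f ∈ F.cl c (w (i + 1)) :=
  fun f hf hcf => (h.comp i hi hi' f hf hcf).imp
    (fun h => Finset.mem_image_of_mem _ h) fun h => Finset.mem_image_of_mem _ h

theorem w_notMem (h : F.Ring C n E w r q) (i : ZMod n) (hi : r i) : w i ∉ C := fun hw => by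
  obtain ⟨f, hf⟩ := Finset.card_pos.1 (by rw [F.card_inc]; norm_num : 0 < (F.inc (w i)).card)
  exact F.notMem_off (F.mem_inc.1 hf).2 hw (h.mem_off i hi f hf)

theorem ne_of_gap (h : F.Ring C n E w r q) {b : ZMod n} (h1 : r b) (h2 : r (b + 1))
    (h3 : r (b + 2)) :
    ∀ i, q i → i ≠ b - 1 ∧ i ≠ b ∧ i ≠ b + 1 ∧ i ≠ b - 2 ∧ i ≠ b - 3 := by
  intro i hi
  obtain ⟨g1, g2, g3⟩ := h.gap i hi
  refine ⟨fun e => g1 ?_, fun e => g1 ?_, fun e => g1 ?_, fun e => g2 ?_, fun e => g3 ?_⟩ <;>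
    rw [e]
  · rwa [sub_add_cancel]
  · exact h2
  · rwa [show b + 1 + 1 = b + 2 by ring]
  · rwa [sub_add_cancel]
  · rwa [sub_add_cancel]

variable [Fintype V]

theorem card_av_aux (h : F.Ring C n E w r q) (c : Sym2 V → Fin 7) (i : ZMod n) :
    3 ≤ (F.av (F.off C) c (E i)).card ∧ (q (i - 3) → 4 ≤ (F.av (F.off C) c (E i)).card) := by
  have hn := h.le
  have hcast : ∀ m : ℕ, 0 < m → m < 6 → ((m : ℕ) : ZMod n) ≠ 0 := by
    intro m h0 hm h
    rw [ZMod.natCast_eq_zero_iff] at h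
    exact absurd (Nat.le_of_dvd h0 h) (by omega)
  have k1 := hcast 1 (by norm_num) (by norm_num)
  have k2 := hcast 2 (by norm_num) (by norm_num)
  have k3 := hcast 3 (by norm_num) (by norm_num)
  have k4 := hcast 4 (by norm_num) (by norm_num)
  have k5 := hcast 5 (by norm_num) (by norm_num)
  push_cast at k1 k2 k3 k4 k5
  have hne : ∀ {j k : ZMod n}, j - k ≠ 0 → E j ≠ E k := fun hjk he =>
    hjk (sub_eq_zero.2 (h.inj he))
  have hT : ∀ f ∈ ({E (i + 1), E (i + 2), E (i - 1), E (i - 2)} : Finset (Sym2 V)),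
      F.cf (E i) f ∧ f ∉ F.off C := by
    intro f hf
    simp only [Finset.mem_insert, Finset.mem_singleton] at hf
    rcases hf with rfl | rfl | rfl | rfl
    · exact ⟨h.cf_one i, h.notMem_off _⟩
    · exact ⟨h.cf_two i, h.notMem_off _⟩
    · refine ⟨F.cf_symm ?_, h.notMem_off _⟩
      have := h.cf_one (i - 1)
      rwa [sub_add_cancel] at this
    · refine ⟨F.cf_symm ?_, h.notMem_off _⟩
      have := h.cf_two (i - 2)
      rwa [sub_add_cancel] at this
  have hcard : ({E (i + 1), E (i + 2), E (i - 1), E (i - 2)} : Finset (Sym2 V)).card = 4 := by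
    rw [Finset.card_insert_of_notMem, Finset.card_insert_of_notMem, Finset.card_pair]
    · exact hne (by rw [show i - 1 - (i - 2) = 1 by ring]; exact k1)
    · simp only [Finset.mem_insert, Finset.mem_singleton, not_or]
      exact ⟨hne (by rw [show i + 2 - (i - 1) = 3 by ring]; exact k3),
        hne (by rw [show i + 2 - (i - 2) = 4 by ring]; exact k4)⟩
    · simp only [Finset.mem_insert, Finset.mem_singleton, not_or]
      exact ⟨(hne (by rw [show i + 2 - (i + 1) = 1 by ring]; exact k1)).symm,
        hne (by rw [show i + 1 - (i - 1) = 2 by ring]; exact k2),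
        hne (by rw [show i + 1 - (i - 2) = 3 by ring]; exact k3)⟩
  refine ⟨?_, fun hq => ?_⟩
  · have hl := F.card_av (S := F.off C) (c := c) (e := E i) _ hT
    omega
  · have hl := F.card_av (S := F.off C) (c := c) (e := E i)
      (insert (E (i - 3)) {E (i + 1), E (i + 2), E (i - 1), E (i - 2)}) (by
        intro f hf
        rcases Finset.mem_insert.1 hf with rfl | hf
        · refine ⟨F.cf_symm ?_, h.notMem_off _⟩
          have := h.cf_three (i - 3) hq
          rwa [sub_add_cancel] at this
        · exact hT f hf)
    rw [Finset.card_insert_of_notMem, hcard] at hl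
    · omega
    · simp only [Finset.mem_insert, Finset.mem_singleton, not_or]
      exact ⟨(hne (by rw [show i + 1 - (i - 3) = 4 by ring]; exact k4)).symm,
        (hne (by rw [show i + 2 - (i - 3) = 5 by ring]; exact k5)).symm,
        (hne (by rw [show i - 1 - (i - 3) = 2 by ring]; exact k2)).symm,
        (hne (by rw [show i - 2 - (i - 3) = 1 by ring]; exact k1)).symm⟩

theorem card_av (h : F.Ring C n E w r q) (c : Sym2 V → Fin 7) (i : ZMod n) :
    3 ≤ (F.av (F.off C) c (E i)).card :=
  (h.card_av_aux c i).1

theorem card_av_add_three (h : F.Ring C n E w r q) (c : Sym2 V → Fin 7) (i : ZMod n)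
    (hi : q i) : 4 ≤ (F.av (F.off C) c (E (i + 3))).card :=
  (h.card_av_aux c (i + 3)).2 (by rwa [add_sub_cancel_right])

theorem good_of_choice (h : F.Ring C n E w r q) {c : Sym2 V → Fin 7} (hc : F.PropOn (F.off C) c)
    (hch : RingChoice n q fun i => F.av (F.off C) c (E i)) : F.Good := by
  obtain ⟨x, hx⟩ := hch
  have hn : Nonempty (ZMod n) := ⟨0⟩
  let g : Sym2 V → Fin 7 := fun e => x (Function.invFun E e)
  have hg : ∀ i, g (E i) = x i := fun i => by
    simp only [g, Function.leftInverse_invFun h.inj i]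
  refine F.good_of_off (Z := C) (T := Set.range E) (fun v hv e he => h.cover v hv e he)
    (F.propOn_union (g := g) hc ?_ ?_ ?_)
  · rintro _ ⟨i, rfl⟩
    exact h.notMem_off i
  · rintro _ ⟨i, rfl⟩
    rw [hg]
    exact (hx i).1
  · rintro _ ⟨i, rfl⟩ _ ⟨j, rfl⟩ hij
    rw [hg, hg]
    rcases h.only i j hij with rfl | rfl | rfl | rfl | ⟨hq, rfl⟩ | ⟨hq, rfl⟩
    · exact (hx _).2.1
    · exact (hx _).2.2.1
    · exact (hx _).2.1.symm
    · exact (hx _).2.2.1.symm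
    · exact (hx _).2.2.2 hq
    · exact ((hx _).2.2.2 hq).symm

theorem mem_av_of_comp {c : Sym2 V → Fin 7} {e : Sym2 V} {A B : Finset (Fin 7)}
    (h : ∀ f ∈ F.off C, F.cf e f → c f ∈ A ∨ c f ∈ B) (x : Fin 7) (hA : x ∉ A) (hB : x ∉ B) :
    x ∈ F.av (F.off C) c e := by
  rw [F.mem_av]
  rintro f hf hef rfl
  exact (h f hf hef).elim hA hB

theorem notMem_av_of_cl {c : Sym2 V → Fin 7} {e : Sym2 V} {v : V}
    (hoff : ∀ f ∈ F.inc v, f ∈ F.off C) (hcf : ∀ f ∈ F.inc v, F.cf e f) :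
    ∀ x ∈ F.cl c v, x ∉ F.av (F.off C) c e := by
  intro x hx hav
  obtain ⟨f, hf, rfl⟩ := Finset.mem_image.1 hx
  exact F.mem_av.1 hav f (hoff f hf) (hcf f hf) rfl

theorem good_of_disjoint (h : F.Ring C n E w r q) {c : Sym2 V → Fin 7}
    (hc : F.PropOn (F.off C) c) {b : ZMod n} (h1 : r b) (h2 : r (b + 1)) (h3 : r (b + 2))
    (h13 : Disjoint (F.cl c (w b)) (F.cl c (w (b + 2))))
    (hne : F.cl c (w (b + 1)) ≠ F.cl c (w b))
    (hne' : F.cl c (w (b + 1)) ≠ F.cl c (w (b + 2)) ∨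
      (r (b + 3) → F.cl c (w (b + 3)) ≠ F.cl c (w b))) : F.Good := by
  have hcl : ∀ i, r i → (F.cl c (w i)).card = 2 := fun i hi => hc.card_cl (h.mem_off i hi)
  have e12 : b + 1 + 1 = b + 2 := by ring
  have e23 : b + 2 + 1 = b + 3 := by ring
  obtain ⟨A, hA, hcA, hA'⟩ : ∃ A : Finset (Fin 7), A.card ≤ 2 ∧
      (∀ f ∈ F.off C, F.cf (E (b + 2)) f → c f ∈ F.cl c (w (b + 2)) ∨ c f ∈ A) ∧
      (F.cl c (w (b + 1)) ≠ F.cl c (w (b + 2)) ∨ A ≠ F.cl c (w b)) := by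
    by_cases h4 : r (b + 3)
    · refine ⟨F.cl c (w (b + 3)), F.card_cl_le _ _, ?_, hne'.imp id fun h => h h4⟩
      have := h.comp_cl c h3 (by rw [e23]; exact h4)
      rwa [e23] at this
    · obtain ⟨g, hg⟩ := h.comp_right (b + 2) h3 (by rw [e23]; exact h4)
      refine ⟨{c g}, by simp, fun f hf hcf => ?_, Or.inr fun h => ?_⟩
      · rcases hg f hf hcf with h | rfl
        · exact Or.inl (Finset.mem_image_of_mem _ h)
        · exact Or.inr (Finset.mem_singleton_self _)
      · have := hcl b h1
        rw [← h, Finset.card_singleton] at this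
        omega
  have hcomp := h.comp_cl c h2 (by rw [e12]; exact h3)
  rw [e12] at hcomp
  have hl := h.cf_left (b + 1) h2
  rw [add_sub_cancel_right] at hl
  exact h.good_of_choice hc (RingChoice.of_disjoint h.le (h.card_av c)
    (h.card_av_add_three c) b (h.ne_of_gap h1 h2 h3) (hcl _ h1) (hcl _ h2)
    (hcl _ h3) hA (notMem_av_of_cl (h.mem_off b h1) (h.cf_left b h1))
    (notMem_av_of_cl (h.mem_off b h1) (h.cf_right b h1))
    (notMem_av_of_cl (h.mem_off _ h2) hl)
    (mem_av_of_comp (h.comp_cl c h1 h2)) (mem_av_of_comp hcomp) (mem_av_of_comp hcA) h13 hne hA')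

theorem good_of_eq (h : F.Ring C n E w r q) {c : Sym2 V → Fin 7}
    (hc : F.PropOn (F.off C) c) {b : ZMod n} (h1 : r b) (h2 : r (b + 1)) (h3 : r (b + 2))
    (h12 : F.cl c (w b) = F.cl c (w (b + 1)))
    (h23 : ¬ Disjoint (F.cl c (w (b + 1))) (F.cl c (w (b + 2)))) : F.Good := by
  have hcl : ∀ i, r i → (F.cl c (w i)).card = 2 := fun i hi => hc.card_cl (h.mem_off i hi)
  have e12 : b + 1 + 1 = b + 2 := by ring
  have hcomp := h.comp_cl c h2 (by rw [e12]; exact h3)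
  rw [e12] at hcomp
  exact h.good_of_choice hc (RingChoice.of_eq h.le (h.card_av c)
    (h.card_av_add_three c) b (h.ne_of_gap h1 h2 h3) (hcl _ h2) (hcl _ h3)
    (mem_av_of_comp (h.comp_cl c h1 h2)) (mem_av_of_comp hcomp) h12 h23)

end Ring

/-- Permuting the colours on the edges at `R`. -/
noncomputable def permuteAt (R : Set V) (π : Equiv.Perm (Fin 7)) (c : Sym2 V → Fin 7) :
    Sym2 V → Fin 7 :=
  fun e => if ∃ v ∈ e, v ∈ R then π (c e) else c e

section permute

variable {C R : Set V} {π : Equiv.Perm (Fin 7)} {c : Sym2 V → Fin 7}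

theorem permuteAt_of_mem {e : Sym2 V} {v : V} (hv : v ∈ e) (hR : v ∈ R) :
    permuteAt R π c e = π (c e) := if_pos ⟨v, hv, hR⟩

theorem permuteAt_of_notMem (hR : ∀ u ∈ R, ∀ v, G.Adj u v → v ∈ R ∨ v ∈ C) {e : Sym2 V}
    (he : e ∈ F.off C) {v : V} (hv : v ∈ e) (hvR : v ∉ R) : permuteAt R π c e = c e := by
  refine if_neg ?_
  rintro ⟨u, hu, huR⟩
  have hne : u ≠ v := fun h => hvR (h ▸ huR)
  have h1 : e = s(u, v) := (Sym2.mem_and_mem_iff hne).1 ⟨hu, hv⟩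
  have h2 : F.N.Adj u v := by
    have := he.1
    rw [h1] at this
    exact this
  rcases hR u huR v h2.1 with h | h
  · exact hvR h
  · exact he.2 v hv h

theorem PropOn.permuteAt (hR : ∀ u ∈ R, ∀ v, G.Adj u v → v ∈ R ∨ v ∈ C)
    (hc : F.PropOn (F.off C) c) : F.PropOn (F.off C) (permuteAt R π c) := by
  intro e he f hf hef
  have hne := hc e he f hf hef
  obtain ⟨u, hu, v, hv, huv⟩ := hef.2.2.2
  have hiff : u ∈ R ↔ v ∈ R := by
    rcases huv with rfl | huv
    · exact Iff.rfl
    · exact ⟨fun h => (hR u h v huv).resolve_right (hf.2 v hv),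
        fun h => (hR v h u huv.symm).resolve_right (he.2 u hu)⟩
  by_cases h : u ∈ R
  · rw [permuteAt_of_mem hu h, permuteAt_of_mem hv (hiff.1 h)]
    exact fun h => hne (π.injective h)
  · rw [permuteAt_of_notMem hR he hu h, permuteAt_of_notMem hR hf hv (fun h' => h (hiff.2 h'))]
    exact hne

theorem cl_permuteAt_of_mem {v : V} (hv : v ∈ R) :
    F.cl (permuteAt R π c) v = (F.cl c v).image π := by
  rw [cl, cl, Finset.image_image]
  exact Finset.image_congr fun e he => permuteAt_of_mem (F.mem_inc.1 he).2 hv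

theorem cl_permuteAt_of_notMem (hR : ∀ u ∈ R, ∀ v, G.Adj u v → v ∈ R ∨ v ∈ C) {v : V}
    (hv : v ∉ R) (hoff : ∀ f ∈ F.inc v, f ∈ F.off C) : F.cl (permuteAt R π c) v = F.cl c v :=
  Finset.image_congr fun e he => permuteAt_of_notMem hR (hoff e he) (F.mem_inc.1 he).2 hv

end permute

namespace Ring

variable {C : Set V} {n : ℕ} {E : ZMod n → Sym2 V} {w : ZMod n → V} {r q : ZMod n → Prop}
  [Fintype V]

theorem good_of_last (h : F.Ring C n E w r q) {c : Sym2 V → Fin 7}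
    (hc : F.PropOn (F.off C) c) {b : ZMod n} (h1 : r b) (h2 : r (b + 1)) (h3 : r (b + 2))
    {R : Set V} (hR : ∀ u ∈ R, ∀ v, G.Adj u v → v ∈ R ∨ v ∈ C)
    (k1 : w b ∉ R) (k2 : w (b + 1) ∉ R) (k3 : w (b + 2) ∈ R) : F.Good := by
  have hcl : ∀ i, r i → (F.cl c (w i)).card = 2 := fun i hi => hc.card_cl (h.mem_off i hi)
  have hkeep : ∀ π i, r i → w i ∉ R → F.cl (permuteAt R π c) (w i) = F.cl c (w i) :=
    fun π i hi hw => cl_permuteAt_of_notMem hR hw (h.mem_off i hi)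
  have c1 := hcl _ h1
  have c2 := hcl _ h2
  have c3 := hcl _ h3
  by_cases heq : F.cl c (w b) = F.cl c (w (b + 1))
  · obtain ⟨π, hπ⟩ := exists_perm_into (C := F.cl c (w (b + 2))) (T := F.cl c (w (b + 1)))
      (by omega)
    refine h.good_of_eq (hc.permuteAt (π := π) hR) h1 h2 h3 ?_ ?_
    · rw [hkeep π b h1 k1, hkeep π _ h2 k2]; exact heq
    · rw [hkeep π _ h2 k2, cl_permuteAt_of_mem k3]
      obtain ⟨x, hx⟩ := Finset.card_pos.1 (by omega : 0 < (F.cl c (w (b + 2))).card)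
      exact Finset.not_disjoint_iff.2 ⟨π x, hπ x hx, Finset.mem_image_of_mem _ hx⟩
  · obtain ⟨a, ha⟩ := Finset.card_pos.1 (by omega : 0 < (F.cl c (w (b + 1))).card)
    obtain ⟨π, hπ⟩ := exists_perm_into (C := F.cl c (w (b + 2)))
      (T := (insert a (F.cl c (w b)))ᶜ) (by
        rw [Finset.card_compl, Fintype.card_fin]
        have := Finset.card_insert_le a (F.cl c (w b))
        omega)
    have hmem : ∀ x ∈ F.cl (permuteAt R π c) (w (b + 2)), x ≠ a ∧ x ∉ F.cl c (w b) := by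
      intro x hx
      rw [cl_permuteAt_of_mem k3] at hx
      obtain ⟨y, hy, rfl⟩ := Finset.mem_image.1 hx
      simpa using hπ y hy
    refine h.good_of_disjoint (hc.permuteAt (π := π) hR) h1 h2 h3 ?_ ?_ (Or.inl ?_)
    · rw [hkeep π b h1 k1, Finset.disjoint_right]
      exact fun x hx => (hmem x hx).2
    · rw [hkeep π b h1 k1, hkeep π _ h2 k2]; exact fun h => heq h.symm
    · rw [hkeep π _ h2 k2]
      exact fun h => (hmem a (h ▸ ha)).1 rfl

theorem good_of_middle (h : F.Ring C n E w r q) {c : Sym2 V → Fin 7}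
    (hc : F.PropOn (F.off C) c) {b : ZMod n} (h1 : r b) (h2 : r (b + 1)) (h3 : r (b + 2))
    {R : Set V} (hR : ∀ u ∈ R, ∀ v, G.Adj u v → v ∈ R ∨ v ∈ C)
    (k1 : w b ∉ R) (k2 : w (b + 1) ∈ R) (k3 : w (b + 2) ∉ R) : F.Good := by
  have hcl : ∀ i, r i → (F.cl c (w i)).card = 2 := fun i hi => hc.card_cl (h.mem_off i hi)
  have hkeep : ∀ π i, r i → w i ∉ R → F.cl (permuteAt R π c) (w i) = F.cl c (w i) :=
    fun π i hi hw => cl_permuteAt_of_notMem hR hw (h.mem_off i hi)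
  have c1 := hcl _ h1
  have c2 := hcl _ h2
  have c3 := hcl _ h3
  by_cases hd : Disjoint (F.cl c (w b)) (F.cl c (w (b + 2)))
  · obtain ⟨π, hπ⟩ := exists_perm_into (C := F.cl c (w (b + 1)))
      (T := (F.cl c (w b) ∪ F.cl c (w (b + 2)))ᶜ) (by
        rw [Finset.card_compl, Fintype.card_fin]
        have := Finset.card_union_le (F.cl c (w b)) (F.cl c (w (b + 2)))
        omega)
    obtain ⟨y, hy⟩ := Finset.card_pos.1 (by omega : 0 < (F.cl c (w (b + 1))).card)
    have hy' : π y ∈ F.cl (permuteAt R π c) (w (b + 1)) := by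
      rw [cl_permuteAt_of_mem k2]
      exact Finset.mem_image_of_mem _ hy
    have hmem := hπ y hy
    rw [Finset.mem_compl, Finset.mem_union, not_or] at hmem
    refine h.good_of_disjoint (hc.permuteAt (π := π) hR) h1 h2 h3 ?_ ?_ (Or.inl ?_)
    · rw [hkeep π b h1 k1, hkeep π _ h3 k3]; exact hd
    · rw [hkeep π b h1 k1]; exact fun h => hmem.1 (h ▸ hy')
    · rw [hkeep π _ h3 k3]; exact fun h => hmem.2 (h ▸ hy')
  · obtain ⟨π, hπ⟩ := exists_perm_into (C := F.cl c (w (b + 1))) (T := F.cl c (w b)) (by omega)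
    have heq : F.cl (permuteAt R π c) (w (b + 1)) = F.cl c (w b) := by
      rw [cl_permuteAt_of_mem k2]
      refine Finset.eq_of_subset_of_card_le (Finset.image_subset_iff.2 hπ) ?_
      rw [Finset.card_image_of_injective _ π.injective]
      omega
    refine h.good_of_eq (hc.permuteAt (π := π) hR) h1 h2 h3 ?_ ?_
    · rw [hkeep π b h1 k1, heq]
    · rw [heq, hkeep π _ h3 k3]; exact hd

/-- Three consecutive positions that are not all on the same side of a set which is closed
outside `C`. -/
theorem good_of_split (h : F.Ring C n E w r q) (hG : G.Connected) {b : ZMod n} (h1 : r b)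
    (h2 : r (b + 1)) (h3 : r (b + 2)) {R : Set V}
    (hR : ∀ u ∈ R, ∀ v, G.Adj u v → v ∈ R ∨ v ∈ C)
    (hs : ¬ ((w b ∈ R ↔ w (b + 1) ∈ R) ∧ (w (b + 1) ∈ R ↔ w (b + 2) ∈ R))) : F.Good := by
  obtain ⟨z, hz, -⟩ := h.touch 0
  obtain ⟨c, hc⟩ := F.flow_connected hG (Z := C) ⟨z, hz⟩
  change F.PropOn (F.off C) c at hc
  have hC := h.w_notMem
  have key : ∀ R : Set V, (∀ u ∈ R, ∀ v, G.Adj u v → v ∈ R ∨ v ∈ C) →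
      (w b ∉ R ∧ w (b + 1) ∉ R ∧ w (b + 2) ∈ R ∨ w b ∉ R ∧ w (b + 1) ∈ R ∧ w (b + 2) ∉ R ∨
        w b ∈ R ∧ w (b + 1) ∉ R ∧ w (b + 2) ∉ R) → F.Good := by
    rintro R hR (⟨k1, k2, k3⟩ | ⟨k1, k2, k3⟩ | ⟨k1, k2, k3⟩)
    · exact h.good_of_last hc h1 h2 h3 hR k1 k2 k3
    · exact h.good_of_middle hc h1 h2 h3 hR k1 k2 k3
    · have e1 : 1 - (-b - 1) = b + 2 := by ring
      have e2 : 1 - (-b - 1 + 1) = b + 1 := by ring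
      have e3 : 1 - (-b - 1 + 2) = b := by ring
      exact h.reflect.good_of_last hc (b := -b - 1) (by rw [e1]; exact h3)
        (by rw [e2]; exact h2) (by rw [e3]; exact h1) hR (by rw [e1]; exact k3)
        (by rw [e2]; exact k2) (by rw [e3]; exact k1)
  have hR' : ∀ u ∈ (R ∪ C)ᶜ, ∀ v, G.Adj u v → v ∈ (R ∪ C)ᶜ ∨ v ∈ C := by
    intro u hu v huv
    simp only [Set.mem_compl_iff, Set.mem_union, not_or] at hu ⊢
    by_cases hv : v ∈ C
    · exact Or.inr hv
    · refine Or.inl ⟨fun hvR => ?_, hv⟩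
      exact (hR v hvR u huv.symm).elim hu.1 hu.2
  have hmem : ∀ i, r i → (w i ∈ (R ∪ C)ᶜ ↔ w i ∉ R) := fun i hi => by
    simp [hC i hi]
  by_cases k1 : w b ∈ R <;> by_cases k2 : w (b + 1) ∈ R <;> by_cases k3 : w (b + 2) ∈ R
  · exact absurd ⟨iff_of_true k1 k2, iff_of_true k2 k3⟩ hs
  · exact key _ hR' (by
      rw [hmem _ h1, hmem _ h2, hmem _ h3]; simp [k1, k2, k3])
  · exact key _ hR' (by
      rw [hmem _ h1, hmem _ h2, hmem _ h3]; simp [k1, k2, k3])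
  · exact key _ hR (by simp [k1, k2, k3])
  · exact key _ hR' (by
      rw [hmem _ h1, hmem _ h2, hmem _ h3]; simp [k1, k2, k3])
  · exact key _ hR (by simp [k1, k2, k3])
  · exact key _ hR (by simp [k1, k2, k3])
  · exact absurd ⟨iff_of_false k1 k2, iff_of_false k2 k3⟩ hs

theorem good_of_six (h : F.Ring C n E w r q) (hn : n = 6) (hq : ∀ i, ¬ q i)
    (hG : G.Connected) : F.Good := by
  subst hn
  obtain ⟨z, hz, -⟩ := h.touch 0
  obtain ⟨c, hc⟩ := F.flow_connected hG (Z := C) ⟨z, hz⟩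
  exact h.good_of_choice hc (RingChoice.six hq (h.card_av c))

end Ring

end Frame

/-- The graph `G` with the edges meeting `C` deleted. -/
def offGraph (G : SimpleGraph V) (C : Set V) : SimpleGraph V where
  Adj u v := G.Adj u v ∧ u ∉ C ∧ v ∉ C
  symm := ⟨fun _ _ h => ⟨h.1.symm, h.2.2, h.2.1⟩⟩
  loopless := ⟨fun _ h => h.1.ne rfl⟩

/-- Depths that vanish exactly on `C` and decrease within the complement of `C` down to the
sink `z`. -/
structure Depth (G : SimpleGraph V) (C : Set V) (z : V) (d : V → ℕ) : Prop where
  eq_zero : ∀ v, v ∈ C ↔ d v = 0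
  parent : ∀ v, v ∉ C → ∃ p, G.Adj v p ∧ d p < d v
  parent_notMem : ∀ v, v ∉ C → v ≠ z → ∃ p, p ∉ C ∧ G.Adj v p ∧ d p < d v

theorem exists_depth_off {C : Set V} {z c : V} (hc : c ∈ C) (hzc : G.Adj z c)
    (hconn : ∀ v, v ∉ C → (offGraph G C).Reachable v z) : ∃ d, Depth G C z d := by
  obtain ⟨d, -, hd⟩ := exists_depth (offGraph G C) {z}
  have hp : ∀ v, v ∉ C → v ≠ z → ∃ p, p ∉ C ∧ G.Adj v p ∧
      (if p ∈ C then 0 else d p + 1) < (if v ∈ C then 0 else d v + 1) := by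
    intro v hv hvz
    obtain ⟨-, p, hp, hlt⟩ := hd v hvz ⟨z, rfl, hconn v hv⟩
    refine ⟨p, hp.2.2, hp.1, ?_⟩
    rw [if_neg hp.2.2, if_neg hv]
    omega
  refine ⟨fun v => if v ∈ C then 0 else d v + 1, fun v => ?_, fun v hv => ?_, hp⟩
  · by_cases h : v ∈ C <;> simp [h]
  · by_cases hvz : v = z
    · subst hvz
      exact ⟨c, hzc, by simp [hc, hv]⟩
    · obtain ⟨p, -, hp⟩ := hp v hv hvz
      exact ⟨p, hp⟩

namespace Frame

variable {F : Frame G} {C : Set V} {z : V} {d : V → ℕ}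

theorem off_later (hd : Depth G C z d) {e : Sym2 V} (he : e ∈ F.off C) :
    ∃ p, ∀ f ∈ F.inc p, F.cf e f ∧ md d f < md d e := by
  induction e with | _ u v
  have he' : F.N.Adj u v := he.1
  rcases le_total (d u) (d v) with h | h
  · obtain ⟨p, hp, hpd⟩ := hd.parent u (he.2 u (Sym2.mem_mk_left _ _))
    exact ⟨p, F.later he' h hp hpd⟩
  · obtain ⟨p, hp, hpd⟩ := hd.parent v (he.2 v (Sym2.mem_mk_right _ _))
    rw [Sym2.eq_swap]
    exact ⟨p, F.later he'.symm h hp hpd⟩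

theorem N_adj_of_mem {e : Sym2 V} {u v : V} (he : e ∈ F.N.edgeSet) (hu : u ∈ e) (hv : v ∈ e)
    (hne : u ≠ v) : F.N.Adj u v := by
  rw [(Sym2.mem_and_mem_iff hne).1 ⟨hu, hv⟩] at he
  exact he

theorem off_later_of_mate (hd : Depth G C z d) (h3 : ∀ x y z, G.Adj x y → G.Adj y z → ¬ G.Adj x z)
    (h4 : ∀ x y z w, G.Adj x y → G.Adj y z → G.Adj z w → G.Adj w x → x = z ∨ y = w)
    {w : V} (hw : w ≠ z) (hmt : F.mt w ∈ C) {e : Sym2 V} (he : e ∈ F.off C) (hwe : w ∈ e) :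
    ∃ p, (∀ f ∈ F.inc p, F.cf e f ∧ md d f < md d e) ∧ Disjoint (F.inc p) (F.inc (F.mt w)) := by
  obtain ⟨y, rfl⟩ := hwe
  have hN : F.N.Adj w y := he.1
  have hwC : w ∉ C := he.2 w (Sym2.mem_mk_left _ _)
  have hyC : y ∉ C := he.2 y (Sym2.mem_mk_right _ _)
  have hwm : G.Adj w (F.mt w) := F.adj_mt w fun h => hwC (h ▸ hmt)
  have common : ∀ p, p ≠ F.mt w → ¬ Disjoint (F.inc p) (F.inc (F.mt w)) →
      G.Adj p (F.mt w) := by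
    intro p hp hdis
    obtain ⟨f, hf, hf'⟩ := Finset.not_disjoint_iff.1 hdis
    rw [F.mem_inc] at hf hf'
    exact (N_adj_of_mem hf.1 hf.2 hf'.2 hp).1
  rcases le_total (d w) (d y) with h | h
  · obtain ⟨p, hpC, hp, hpd⟩ := hd.parent_notMem w hwC hw
    refine ⟨p, F.later hN h hp hpd, ?_⟩
    by_contra hdis
    exact h3 _ _ _ hp (common p (fun h => hpC (h ▸ hmt)) hdis) hwm
  · obtain ⟨p, hp, hpd⟩ := hd.parent y hyC
    refine ⟨p, by rw [Sym2.eq_swap]; exact F.later hN.symm h hp hpd, ?_⟩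
    by_contra hdis
    by_cases hpm : p = F.mt w
    · exact h3 _ _ _ hN.1 (hpm ▸ hp) hwm
    · rcases h4 _ _ _ _ hp (common p hpm hdis) hwm.symm hN.1 with h' | h'
      · exact hyC (h' ▸ hmt)
      · rw [h'] at hpd
        omega

theorem cl_ne_of_adj {c : Sym2 V → Fin 7} (hc : F.PropOn (F.off C) c) {u v : V}
    (hu : ∀ f ∈ F.inc u, f ∈ F.off C) (hv : ∀ f ∈ F.inc v, f ∈ F.off C) (h : F.N.Adj u v) :
    F.cl c u ≠ F.cl c v := by
  intro heq
  have h0 : s(u, v) ∈ F.inc u := F.mem_inc.2 ⟨h, Sym2.mem_mk_left _ _⟩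
  obtain ⟨e, he, hne⟩ := Finset.exists_mem_ne (by rw [F.card_inc]; norm_num :
    1 < (F.inc u).card) s(u, v)
  have hx : c e ∈ F.cl c v := heq ▸ Finset.mem_image_of_mem _ he
  obtain ⟨f, hf, hfe⟩ := Finset.mem_image.1 hx
  have hef : e ≠ f := by
    rintro rfl
    exact hne ((Sym2.mem_and_mem_iff h.1.ne).1 ⟨(F.mem_inc.1 he).2, (F.mem_inc.1 hf).2⟩)
  exact hc e (hu e he) f (hv f hf) ⟨(F.mem_inc.1 he).1, (F.mem_inc.1 hf).1, hef, u,
    (F.mem_inc.1 he).2, v, (F.mem_inc.1 hf).2, Or.inr h.1⟩ hfe.symm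

variable [Fintype V]

/-- Colouring the edges avoiding `C` so that moreover the colours on `X` and `Y` are distinct. -/
theorem exists_separating (hd : Depth G C z d)
    (h3 : ∀ x y z, G.Adj x y → G.Adj y z → ¬ G.Adj x z)
    (h4 : ∀ x y z w, G.Adj x y → G.Adj y z → G.Adj z w → G.Adj w x → x = z ∨ y = w)
    {r : Sym2 V → ℕ} (hr : Function.Injective r) (hrd : ∀ e f, md d f < md d e → r e < r f)
    {X Y : Finset (Sym2 V)} (hXY : Disjoint X Y) (hX : X.card ≤ 2)
    (hrich : ∀ e, e ∈ X ∨ e ∈ Y → ∃ w, w ∈ e ∧ w ≠ z ∧ F.mt w ∈ C)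
    (hY : ∀ e ∈ X, (Y.filter fun f => r f < r e).card ≤ 2)
    (hoff : ∀ e, e ∈ X ∨ e ∈ Y → e ∈ F.off C) :
    ∃ c, F.PropOn (F.off C) c ∧ ∀ e ∈ X, ∀ f ∈ Y, c e ≠ c f := by
  let R : Sym2 V → Sym2 V → Prop := fun e f =>
    F.cf e f ∨ (e ∈ X ∧ f ∈ Y) ∨ (e ∈ Y ∧ f ∈ X)
  obtain ⟨c, -, hc⟩ := greedy R (by
      rintro e (h | h | h)
      · exact F.cf_irrefl e h
      · exact Finset.disjoint_left.1 hXY h.1 h.2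
      · exact Finset.disjoint_left.1 hXY h.2 h.1)
    (by
      rintro e f (h | h | h)
      · exact Or.inl (F.cf_symm h)
      · exact Or.inr (Or.inr ⟨h.2, h.1⟩)
      · exact Or.inr (Or.inl ⟨h.2, h.1⟩))
    ∅ (Finset.univ.filter fun e => e ∈ F.off C) (by simp) r
    (fun e _ f _ h => hr h) (fun _ => 0) (by simp) (by
      intro e he
      simp only [Finset.mem_filter, Finset.mem_univ, true_and] at he
      have hearly : ∀ p, (∀ f ∈ F.inc p, F.cf e f ∧ md d f < md d e) →
          ∀ f ∈ F.inc p, f ∈ F.nb e ∧ ¬ r f < r e := fun p hp f hf =>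
        ⟨F.mem_nb.2 (hp f hf).1, by have := hrd _ _ (hp f hf).2; omega⟩
      have hnb := F.card_nb e
      by_cases hext : e ∈ X ∨ e ∈ Y
      · obtain ⟨w, hwe, hwz, hwm⟩ := hrich e hext
        obtain ⟨p, hp, hdis⟩ := off_later_of_mate hd h3 h4 hwz hwm he hwe
        obtain ⟨B, hB, hBm⟩ : ∃ B : Finset (Sym2 V), B.card ≤ 2 ∧
            ∀ f, (e ∈ X ∧ f ∈ Y ∨ e ∈ Y ∧ f ∈ X) → r f < r e → f ∈ B := by
          by_cases heX : e ∈ X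
          · refine ⟨_, hY e heX, fun f hf hlt => ?_⟩
            rcases hf with hf | hf
            · exact Finset.mem_filter.2 ⟨hf.2, hlt⟩
            · exact absurd hf.1 (Finset.disjoint_left.1 hXY heX)
          · exact ⟨X, hX, fun f hf _ => (hf.resolve_left fun h => heX h.1).2⟩
        have hcf : ∀ f ∈ F.inc (F.mt w), f ∈ F.nb e ∧ f ∉ F.off C := by
          intro f hf
          rw [F.mem_inc] at hf
          have hf' : f ∉ F.off C := F.notMem_off hf.2 hwm
          refine ⟨F.mem_nb.2 ⟨he.1, hf.1, fun h => hf' (h ▸ he), w, hwe, _, hf.2, Or.inr ?_⟩, hf'⟩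
          exact F.adj_mt w fun h => he.2 w hwe (h ▸ hwm)
        have hsub : F.inc p ∪ F.inc (F.mt w) ⊆ F.nb e := by
          intro f hf
          rcases Finset.mem_union.1 hf with hf | hf
          exacts [(hearly p hp f hf).1, (hcf f hf).1]
        have hcard := Finset.card_sdiff_of_subset hsub
        rw [Finset.card_union_of_disjoint hdis, F.card_inc, F.card_inc] at hcard
        refine (Finset.card_le_card
          (t := (F.nb e \ (F.inc p ∪ F.inc (F.mt w))) ∪ B) ?_).trans ?_
        · intro f hf
          simp only [Finset.mem_filter, Finset.mem_univ, true_and, Set.mem_empty_iff_false,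
            false_or] at hf
          rw [Finset.mem_union, Finset.mem_sdiff, Finset.mem_union]
          rcases hf.1 with h | h
          · refine Or.inl ⟨F.mem_nb.2 h, ?_⟩
            rintro (h' | h')
            · exact (hearly p hp f h').2 hf.2.2
            · exact (hcf f h').2 hf.2.1
          · exact Or.inr (hBm f h hf.2.2)
        · have := Finset.card_union_le (F.nb e \ (F.inc p ∪ F.inc (F.mt w))) B
          omega
      · obtain ⟨p, hp⟩ := off_later hd he
        have hcard := Finset.card_sdiff_of_subset
          (fun f hf => (hearly p hp f hf).1 : F.inc p ⊆ F.nb e)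
        rw [F.card_inc] at hcard
        refine (Finset.card_le_card (t := F.nb e \ F.inc p) ?_).trans (by omega)
        intro f hf
        simp only [Finset.mem_filter, Finset.mem_univ, true_and, Set.mem_empty_iff_false,
          false_or] at hf
        rw [Finset.mem_sdiff]
        refine ⟨F.mem_nb.2 (hf.1.resolve_right fun h => hext ?_), fun h =>
          (hearly p hp f h).2 hf.2.2⟩
        exact h.imp And.left And.left)
  refine ⟨c, fun e he f hf hef => hc e (Or.inr (by simpa using he)) f (Or.inr (by simpa using hf))
    (Or.inl hef), fun e he f hf => ?_⟩
  exact hc e (Or.inr (by simpa using hoff e (Or.inl he))) f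
    (Or.inr (by simpa using hoff f (Or.inr hf))) (Or.inr (Or.inl ⟨he, hf⟩))

namespace Ring

variable {n : ℕ} {E : ZMod n → Sym2 V} {w : ZMod n → V} {r q : ZMod n → Prop}

theorem good_of_min (h : F.Ring C n E w r q) (hd : Depth G C z d)
    (h3 : ∀ x y z, G.Adj x y → G.Adj y z → ¬ G.Adj x z)
    (h4 : ∀ x y z w, G.Adj x y → G.Adj y z → G.Adj z w → G.Adj w x → x = z ∨ y = w)
    (h5 : ∀ x y z w u, G.Adj x y → G.Adj y z → G.Adj z w → G.Adj w u → ¬ G.Adj u x)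
    {rk : Sym2 V → ℕ} (hr : Function.Injective rk)
    (hrd : ∀ e f, md d f < md d e → rk e < rk f) {top : V → Sym2 V}
    (htop : ∀ v, top v ∈ F.inc v) (hmax : ∀ v, ∀ e ∈ F.inc v, rk e ≤ rk (top v)) {b : ZMod n}
    (hmin : ∀ i, r i → w i ≠ z → rk (top (w b)) ≤ rk (top (w i)))
    (h1 : r b) (z1 : w b ≠ z) (h2 : r (b + 1)) (z2 : w (b + 1) ≠ z) (r3 : r (b + 2))
    (z3 : w (b + 2) ≠ z) (z4 : r (b + 3) → w (b + 3) ≠ z) : F.Good := by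
  have hadj : ∀ i, r i → G.Adj (w i) (F.mt (w i)) := fun i hi =>
    F.adj_mt _ fun h' => h.w_notMem i hi (h' ▸ h.mt_mem i hi)
  have hnadj : ∀ i j, r i → r j → G.Adj (w i) (w j) → F.N.Adj (w i) (w j) := fun i j hi hj hij =>
    ⟨hij, fun h' => h.w_notMem j hj (h' ▸ h.mt_mem i hi)⟩
  have hshare : ∀ i j, r i → r j → i ≠ j → ∀ e, e ∈ F.inc (w i) → e ∈ F.inc (w j) →
      G.Adj (w i) (w j) := by
    intro i j hi hj hij e he he'
    rw [F.mem_inc] at he he'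
    exact (N_adj_of_mem he.1 he.2 he'.2 fun h' => hij (h.w_inj i j hi hj h')).1
  have hcast : ∀ m : ℕ, 0 < m → m < 6 → b ≠ b + (m : ZMod n) := by
    intro m h0 hm h'
    rw [left_eq_add, ZMod.natCast_eq_zero_iff] at h'
    have := Nat.le_of_dvd h0 h'
    have := h.le
    omega
  have k1 := hcast 1 (by norm_num) (by norm_num)
  have k2 := hcast 2 (by norm_num) (by norm_num)
  have k3 := hcast 3 (by norm_num) (by norm_num)
  push_cast at k1 k2 k3
  have a12 := h.adj b h1 h2
  have a23 : G.Adj (F.mt (w (b + 1))) (F.mt (w (b + 2))) := by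
    have := h.adj (b + 1) h2 (by rw [show b + 1 + 1 = b + 2 by ring]; exact r3)
    rwa [show b + 1 + 1 = b + 2 by ring] at this
  let Y : Finset (Sym2 V) := F.inc (w (b + 2)) ∪ {top (w (b + 1))} ∪
    if r (b + 3) ∧ ¬ G.Adj (w b) (w (b + 3)) then {top (w (b + 3))} else ∅
  have hY : ∀ e, e ∈ Y ↔ e ∈ F.inc (w (b + 2)) ∨ e = top (w (b + 1)) ∨
      ((r (b + 3) ∧ ¬ G.Adj (w b) (w (b + 3))) ∧ e = top (w (b + 3))) := by
    intro e
    simp only [Y, Finset.mem_union, Finset.mem_singleton, or_assoc]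
    split_ifs with h' <;> simp [h']
  have hsrc : ∀ e, e ∈ F.inc (w b) ∨ e ∈ Y → ∃ i, r i ∧ w i ≠ z ∧ e ∈ F.inc (w i) := by
    rintro e (he | he)
    · exact ⟨b, h1, z1, he⟩
    · rcases (hY e).1 he with he | rfl | ⟨h', rfl⟩
      · exact ⟨_, r3, z3, he⟩
      · exact ⟨_, h2, z2, htop _⟩
      · exact ⟨_, h'.1, z4 h'.1, htop _⟩
  obtain ⟨c, hc, hsep⟩ := exists_separating (F := F) hd h3 h4 hr hrd (X := F.inc (w b)) (Y := Y)
    (by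
      rw [Finset.disjoint_left]
      intro e he heY
      rcases (hY e).1 heY with he' | rfl | ⟨h', rfl⟩
      · have := hshare _ _ h1 r3 k2 e he he'
        exact h5 _ _ _ _ _ (hadj _ h1) a12 a23 (hadj _ r3).symm this.symm
      · have := hshare _ _ h1 h2 k1 _ he (htop _)
        rcases h4 _ _ _ _ (hadj _ h1) a12 (hadj _ h2).symm this.symm with h' | h'
        · exact h.w_notMem _ h1 (h' ▸ h.mt_mem _ h2)
        · exact h.w_notMem _ h2 (h' ▸ h.mt_mem _ h1)
      · exact h'.2 (hshare _ _ h1 h'.1 k3 _ he (htop _)))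
    (F.card_inc _).le
    (by
      intro e he
      obtain ⟨i, hi, hz, hei⟩ := hsrc e he
      exact ⟨w i, (F.mem_inc.1 hei).2, hz, h.mt_mem i hi⟩)
    (by
      intro e he
      rw [← F.card_inc (w (b + 2))]
      refine Finset.card_le_card fun f hf => ?_
      rw [Finset.mem_filter] at hf
      have hle := hmax _ e he
      rcases (hY f).1 hf.1 with hf' | rfl | ⟨h', rfl⟩
      · exact hf'
      · have := hmin _ h2 z2
        omega
      · have := hmin _ h'.1 (z4 h'.1)
        omega)
    (by
      intro e he
      obtain ⟨i, hi, -, hei⟩ := hsrc e he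
      exact h.mem_off i hi e hei)
  have hnot : ∀ e ∈ Y, c e ∉ F.cl c (w b) := by
    intro e he hce
    obtain ⟨f, hf, hfe⟩ := Finset.mem_image.1 hce
    exact hsep f hf e he hfe
  refine h.good_of_disjoint hc h1 h2 r3 ?_ ?_ (Or.inr fun h4' => ?_)
  · rw [Finset.disjoint_right]
    intro x hx
    obtain ⟨f, hf, rfl⟩ := Finset.mem_image.1 hx
    exact hnot f ((hY f).2 (Or.inl hf))
  · intro heq
    refine hnot _ ((hY _).2 (Or.inr (Or.inl rfl))) ?_
    rw [← heq]
    exact Finset.mem_image_of_mem _ (htop _)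
  · by_cases hadj4 : G.Adj (w b) (w (b + 3))
    · exact (cl_ne_of_adj hc (h.mem_off _ h1) (h.mem_off _ h4') (hnadj _ _ h1 h4' hadj4)).symm
    · intro heq
      refine hnot _ ((hY _).2 (Or.inr (Or.inr ⟨⟨h4', hadj4⟩, rfl⟩))) ?_
      rw [← heq]
      exact Finset.mem_image_of_mem _ (htop _)

theorem good_of_sink (h : F.Ring C n E w r q) {c : V} (hcC : c ∈ C) (hzc : G.Adj z c)
    (hconn : ∀ v, v ∉ C → (offGraph G C).Reachable v z)
    (h3 : ∀ x y z, G.Adj x y → G.Adj y z → ¬ G.Adj x z)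
    (h4 : ∀ x y z w, G.Adj x y → G.Adj y z → G.Adj z w → G.Adj w x → x = z ∨ y = w)
    (h5 : ∀ x y z w u, G.Adj x y → G.Adj y z → G.Adj z w → G.Adj w u → ¬ G.Adj u x)
    (hne : ∃ i, r i ∧ w i ≠ z)
    (hwin : ∀ i, r i → w i ≠ z →
      ((r (i + 1) ∧ w (i + 1) ≠ z) ∧ (r (i + 2) ∧ w (i + 2) ≠ z) ∧
        (r (i + 3) → w (i + 3) ≠ z)) ∨
      ((r (i - 1) ∧ w (i - 1) ≠ z) ∧ (r (i - 2) ∧ w (i - 2) ≠ z) ∧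
        (r (i - 3) → w (i - 3) ≠ z))) : F.Good := by
  have : NeZero n := ⟨by have := h.le; omega⟩
  obtain ⟨d, hd⟩ := exists_depth_off hcC hzc hconn
  obtain ⟨rk, hr, hrd⟩ := exists_rank d
  choose top htop hmax using fun v => Finset.exists_max_image (F.inc v) rk
    (Finset.card_pos.1 (by rw [F.card_inc]; norm_num))
  obtain ⟨i₀, hi₀⟩ := hne
  obtain ⟨b, hb, hmin⟩ := Finset.exists_min_image
    (Finset.univ.filter fun i => r i ∧ w i ≠ z) (fun i => rk (top (w i))) ⟨i₀, by simpa using hi₀⟩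
  simp only [Finset.mem_filter, Finset.mem_univ, true_and] at hb hmin
  rcases hwin b hb.1 hb.2 with ⟨h1, h2, h'⟩ | ⟨h1, h2, h'⟩
  · exact h.good_of_min hd h3 h4 h5 hr hrd htop hmax (fun i hi hz => hmin i ⟨hi, hz⟩)
      hb.1 hb.2 h1.1 h1.2 h2.1 h2.2 h'
  · have e0 : 1 - (1 - b) = b := by ring
    have e1 : 1 - (1 - b + 1) = b - 1 := by ring
    have e2 : 1 - (1 - b + 2) = b - 2 := by ring
    have e3 : 1 - (1 - b + 3) = b - 3 := by ring
    exact h.reflect.good_of_min hd h3 h4 h5 hr hrd htop hmax (b := 1 - b)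
      (fun i hi hz => by rw [e0]; exact hmin _ ⟨hi, hz⟩)
      (by rw [e0]; exact hb.1) (by rw [e0]; exact hb.2) (by rw [e1]; exact h1.1)
      (by rw [e1]; exact h1.2) (by rw [e2]; exact h2.1) (by rw [e2]; exact h2.2)
      (by rw [e3]; exact h')

end Ring

end Frame

namespace Frame

variable {F : Frame G}

theorem cf_of_notMem {e f : Sym2 V} {u v : V} (he : e ∈ F.N.edgeSet) (hf : f ∈ F.N.edgeSet)
    (hu : u ∈ e) (hv : v ∈ f) (huv : G.Adj u v) (hne : u ∉ f) : F.cf e f :=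
  ⟨he, hf, fun h => hne (h ▸ hu), u, hu, v, hv, Or.inr huv⟩

theorem mem_inc_mt_or {C : Set V} {e f : Sym2 V} (hf : f ∈ F.off C) (he : ∀ u ∈ e, u ∈ C)
    (hcf : F.cf e f) : ∃ u ∈ e, f ∈ F.inc (F.mt u) ∨ ∃ v ∈ f, v ∉ C ∧ F.N.Adj u v := by
  obtain ⟨-, -, -, u, hu, v, hv, huv⟩ := hcf
  refine ⟨u, hu, ?_⟩
  rcases huv with rfl | huv
  · exact absurd (he u hu) (hf.2 u hv)
  · rcases F.adj_cases huv with rfl | h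
    · exact Or.inl (F.mem_inc.2 ⟨hf.1, hv⟩)
    · exact Or.inr ⟨v, hv, hf.2 v hv, h⟩

theorem mt_inj {u v : V} (h : F.mt u = F.mt v) : u = v := by
  rw [← F.mt_mt u, h, F.mt_mt]

theorem mem_off_of_inc {C : Set V} {w : V} (hw : w ∉ C) (h : ∀ v ∈ C, ¬ F.N.Adj v w)
    {f : Sym2 V} (hf : f ∈ F.inc w) : f ∈ F.off C := by
  rw [F.mem_inc] at hf
  obtain ⟨hf, t, rfl⟩ := hf
  refine ⟨hf, fun v hv hvC => ?_⟩
  rcases Sym2.mem_iff.1 hv with rfl | rfl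
  · exact hw hvC
  · exact h v hvC (SimpleGraph.Adj.symm hf)

/-- The ring around an induced cycle of `N`. -/
theorem Ring.of_cycle {n : ℕ} (hn : 6 ≤ n) {p : ZMod n → V} (hp : Function.Injective p)
    (hN : ∀ i, F.N.Adj (p i) (p (i + 1)))
    (hch : ∀ i j, G.Adj (p i) (p j) → j = i + 1 ∨ i = j + 1) (hm : ∀ v, F.mt v ≠ v) :
    F.Ring (Set.range p) n (fun i => s(p i, p (i + 1))) (fun i => F.mt (p i)) (fun _ => True)
      (fun _ => False) := by
  have hcast : ∀ m : ℕ, 0 < m → m < 6 → ((m : ℕ) : ZMod n) ≠ 0 := by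
    intro m h0 hm h
    rw [ZMod.natCast_eq_zero_iff] at h
    exact absurd (Nat.le_of_dvd h0 h) (by omega)
  have k1 := hcast 1 (by norm_num) (by norm_num)
  have k2 := hcast 2 (by norm_num) (by norm_num)
  have k3 := hcast 3 (by norm_num) (by norm_num)
  push_cast at k1 k2 k3
  have hN' : ∀ i, F.N.Adj (p i) (p (i - 1)) := fun i => by
    have := (hN (i - 1)).symm
    rwa [sub_add_cancel] at this
  have hnb : ∀ i v, F.N.Adj (p i) v → v ∈ Set.range p := by
    intro i v hv
    rcases F.eq_or_eq_oth (hN i) hv with rfl | h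
    · exact ⟨_, rfl⟩
    · refine ⟨i - 1, ?_⟩
      rw [h]
      refine F.eq_oth (hN i) (hN' i) fun h' => k2 ?_
      linear_combination -(hp h')
  have hw : ∀ i, F.mt (p i) ∉ Set.range p := by
    rintro i ⟨j, hj⟩
    have h1 : G.Adj (p i) (p j) := by rw [hj]; exact F.adj_mt _ (hm _)
    have h2 : F.N.Adj (p i) (p j) := by
      rcases hch i j h1 with rfl | rfl
      · exact hN i
      · exact (hN j).symm
    exact h2.2 hj
  have hE : ∀ i u, u ∈ s(p i, p (i + 1)) → u ∈ Set.range p := by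
    intro i u hu
    rcases Sym2.mem_iff.1 hu with rfl | rfl <;> exact ⟨_, rfl⟩
  have hinj : Function.Injective fun i => s(p i, p (i + 1)) := by
    intro i j hij
    rcases Sym2.eq_iff.1 hij with h | h
    · exact hp h.1
    · exact absurd (by linear_combination hp h.2 - hp h.1 : (2 : ZMod n) = 0) k2
  have hmo : ∀ i, ∀ f ∈ F.inc (F.mt (p i)), f ∈ F.off (Set.range p) := fun i f hf =>
    mem_off_of_inc (hw i) (by
      rintro _ ⟨j, rfl⟩ h
      exact hw i (hnb j _ h)) hf
  have hcf : ∀ i j, p j ∈ s(p i, p (i + 1)) → ∀ f ∈ F.inc (F.mt (p j)),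
      F.cf s(p i, p (i + 1)) f := fun i j hj f hf =>
    cf_of_notMem (hN i) (F.mem_inc.1 hf).1 hj (F.mem_inc.1 hf).2 (F.adj_mt _ (hm _))
      fun h => (hmo j f hf).2 _ h ⟨j, rfl⟩
  refine ⟨hn, hinj, fun i => ⟨p i, ⟨i, rfl⟩, Sym2.mem_mk_left _ _⟩, ?_, ?_, ?_,
    fun _ h => h.elim, ?_, fun _ h => h.elim, ?_, ?_, ?_, fun i _ => hmo i, ?_, ?_, ?_, ?_, ?_⟩
  · rintro _ ⟨i, rfl⟩ e he
    obtain ⟨he, t, rfl⟩ := F.mem_inc.1 he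
    replace he : F.N.Adj (p i) t := he
    rcases F.eq_or_eq_oth (hN i) he with rfl | h
    · exact ⟨i, rfl⟩
    · refine ⟨i - 1, ?_⟩
      have h' := F.eq_oth (hN i) (hN' i) fun h' => k2 (by linear_combination -(hp h'))
      rw [h, ← h']
      simp only [sub_add_cancel]
      exact Sym2.eq_swap
  · exact fun i => ⟨hN i, hN (i + 1), fun h => k1 (by linear_combination -(hinj h)), p (i + 1),
      Sym2.mem_mk_right _ _, _, Sym2.mem_mk_left _ _, Or.inl rfl⟩
  · refine fun i => ⟨hN i, hN (i + 2), fun h => k2 (by linear_combination -(hinj h)), p (i + 1),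
      Sym2.mem_mk_right _ _, _, Sym2.mem_mk_left _ _, Or.inr ?_⟩
    have := (hN (i + 1)).1
    rwa [show i + 1 + 1 = i + 2 by ring] at this
  · rintro i j ⟨-, -, hne, u, hu, v, hv, huv⟩
    have hij : i ≠ j := fun h => hne (by rw [h])
    have key : ∀ a b : ZMod n, p a = p b ∨ G.Adj (p a) (p b) →
        a = b ∨ b = a + 1 ∨ a = b + 1 := fun a b h => h.imp (fun h => hp h) (hch a b)
    rcases Sym2.mem_iff.1 hu with rfl | rfl <;> rcases Sym2.mem_iff.1 hv with rfl | rfl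
    · rcases key _ _ huv with h | h | h
      · exact absurd h hij
      · exact Or.inl h
      · exact Or.inr (Or.inr (Or.inl h))
    · rcases key _ _ huv with h | h | h
      · exact Or.inr (Or.inr (Or.inl h))
      · exact absurd (add_right_cancel h).symm hij
      · exact Or.inr (Or.inr (Or.inr (Or.inl (by linear_combination h))))
    · rcases key _ _ huv with h | h | h
      · exact Or.inl h.symm
      · exact Or.inr (Or.inl (by linear_combination h))
      · exact absurd (add_right_cancel h) hij
    · rcases key _ _ huv with h | h | h
      · exact absurd (add_right_cancel h) hij
      · exact Or.inl (by linear_combination h)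
      · exact Or.inr (Or.inr (Or.inl (by linear_combination h)))
  · exact fun i j _ _ h => hp (mt_inj h)
  · exact fun i _ => ⟨i, (F.mt_mt _).symm⟩
  · intro i _ _
    rw [F.mt_mt, F.mt_mt]
    exact (hN i).1
  · intro i _ f hf
    exact hcf (i - 1) i (by rw [sub_add_cancel]; exact Sym2.mem_mk_right _ _) f hf
  · intro i _ f hf
    exact hcf i i (Sym2.mem_mk_left _ _) f hf
  · intro i _ _ f hf hcf
    obtain ⟨u, hu, h | ⟨v, hv, hvC, huv⟩⟩ := mem_inc_mt_or hf (hE i) hcf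
    · rcases Sym2.mem_iff.1 hu with rfl | rfl
      exacts [Or.inl h, Or.inr h]
    · rcases Sym2.mem_iff.1 hu with rfl | rfl <;> exact absurd (hnb _ _ huv) hvC
  · exact fun i _ h => absurd trivial h
  · exact fun i _ h => absurd trivial h

/-- The ring around a path of `N` whose ends are joined by an edge outside `N`, the path being
`y 1, …, y (n - 1)`. -/
theorem Ring.of_path {n : ℕ} (hn : 7 ≤ n) {y : ℕ → V}
    (hy : ∀ i j, i ≤ n → j ≤ n → y i = y j → i = j) (hN : ∀ i < n, F.N.Adj (y i) (y (i + 1)))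
    (hch : ∀ i j, i < j → j ≤ n → G.Adj (y i) (y j) → j = i + 1 ∨ i = 1 ∧ j + 1 = n)
    (hmt : F.mt (y 1) = y (n - 1)) (hm : ∀ v, F.mt v ≠ v) :
    F.Ring {v | ∃ i, 1 ≤ i ∧ i < n ∧ y i = v} n (fun i => s(y i.val, y (i.val + 1)))
      (fun i => F.mt (y i.val)) (fun i => 2 ≤ i.val ∧ i.val + 1 < n) (fun i => i.val + 2 = n) := by
  have : NeZero n := ⟨by omega⟩
  have hval : ∀ m < n, ((m : ℕ) : ZMod n).val = m := fun m h => by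
    rw [ZMod.val_natCast, Nat.mod_eq_of_lt h]
  have hadd : ∀ m k : ℕ, m < n → k < n → (((m : ℕ) : ZMod n) + (k : ℕ)).val =
      if m + k < n then m + k else m + k - n := fun m k h h' => by
    rw [← Nat.cast_add, ZMod.val_natCast]
    split_ifs with h1
    · exact Nat.mod_eq_of_lt h1
    · rw [Nat.mod_eq_sub_mod (by omega), Nat.mod_eq_of_lt (by omega)]
  have hadd1 : ∀ m < n, (((m : ℕ) : ZMod n) + 1).val = if m + 1 < n then m + 1 else m + 1 - n :=
    fun m h => by have := hadd m 1 h (by omega); rwa [Nat.cast_one] at this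
  have hadd2 : ∀ m < n, (((m : ℕ) : ZMod n) + 2).val = if m + 2 < n then m + 2 else m + 2 - n :=
    fun m h => by have := hadd m 2 h (by omega); rwa [Nat.cast_ofNat] at this
  have hadd3 : ∀ m < n, (((m : ℕ) : ZMod n) + 3).val = if m + 3 < n then m + 3 else m + 3 - n :=
    fun m h => by have := hadd m 3 h (by omega); rwa [Nat.cast_ofNat] at this
  have hsub : ∀ m, 1 ≤ m → m < n → (((m : ℕ) : ZMod n) - 1).val = m - 1 := fun m h h' => by
    have := hval (m - 1) (by omega)
    rwa [Nat.cast_sub h, Nat.cast_one] at this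
  have hnat : ∀ i : ZMod n, ∃ m < n, ((m : ℕ) : ZMod n) = i := fun i =>
    ⟨i.val, ZMod.val_lt i, ZMod.natCast_zmod_val i⟩
  have hlink : G.Adj (y (n - 1)) (y 1) := by
    rw [← hmt]; exact (F.adj_mt _ (hm _)).symm
  have key : ∀ i j, i ≤ n → j ≤ n → (y i = y j ∨ G.Adj (y i) (y j)) →
      i = j ∨ j = i + 1 ∨ i = j + 1 ∨ i = 1 ∧ j + 1 = n ∨ j = 1 ∧ i + 1 = n := by
    rintro i j hi hj (h | h)
    · exact Or.inl (hy i j hi hj h)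
    · rcases lt_trichotomy i j with h' | h' | h'
      · have := hch i j h' hj h
        omega
      · exact Or.inl h'
      · have := hch j i h' hi h.symm
        omega
  have hN' : ∀ i, 1 ≤ i → i ≤ n → F.N.Adj (y i) (y (i - 1)) := fun i h h' => by
    have := (hN (i - 1) (by omega)).symm
    rwa [Nat.sub_add_cancel h] at this
  have hnb : ∀ i, 1 ≤ i → i < n → ∀ v, F.N.Adj (y i) v → v = y (i - 1) ∨ v = y (i + 1) := by
    intro i h h' v hv
    refine (F.eq_or_eq_oth (hN' i h h'.le) hv).imp id fun h1 => ?_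
    rw [h1]
    exact (F.eq_oth (hN' i h h'.le) (hN i h') fun h2 => by
      have := hy _ _ (by omega) (by omega) h2
      omega).symm
  have hw : ∀ i, 2 ≤ i → i + 1 < n → ∀ j ≤ n, F.mt (y i) ≠ y j := by
    intro i h h' j hj hij
    have h1 : G.Adj (y i) (y j) := by rw [← hij]; exact F.adj_mt _ (hm _)
    have h2 : F.N.Adj (y i) (y j) := by
      rcases key i j (by omega) hj (Or.inr h1) with rfl | rfl | rfl | h2 | h2
      · exact absurd h1 (G.irrefl)
      · exact hN i (by omega)
      · exact (hN j (by omega)).symm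
      · omega
      · omega
    exact h2.2 hij.symm
  set C : Set V := {v | ∃ i, 1 ≤ i ∧ i < n ∧ y i = v} with hC
  have hmo : ∀ i, 2 ≤ i → i + 1 < n → ∀ f ∈ F.inc (F.mt (y i)), f ∈ F.off C := by
    intro i h h' f hf
    refine mem_off_of_inc ?_ ?_ hf
    · rintro ⟨j, -, hj, hij⟩
      exact hw i h h' j hj.le hij.symm
    · rintro _ ⟨j, hj, hj', rfl⟩ hij
      rcases hnb j hj hj' _ hij with h1 | h1
      · exact hw i h h' _ (by omega) h1
      · exact hw i h h' _ (by omega) h1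
  have hcf : ∀ i j, i < n → 2 ≤ j → j + 1 < n → y j ∈ s(y i, y (i + 1)) →
      ∀ f ∈ F.inc (F.mt (y j)), F.cf s(y i, y (i + 1)) f := fun i j hi hj hj' hij f hf =>
    cf_of_notMem (hN i hi) (F.mem_inc.1 hf).1 hij (F.mem_inc.1 hf).2 (F.adj_mt _ (hm _))
      fun h => (hmo j hj hj' f hf).2 _ h ⟨j, by omega, by omega, rfl⟩
  have hEinj : ∀ a b, a < n → b < n → s(y a, y (a + 1)) = s(y b, y (b + 1)) → a = b := by
    intro a b ha hb h
    rcases Sym2.eq_iff.1 h with h | h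
    · exact hy a b ha.le hb.le h.1
    · have h1 := hy a (b + 1) ha.le hb h.1
      have h2 := hy (a + 1) b ha hb.le h.2
      omega
  have hcfE : ∀ a b, a < n → b < n → a ≠ b → ∀ u ∈ s(y a, y (a + 1)), ∀ v ∈ s(y b, y (b + 1)),
      (u = v ∨ G.Adj u v) → F.cf s(y a, y (a + 1)) s(y b, y (b + 1)) :=
    fun a b ha hb hab u hu v hv huv =>
      ⟨hN a ha, hN b hb, fun h => hab (hEinj a b ha hb h), u, hu, v, hv, huv⟩
  have hE : ∀ i, 1 ≤ i → i + 1 < n → ∀ u ∈ s(y i, y (i + 1)), u ∈ C := by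
    intro i h h' u hu
    rcases Sym2.mem_iff.1 hu with rfl | rfl
    exacts [⟨i, h, by omega, rfl⟩, ⟨i + 1, by omega, h', rfl⟩]
  have hoff : ∀ i, 1 ≤ i → i + 1 < n → ∀ f ∈ F.off C, F.cf s(y i, y (i + 1)) f →
      (f ∈ F.inc (F.mt (y i)) ∨ i = 1 ∧ f = s(y 0, F.oth (y 1) (y 0))) ∨
      f ∈ F.inc (F.mt (y (i + 1))) ∨ i + 2 = n ∧ f = s(y n, F.oth (y (n - 1)) (y n)) := by
    intro i h h' f hf hif
    have hend : ∀ a b, F.N.Adj (y a) (y b) → y b ∈ C → y a ∈ f →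
        f = s(y a, F.oth (y b) (y a)) := by
      intro a b hab hb ha
      have hi : f ∈ F.inc (y a) := F.mem_inc.2 ⟨hf.1, ha⟩
      rw [F.inc_eq hab, Finset.mem_insert, Finset.mem_singleton] at hi
      exact hi.resolve_left fun h => hf.2 (y b) (h ▸ Sym2.mem_mk_right _ _) hb
    have h01 : ∀ j, 1 ≤ j → j < n → ∀ v, F.N.Adj (y j) v → v ∉ C → v ∈ f →
        j = 1 ∧ f = s(y 0, F.oth (y 1) (y 0)) ∨
          j + 1 = n ∧ f = s(y n, F.oth (y (n - 1)) (y n)) := by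
      intro j hj hj' v hv hvC hvf
      rcases hnb j hj hj' v hv with rfl | rfl
      · have h1 : j = 1 := by
          by_contra h1
          exact hvC ⟨j - 1, by omega, by omega, rfl⟩
        subst h1
        exact Or.inl ⟨rfl, hend 0 1 (hN 0 (by omega)) ⟨1, le_rfl, by omega, rfl⟩ hvf⟩
      · have h1 : j + 1 = n := by
          by_contra h1
          exact hvC ⟨j + 1, by omega, by omega, rfl⟩
        refine Or.inr ⟨h1, hend n (n - 1) (hN' n (by omega) le_rfl)
          ⟨n - 1, by omega, by omega, rfl⟩ ?_⟩
        rwa [h1] at hvf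
    obtain ⟨u, hu, h1 | ⟨v, hv, hvC, huv⟩⟩ := mem_inc_mt_or hf (hE i h h') hif
    · rcases Sym2.mem_iff.1 hu with rfl | rfl
      exacts [Or.inl (Or.inl h1), Or.inr (Or.inl h1)]
    · rcases Sym2.mem_iff.1 hu with rfl | rfl
      · rcases h01 i h (by omega) v huv hvC hv with h1 | h1
        · exact Or.inl (Or.inr h1)
        · omega
      · rcases h01 (i + 1) (by omega) h' v huv hvC hv with h1 | h1
        · omega
        · exact Or.inr (Or.inr ⟨by omega, h1.2⟩)
  refine ⟨by omega, ?_, ?_, ?_, ?_, ?_, ?_, ?_, ?_, ?_, ?_, ?_, ?_, ?_, ?_, ?_, ?_, ?_⟩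
  · intro i j hij
    exact ZMod.val_injective n (hEinj _ _ (ZMod.val_lt _) (ZMod.val_lt _) hij)
  · intro i
    have := ZMod.val_lt i
    by_cases h : i.val = 0
    · exact ⟨y (i.val + 1), ⟨i.val + 1, by omega, by omega, rfl⟩, Sym2.mem_mk_right _ _⟩
    · exact ⟨y i.val, ⟨i.val, by omega, by omega, rfl⟩, Sym2.mem_mk_left _ _⟩
  · rintro _ ⟨i, hi, hi', rfl⟩ e he
    obtain ⟨he, t, rfl⟩ := F.mem_inc.1 he
    rcases hnb i hi hi' t he with rfl | rfl
    · refine ⟨((i - 1 : ℕ) : ZMod n), ?_⟩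
      simp only [hval (i - 1) (by omega), Nat.sub_add_cancel hi]
      exact Sym2.eq_swap
    · refine ⟨(i : ZMod n), ?_⟩
      simp only [hval i hi']
  · intro i
    obtain ⟨m, hm, rfl⟩ := hnat i
    simp only [hval m hm, hadd1 m hm]
    split_ifs with h
    · exact hcfE _ _ hm h (by omega) _ (Sym2.mem_mk_right _ _) _ (Sym2.mem_mk_left _ _)
        (Or.inl rfl)
    · obtain rfl : m = n - 1 := by omega
      rw [show n - 1 + 1 - n = 0 by omega]
      exact hcfE _ _ hm (by omega) (by omega) _ (Sym2.mem_mk_left _ _) _ (Sym2.mem_mk_right _ _)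
        (Or.inr hlink)
  · intro i
    obtain ⟨m, hm, rfl⟩ := hnat i
    simp only [hval m hm, hadd2 m hm]
    split_ifs with h
    · exact hcfE _ _ hm h (by omega) _ (Sym2.mem_mk_right _ _) _ (Sym2.mem_mk_left _ _)
        (Or.inr (hN (m + 1) (by omega)).1)
    · rcases (by omega : m + 1 = n ∨ m + 2 = n) with h' | h'
      · obtain rfl : m = n - 1 := by omega
        rw [show n - 1 + 2 - n = 1 by omega]
        exact hcfE _ _ hm (by omega) (by omega) _ (Sym2.mem_mk_left _ _) _ (Sym2.mem_mk_left _ _)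
          (Or.inr hlink)
      · rw [show m + 2 - n = 0 by omega]
        refine hcfE _ _ hm (by omega) (by omega) _ (Sym2.mem_mk_right _ _) _
          (Sym2.mem_mk_right _ _) (Or.inr ?_)
        rw [show m + 1 = n - 1 by omega]
        exact hlink
  · intro i hi
    obtain ⟨m, hm, rfl⟩ := hnat i
    simp only [hval m hm] at hi
    simp only [hval m hm, hadd3 m hm]
    rw [if_neg (by omega), show m + 3 - n = 1 by omega]
    refine hcfE _ _ hm (by omega) (by omega) _ (Sym2.mem_mk_right _ _) _
      (Sym2.mem_mk_left _ _) (Or.inr ?_)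
    rw [show m + 1 = n - 1 by omega]
    exact hlink
  · rintro i j ⟨-, -, hne, u, hu, v, hv, huv⟩
    obtain ⟨a, ha, rfl⟩ := hnat i
    obtain ⟨b, hb, rfl⟩ := hnat j
    simp only [hval a ha, hval b hb] at hne hu hv ⊢
    have hab : a ≠ b := fun h => hne (by rw [h])
    have hc : ∀ a b k : ℕ, a + k = b ∨ a + k = b + n → (b : ZMod n) = a + (k : ℕ) := by
      rintro a b k (h | h)
      · rw [← h, Nat.cast_add]
      · rw [← Nat.cast_add, h, Nat.cast_add, ZMod.natCast_self, add_zero]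
    have hnum : (a + 1 = b ∨ a + 1 = b + n) ∨ (a + 2 = b ∨ a + 2 = b + n) ∨
        (b + 1 = a ∨ b + 1 = a + n) ∨ (b + 2 = a ∨ b + 2 = a + n) ∨
        a + 2 = n ∧ (a + 3 = b ∨ a + 3 = b + n) ∨ b + 2 = n ∧ (b + 3 = a ∨ b + 3 = a + n) := by
      rcases Sym2.mem_iff.1 hu with rfl | rfl <;> rcases Sym2.mem_iff.1 hv with rfl | rfl
      · have := key _ _ (by omega) (by omega) huv
        omega
      · have := key _ _ (by omega) (by omega) huv
        omega
      · have := key _ _ (by omega) (by omega) huv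
        omega
      · have := key _ _ (by omega) (by omega) huv
        omega
    have c1 := hc a b 1
    have c2 := hc a b 2
    have c3 := hc a b 3
    have d1 := hc b a 1
    have d2 := hc b a 2
    have d3 := hc b a 3
    push_cast at c1 c2 c3 d1 d2 d3
    exact hnum.imp c1 (Or.imp c2 (Or.imp d1 (Or.imp d2 (Or.imp (And.imp_right c3)
      (And.imp_right d3)))))
  · intro i hi
    obtain ⟨m, hm, rfl⟩ := hnat i
    simp only [hval m hm] at hi
    simp only [hadd1 m hm, hadd2 m hm, hadd3 m hm]
    split_ifs <;> omega
  · rintro i j hi hj hij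
    exact ZMod.val_injective n (hy _ _ (by omega) (by omega) (mt_inj hij))
  · intro i hi
    rw [F.mt_mt]
    exact ⟨i.val, by omega, by omega, rfl⟩
  · intro i hi hi'
    obtain ⟨m, hm, rfl⟩ := hnat i
    simp only [F.mt_mt, hval m hm, hadd1 m hm] at hi hi' ⊢
    rw [if_pos hi.2]
    exact (hN m hm).1
  · exact fun i hi => hmo _ hi.1 hi.2
  · intro i hi
    obtain ⟨m, hm, rfl⟩ := hnat i
    simp only [hval m hm, hsub m (by simp only [hval m hm] at hi; omega) hm] at hi ⊢
    refine hcf _ _ (by omega) hi.1 hi.2 ?_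
    rw [Nat.sub_add_cancel (by omega)]
    exact Sym2.mem_mk_right _ _
  · exact fun i hi => hcf _ _ (ZMod.val_lt i) hi.1 hi.2 (Sym2.mem_mk_left _ _)
  · intro i hi hi' f hf hif
    obtain ⟨m, hm, rfl⟩ := hnat i
    simp only [hval m hm, hadd1 m hm] at hi hi' hif ⊢
    rw [if_pos hi.2] at hi' ⊢
    rcases hoff m (by omega) hi.2 f hf hif with (h | h) | h | h
    · exact Or.inl h
    · omega
    · exact Or.inr h
    · omega
  · intro i hi hi'
    obtain ⟨m, hm, rfl⟩ := hnat i
    simp only [hval m hm, hadd1 m hm] at hi hi' ⊢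
    rw [if_pos hi.2] at hi'
    obtain rfl : m = n - 2 := by omega
    refine ⟨s(y n, F.oth (y (n - 1)) (y n)), fun f hf hif => ?_⟩
    rcases hoff _ (by omega) hi.2 f hf hif with (h | h) | h | h
    · exact Or.inl h
    · omega
    · rw [show n - 2 + 1 = n - 1 by omega, ← hmt, F.mt_mt] at h
      exact absurd ⟨1, le_rfl, by omega, rfl⟩ (hf.2 _ (F.mem_inc.1 h).2)
    · exact Or.inr h.2
  · intro i hi hi'
    obtain ⟨m, hm, rfl⟩ := hnat i
    have h1 : 1 ≤ m := by simp only [hval m hm] at hi; omega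
    simp only [hval m hm, hsub m h1 hm] at hi hi' ⊢
    obtain rfl : m = 2 := by omega
    refine ⟨s(y 0, F.oth (y 1) (y 0)), fun f hf hif => ?_⟩
    rcases hoff 1 le_rfl (by omega) f hf hif with (h | h) | h | h
    · rw [hmt] at h
      exact absurd ⟨n - 1, by omega, by omega, rfl⟩ (hf.2 _ (F.mem_inc.1 h).2)
    · exact Or.inr h.2
    · exact Or.inl h
    · omega

end Frame

namespace Frame

variable {F : Frame G}

theorem Ring.reachable_or_good [Fintype V] {C : Set V} {n : ℕ} {E : ZMod n → Sym2 V}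
    {w : ZMod n → V} {r q : ZMod n → Prop} (h : F.Ring C n E w r q) (hG : G.Connected)
    (hcut : ∀ A : Finset V, A.Nonempty → A ≠ Finset.univ → 3 ≤ (bd G A).card)
    (hr : ∃ i, r i)
    (hrun : ∀ P : V → Prop, (∀ b, r b → r (b + 1) → r (b + 2) →
      (P (w b) ↔ P (w (b + 1))) ∧ (P (w (b + 1)) ↔ P (w (b + 2)))) →
      ∀ i j, r i → r j → P (w i) → P (w j))
    {g₁ g₂ : V × V} (hg : ∀ u v, u ∉ C → v ∈ C → G.Adj u v →
      (∃ i, r i ∧ u = w i) ∨ (u, v) = g₁ ∨ (u, v) = g₂) :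
    F.Good ∨ ∀ u ∉ C, ∀ v ∉ C, (offGraph G C).Reachable u v := by
  by_cases hgood : F.Good
  · exact Or.inl hgood
  right
  obtain ⟨i₀, hi₀⟩ := hr
  set R : Set V := {u | u ∉ C ∧ (offGraph G C).Reachable (w i₀) u} with hRdef
  have hR : ∀ u ∈ R, ∀ v, G.Adj u v → v ∈ R ∨ v ∈ C := by
    intro u hu v huv
    by_cases hv : v ∈ C
    · exact Or.inr hv
    · have huv' : (offGraph G C).Adj u v := ⟨huv, hu.1, hv⟩
      exact Or.inl ⟨hv, hu.2.trans huv'.reachable⟩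
  have hwR : ∀ i, r i → w i ∈ R := by
    intro i hi
    refine hrun (· ∈ R) ?_ i₀ i hi₀ hi ⟨h.w_notMem i₀ hi₀, SimpleGraph.Reachable.refl _⟩
    intro b h1 h2 h3
    by_contra hs
    exact hgood (h.good_of_split hG h1 h2 h3 hR hs)
  have hall : ∀ u, u ∉ C → u ∈ R := by
    intro u hu
    by_contra huR
    obtain ⟨c, hc, -⟩ := h.touch 0
    have h3 := hcut (Finset.univ.filter fun v => v ∉ C ∧ v ∉ R) ⟨u, by simp [hu, huR]⟩
      (fun h' => by
        have := Finset.mem_univ c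
        rw [← h'] at this
        exact (Finset.mem_filter.1 this).2.1 hc)
    have hsub : bd G ((Finset.univ.filter fun v => v ∉ C ∧ v ∉ R : Finset V) : Set V)
        ⊆ {g₁, g₂} := by
      rintro ⟨x, y⟩ hxy
      rw [mem_bd] at hxy
      obtain ⟨hx, hy, hxy⟩ := hxy
      simp only [Finset.coe_filter, Finset.mem_univ, true_and, Set.mem_ofPred_eq] at hx hy
      have hyC : y ∈ C := by
        by_contra hyC
        have hyR : y ∈ R := by
          by_contra hyR
          exact hy ⟨hyC, hyR⟩
        rcases hR y hyR x hxy.symm with hx' | hx'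
        · exact hx.2 hx'
        · exact hx.1 hx'
      rcases hg x y hx.1 hyC hxy with ⟨i, hi, rfl⟩ | h' | h'
      · exact absurd (hwR i hi) hx.2
      · simp [h']
      · simp [h']
    have := (Finset.card_le_card hsub).trans Finset.card_le_two
    omega
  intro u hu v hv
  exact (hall u hu).2.symm.trans (hall v hv).2

/-- A path of `F.N` on `k ≥ 3` vertices whose ends are adjacent in `G`. -/
structure ClosedPath (F : Frame G) (k : ℕ) (p : ℕ → V) : Prop where
  three : 3 ≤ k
  adj : ∀ i, i + 1 < k → F.N.Adj (p i) (p (i + 1))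
  inj : ∀ i j, i < k → j < k → p i = p j → i = j
  last : G.Adj (p (k - 1)) (p 0)

theorem exists_closedPath [Finite V] [Nonempty V] (F : Frame G) : ∃ k p, F.ClosedPath k p := by
  obtain ⟨v⟩ := ‹Nonempty V›
  let s : ℕ → V × V := fun i => Nat.rec (v, F.n1 v) (fun _ x => (x.2, F.oth x.1 x.2)) i
  have hs : ∀ i, s (i + 1) = ((s i).2, F.oth (s i).1 (s i).2) := fun i => rfl
  have hq1 : ∀ i, F.N.Adj (s i).1 (s (i + 1)).1 := by
    intro i
    rw [hs]
    induction i with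
    | zero => exact F.N_adj_n1 v
    | succ i _ => rw [hs]; exact F.N_adj_oth _ _
  have hq2 : ∀ i, (s (i + 2)).1 ≠ (s i).1 := by
    intro i
    rw [hs (i + 1), hs i]
    exact F.oth_ne _ _
  have hex : ∃ k, 0 < k ∧ ∃ i, (s i).1 = (s (i + k)).1 := by
    obtain ⟨a, b, hab, hne⟩ := Finite.exists_ne_map_eq_of_infinite fun i => (s i).1
    rcases lt_or_gt_of_ne hab with hlt | hlt
    · exact ⟨b - a, by omega, a, by rw [show a + (b - a) = b by omega]; exact hne⟩
    · exact ⟨a - b, by omega, b, by rw [show b + (a - b) = a by omega]; exact hne.symm⟩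
  obtain ⟨hk, i, hi⟩ := Nat.find_spec hex
  have hmin : ∀ m, m < Nat.find hex → ¬ (0 < m ∧ ∃ i, (s i).1 = (s (i + m)).1) :=
    fun m hm => Nat.find_min hex hm
  generalize Nat.find hex = k at hk hi hmin
  have h3 : 3 ≤ k := by
    by_contra hlt
    have : k = 1 ∨ k = 2 := by omega
    rcases this with rfl | rfl
    · exact (hq1 i).ne hi
    · exact hq2 i hi.symm
  refine ⟨k, fun j => (s (i + j)).1, h3, fun j _ => hq1 (i + j), ?_, ?_⟩
  · have key : ∀ a b, a < b → b < k → (s (i + a)).1 ≠ (s (i + b)).1 := by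
      intro a b hab hb heq
      refine hmin (b - a) (by omega) ⟨by omega, i + a, ?_⟩
      rw [show i + a + (b - a) = i + b by omega]
      exact heq
    intro a b ha hb hab
    rcases lt_trichotomy a b with h | h | h
    · exact absurd hab (key a b h hb)
    · exact h
    · exact absurd hab.symm (key b a h ha)
  · have := (hq1 (i + (k - 1))).1
    rw [show i + (k - 1) + 1 = i + k by omega, ← hi] at this
    exact this

theorem exists_min_closedPath [Finite V] [Nonempty V] (F : Frame G) :
    ∃ k p, F.ClosedPath k p ∧ ∀ k' p', F.ClosedPath k' p' → k ≤ k' := by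
  have hex := F.exists_closedPath
  obtain ⟨p, hp⟩ := Nat.find_spec hex
  exact ⟨_, p, hp, fun k' p' h' => Nat.find_min' hex ⟨p', h'⟩⟩

namespace ClosedPath

variable {k : ℕ} {p : ℕ → V}

theorem reverse (h : F.ClosedPath k p) : F.ClosedPath k fun i => p (k - 1 - i) where
  three := h.three
  adj i hi := by
    have := (h.adj (k - 1 - (i + 1)) (by omega)).symm
    rwa [show k - 1 - (i + 1) + 1 = k - 1 - i by omega] at this
  inj i j hi hj hij := by
    have := h.inj _ _ (by omega) (by omega) hij
    omega
  last := by
    have := h.last.symm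
    rwa [show (k - 1 - (k - 1)) = 0 by omega, show k - 1 - 0 = k - 1 by omega]

theorem chordless (h : F.ClosedPath k p) (hmin : ∀ k' p', F.ClosedPath k' p' → k ≤ k')
    {i j : ℕ} (hij : i < j) (hj : j < k) (hadj : G.Adj (p i) (p j)) :
    j = i + 1 ∨ i = 0 ∧ j + 1 = k := by
  by_cases hne : j = i + 1
  · exact Or.inl hne
  have := hmin (j - i + 1) (fun t => p (i + t))
    ⟨by omega, fun t ht => h.adj (i + t) (by omega),
      fun a b ha hb hab => by have := h.inj _ _ (by omega) (by omega) hab; omega, by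
        rw [show i + (j - i + 1 - 1) = j by omega]
        exact hadj.symm⟩
  omega

theorem six_le (h : F.ClosedPath k p)
    (h3 : ∀ x y z, G.Adj x y → G.Adj y z → ¬ G.Adj x z)
    (h4 : ∀ x y z w, G.Adj x y → G.Adj y z → G.Adj z w → G.Adj w x → x = z ∨ y = w)
    (h5 : ∀ x y z w u, G.Adj x y → G.Adj y z → G.Adj z w → G.Adj w u → ¬ G.Adj u x) :
    6 ≤ k := by
  by_contra hlt
  have hk : k = 3 ∨ k = 4 ∨ k = 5 := by have := h.three; omega
  rcases hk with rfl | rfl | rfl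
  · exact h3 _ _ _ (h.adj 0 (by omega)).1 (h.adj 1 (by omega)).1 h.last.symm
  · rcases h4 _ _ _ _ (h.adj 0 (by omega)).1 (h.adj 1 (by omega)).1 (h.adj 2 (by omega)).1 h.last
      with h' | h'
    · exact absurd (h.inj _ _ (by omega) (by omega) h') (by omega)
    · exact absurd (h.inj _ _ (by omega) (by omega) h') (by omega)
  · exact h5 _ _ _ _ _ (h.adj 0 (by omega)).1 (h.adj 1 (by omega)).1 (h.adj 2 (by omega)).1
      (h.adj 3 (by omega)).1 h.last

/-- The outer neighbour of an end is not on the path, and has no other neighbour on it. -/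
theorem end_nbr (h : F.ClosedPath k p) (hmin : ∀ k' p', F.ClosedPath k' p' → k ≤ k')
    (h3 : ∀ x y z, G.Adj x y → G.Adj y z → ¬ G.Adj x z)
    (h4 : ∀ x y z w, G.Adj x y → G.Adj y z → G.Adj z w → G.Adj w x → x = z ∨ y = w)
    (hmt : F.mt (p 0) = p (k - 1)) {x : V} (hx : x ≠ p 1) (hN : F.N.Adj (p 0) x) :
    (∀ j, j < k → x ≠ p j) ∧ ∀ j, j < k → G.Adj x (p j) → j = 0 := by
  have hk := h.three
  have hout : ∀ j, j < k → x ≠ p j := by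
    rintro j hj rfl
    have hj0 : 0 < j := Nat.pos_of_ne_zero fun h0 => hN.ne (by rw [h0])
    rcases h.chordless hmin hj0 hj hN.1 with rfl | ⟨-, h'⟩
    · exact hx rfl
    · exact hN.2 (by rw [hmt, show j = k - 1 by omega])
  refine ⟨hout, fun j hj hxj => ?_⟩
  by_contra hj0
  rcases (by omega : j + 2 < k ∨ j + 2 = k ∨ j + 1 = k) with hj' | hj' | hj'
  · have := hmin (j + 2) (fun t => if t = 0 then x else p (t - 1))
      ⟨by omega, ?_, ?_, ?_⟩
    · omega
    · intro t ht
      by_cases h0 : t = 0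
      · subst h0
        simpa using hN.symm
      · have := h.adj (t - 1) (by omega)
        rw [show t - 1 + 1 = t by omega] at this
        simpa [h0] using this
    · intro a b ha hb hab
      by_cases ha0 : a = 0 <;> by_cases hb0 : b = 0
      · omega
      · simp only [ha0, hb0, if_true, if_false] at hab
        exact absurd hab (hout _ (by omega))
      · simp only [ha0, hb0, if_true, if_false] at hab
        exact absurd hab.symm (hout _ (by omega))
      · simp only [ha0, hb0, if_false] at hab
        have := h.inj _ _ (by omega) (by omega) hab
        omega
    · simpa using hxj.symm
  · have h1 := (h.adj j (by omega)).1
    rw [show j + 1 = k - 1 by omega] at h1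
    rcases h4 x (p j) (p (k - 1)) (p 0) hxj h1 h.last hN.1 with h' | h'
    · exact hout _ (by omega) h'
    · exact hj0 (h.inj _ _ (by omega) (by omega) h')
  · have hl := h.last
    rw [show k - 1 = j by omega] at hl
    exact h3 x (p j) (p 0) hxj hl hN.1.symm

end ClosedPath

end Frame

namespace Frame

variable {F : Frame G}

theorem good_of_cycle [Fintype V] (hG : G.Connected) (hm : ∀ v, F.mt v ≠ v)
    (h3 : ∀ x y z, G.Adj x y → G.Adj y z → ¬ G.Adj x z)
    (h4 : ∀ x y z w, G.Adj x y → G.Adj y z → G.Adj z w → G.Adj w x → x = z ∨ y = w)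
    (h5 : ∀ x y z w u, G.Adj x y → G.Adj y z → G.Adj z w → G.Adj w u → ¬ G.Adj u x)
    (hcut : ∀ A : Finset V, A.Nonempty → A ≠ Finset.univ → 3 ≤ (bd G A).card)
    {n : ℕ} (hn : 6 ≤ n) {p : ZMod n → V} (hp : Function.Injective p)
    (hN : ∀ i, F.N.Adj (p i) (p (i + 1)))
    (hch : ∀ i j, G.Adj (p i) (p j) → j = i + 1 ∨ i = j + 1) : F.Good := by
  have : NeZero n := ⟨by omega⟩
  have hR := Ring.of_cycle hn hp hN hch hm
  rcases hn.eq_or_lt with h6 | h7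
  · exact hR.good_of_six h6.symm (fun _ h => h) hG
  have hcast : ∀ m : ℕ, 0 < m → m < 7 → ((m : ℕ) : ZMod n) ≠ 0 := by
    intro m h0 hm h
    rw [ZMod.natCast_eq_zero_iff] at h
    exact absurd (Nat.le_of_dvd h0 h) (by omega)
  have hpw : ∀ i, F.mt (p i) ∉ Set.range p := fun i => hR.w_notMem i trivial
  have hnb : ∀ i u, F.N.Adj (p i) u → u ∈ Set.range p := by
    intro i u hu
    have hN' := (hN (i - 1)).symm
    rw [sub_add_cancel] at hN'
    rcases F.eq_or_eq_oth (hN i) hu with rfl | h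
    · exact ⟨_, rfl⟩
    · refine ⟨i - 1, ?_⟩
      rw [h]
      refine F.eq_oth (hN i) hN' fun h' => hcast 2 (by norm_num) (by norm_num) ?_
      have := hp h'
      push_cast
      linear_combination -this
  refine Or.elim (hR.reachable_or_good (g₁ := (p 0, p 0)) (g₂ := (p 0, p 0)) hG hcut
    ⟨0, trivial⟩ ?_ ?_) id fun hreach => ?_
  rotate_left 2
  · have hw : ∀ i : ZMod n, i ≠ 0 → F.mt (p i) ≠ F.mt (p 0) := fun i hi h => hi (hp (mt_inj h))
    refine hR.good_of_sink (z := F.mt (p 0)) (c := p 0) ⟨0, rfl⟩ (F.adj_mt _ (hm _)).symm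
      (fun v hv => hreach v hv _ (hpw 0)) h3 h4 h5
      ⟨1, trivial, hw 1 (by simpa using hcast 1 (by norm_num) (by norm_num))⟩ ?_
    intro i _ hi
    have hi0 : i ≠ 0 := by
      rintro rfl
      exact hi rfl
    by_cases hf : i + 1 ≠ 0 ∧ i + 2 ≠ 0 ∧ i + 3 ≠ 0
    · exact Or.inl ⟨⟨trivial, hw _ hf.1⟩, ⟨trivial, hw _ hf.2.1⟩, fun _ => hw _ hf.2.2⟩
    · have hback : ∃ a : ℕ, 1 ≤ a ∧ a ≤ 3 ∧ i + a = 0 := by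
        by_contra hno
        push Not at hno
        exact hf ⟨by simpa using hno 1 (by norm_num) (by norm_num),
          by simpa using hno 2 (by norm_num) (by norm_num),
          by simpa using hno 3 (by norm_num) (by norm_num)⟩
      obtain ⟨a, ha1, ha3, hia⟩ := hback
      have hb : ∀ b : ℕ, b ≤ 3 → i - b ≠ 0 := by
        intro b hb h0
        refine hcast (a + b) (by omega) (by omega) ?_
        push_cast
        linear_combination hia - h0
      have b1 := hb 1 (by norm_num)
      have b2 := hb 2 (by norm_num)
      have b3 := hb 3 (by norm_num)
      push_cast at b1 b2 b3
      exact Or.inr ⟨⟨trivial, hw _ b1⟩, ⟨trivial, hw _ b2⟩, fun _ => hw _ b3⟩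
  · intro P hP i j _ _ hi
    have key : ∀ m : ℕ, P (F.mt (p (i + m))) := by
      intro m
      induction m with
      | zero => simpa using hi
      | succ m ih =>
        have := ((hP (i + m) trivial trivial trivial).1).1 ih
        rw [show i + (m : ZMod n) + 1 = i + ((m + 1 : ℕ) : ZMod n) by push_cast; ring] at this
        exact this
    have := key (j - i).val
    rwa [ZMod.natCast_zmod_val, add_sub_cancel] at this
  · rintro u _ hu ⟨i, rfl⟩ hadj
    rcases F.adj_cases hadj.symm with rfl | h
    · exact Or.inl ⟨i, trivial, rfl⟩
    · exact absurd (hnb i u h) hu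

theorem good_of_path [Fintype V] (hG : G.Connected) (hm : ∀ v, F.mt v ≠ v)
    (h3 : ∀ x y z, G.Adj x y → G.Adj y z → ¬ G.Adj x z)
    (h4 : ∀ x y z w, G.Adj x y → G.Adj y z → G.Adj z w → G.Adj w x → x = z ∨ y = w)
    (h5 : ∀ x y z w u, G.Adj x y → G.Adj y z → G.Adj z w → G.Adj w u → ¬ G.Adj u x)
    (hcut : ∀ A : Finset V, A.Nonempty → A ≠ Finset.univ → 3 ≤ (bd G A).card)
    {n : ℕ} (hn : 7 ≤ n) {y : ℕ → V}
    (hy : ∀ i j, i ≤ n → j ≤ n → y i = y j → i = j) (hN : ∀ i < n, F.N.Adj (y i) (y (i + 1)))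
    (hch : ∀ i j, i < j → j ≤ n → G.Adj (y i) (y j) → j = i + 1 ∨ i = 1 ∧ j + 1 = n)
    (hmt : F.mt (y 1) = y (n - 1)) : F.Good := by
  have : NeZero n := ⟨by omega⟩
  have hR := Ring.of_path hn hy hN hch hmt hm
  have hval : ∀ m < n, ((m : ℕ) : ZMod n).val = m := fun m h => by
    rw [ZMod.val_natCast, Nat.mod_eq_of_lt h]
  have hrun : ∀ m : ℕ, 2 ≤ m → m + 1 < n →
      2 ≤ ((m : ℕ) : ZMod n).val ∧ ((m : ℕ) : ZMod n).val + 1 < n := fun m h2 hm => by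
    rw [hval m (by omega)]
    exact ⟨h2, hm⟩
  have hC0 : y 0 ∉ {v | ∃ i, 1 ≤ i ∧ i < n ∧ y i = v} := by
    rintro ⟨i, hi, hin, hyi⟩
    exact absurd (hy _ _ hin.le (Nat.zero_le _) hyi) (by omega)
  have hz : ∀ i : ZMod n, (2 ≤ i.val ∧ i.val + 1 < n) → F.mt (y i.val) ≠ y 0 := by
    intro i hi h
    have hadj := F.adj_mt (y i.val) (hm _)
    rw [h] at hadj
    rcases hch 0 i.val (by omega) (by omega) hadj.symm with h' | h' <;> omega
  refine Or.elim (hR.reachable_or_good (g₁ := (y 0, y 1)) (g₂ := (y n, y (n - 1))) hG hcut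
    ⟨((2 : ℕ) : ZMod n), hrun 2 le_rfl (by omega)⟩ ?_ ?_) id fun hreach => ?_
  rotate_left 2
  · refine hR.good_of_sink (z := y 0) (c := y 1) ⟨1, le_rfl, by omega, rfl⟩ (hN 0 (by omega)).1
      (fun v hv => hreach v hv _ hC0) h3 h4 h5
      ⟨((2 : ℕ) : ZMod n), hrun 2 le_rfl (by omega), hz _ (hrun 2 le_rfl (by omega))⟩ ?_
    intro i hi _
    have hii : ((i.val : ℕ) : ZMod n) = i := ZMod.natCast_zmod_val i
    by_cases hf : i.val + 3 < n
    · have e1 := hrun (i.val + 1) (by omega) (by omega)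
      have e2 := hrun (i.val + 2) (by omega) (by omega)
      push_cast at e1 e2
      rw [hii] at e1 e2
      exact Or.inl ⟨⟨e1, hz _ e1⟩, ⟨e2, hz _ e2⟩, fun h => hz _ h⟩
    · have e1 := hrun (i.val - 1) (by omega) (by omega)
      have e2 := hrun (i.val - 2) (by omega) (by omega)
      rw [Nat.cast_sub (by omega), hii] at e1 e2
      push_cast at e1 e2
      exact Or.inr ⟨⟨e1, hz _ e1⟩, ⟨e2, hz _ e2⟩, fun h => hz _ h⟩
  · intro P hP
    have hP' : ∀ m : ℕ, 2 ≤ m → m + 3 < n → (P (F.mt (y m)) ↔ P (F.mt (y (m + 1)))) ∧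
        (P (F.mt (y (m + 1))) ↔ P (F.mt (y (m + 2)))) := by
      intro m h2 hmn
      have := hP (m : ℕ) (hrun m h2 (by omega))
        (by have := hrun (m + 1) (by omega) (by omega); push_cast at this; exact this)
        (by have := hrun (m + 2) (by omega) (by omega); push_cast at this; exact this)
      rw [show ((m : ℕ) : ZMod n) + 1 = ((m + 1 : ℕ) : ZMod n) by push_cast; ring,
        show ((m : ℕ) : ZMod n) + 2 = ((m + 2 : ℕ) : ZMod n) by push_cast; ring,
        hval m (by omega), hval (m + 1) (by omega), hval (m + 2) (by omega)] at this
      exact this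
    have hstep : ∀ m : ℕ, 2 ≤ m → m + 2 < n → (P (F.mt (y m)) ↔ P (F.mt (y (m + 1)))) := by
      intro m h2 hmn
      by_cases hmn' : m + 3 < n
      · exact (hP' m h2 hmn').1
      · have := (hP' (m - 1) (by omega) (by omega)).2
        rwa [show m - 1 + 1 = m by omega, show m - 1 + 2 = m + 1 by omega] at this
    have hbase : ∀ m : ℕ, 2 ≤ m → m + 1 < n → (P (F.mt (y 2)) ↔ P (F.mt (y m))) := by
      intro m h2
      induction m, h2 using Nat.le_induction with
      | base => exact fun _ => Iff.rfl
      | succ m h2 ih => exact fun hmn => (ih (by omega)).trans (hstep m h2 (by omega))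
    intro i j hi hj h
    exact (hbase _ hj.1 hj.2).1 ((hbase _ hi.1 hi.2).2 h)
  · rintro u _ hu ⟨i, hi, hin, rfl⟩ hadj
    have hmem : ∀ j, 1 ≤ j → j < n → u ≠ y j := fun j h1 h2 h => hu ⟨j, h1, h2, h.symm⟩
    rcases F.adj_cases hadj.symm with h | h
    · left
      rcases (by omega : i = 1 ∨ i = n - 1 ∨ 2 ≤ i ∧ i + 1 < n) with rfl | rfl | hi'
      · exact absurd (h.trans hmt) (hmem _ (by omega) (by omega))
      · rw [← hmt, F.mt_mt] at h
        exact absurd h (hmem 1 (by omega) (by omega))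
      · exact ⟨(i : ℕ), hrun i hi'.1 hi'.2, by rw [hval i hin]; exact h⟩
    · right
      have hp : F.N.Adj (y i) (y (i - 1)) := by
        have := (hN (i - 1) (by omega)).symm
        rwa [show i - 1 + 1 = i by omega] at this
      have hne : y (i - 1) ≠ y (i + 1) := fun h' => by
        have := hy _ _ (by omega) (by omega) h'
        omega
      have hu' : u = y (i - 1) ∨ u = y (i + 1) := by
        rcases F.eq_or_eq_oth (hN i hin) h with h' | h'
        · exact Or.inr h'
        · exact Or.inl (h'.trans (F.eq_oth (hN i hin) hp hne).symm)
      rcases hu' with h' | h'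
      · have hi1 : i = 1 := by
          by_contra hi1
          exact hmem _ (by omega) (by omega) h'
        subst hi1
        exact Or.inl (by rw [h'])
      · have hi1 : i + 1 = n := by
          by_contra hi1
          exact hmem _ (by omega) (by omega) h'
        right
        rw [h', hi1, show i = n - 1 by omega]

theorem good_of_girth [Fintype V] (hG : G.Connected) (hm : ∀ v, F.mt v ≠ v)
    (h3 : ∀ x y z, G.Adj x y → G.Adj y z → ¬ G.Adj x z)
    (h4 : ∀ x y z w, G.Adj x y → G.Adj y z → G.Adj z w → G.Adj w x → x = z ∨ y = w)
    (h5 : ∀ x y z w u, G.Adj x y → G.Adj y z → G.Adj z w → G.Adj w u → ¬ G.Adj u x)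
    (hcut : ∀ A : Finset V, A.Nonempty → A ≠ Finset.univ → 3 ≤ (bd G A).card) : F.Good := by
  have := hG.nonempty
  obtain ⟨k, p, h, hmin⟩ := F.exists_min_closedPath
  have hk := h.six_le h3 h4 h5
  by_cases hl : p 0 = F.mt (p (k - 1))
  · have hmt : F.mt (p 0) = p (k - 1) := by rw [hl, F.mt_mt]
    set x := F.oth (p 1) (p 0) with hx
    set x' := F.oth (p (k - 2)) (p (k - 1)) with hx'
    have hxN : F.N.Adj (p 0) x := F.N_adj_oth _ _
    have hxN' : F.N.Adj (p (k - 1)) x' := F.N_adj_oth _ _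
    obtain ⟨a1, a2⟩ := h.end_nbr hmin h3 h4 hmt (F.oth_ne _ _) hxN
    obtain ⟨b1, b2⟩ := h.reverse.end_nbr hmin h3 h4 (x := x')
      (by
        rw [Nat.sub_zero, Nat.sub_self]
        exact hl.symm)
      (by
        rw [show k - 1 - 1 = k - 2 by omega]
        exact F.oth_ne _ _) hxN'
    have b1' : ∀ j < k, x' ≠ p j := fun j hj => by
      have := b1 (k - 1 - j) (by omega)
      rwa [show k - 1 - (k - 1 - j) = j by omega] at this
    have b2' : ∀ j < k, G.Adj x' (p j) → j + 1 = k := fun j hj hadj => by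
      have := b2 (k - 1 - j) (by omega)
        (by rwa [show k - 1 - (k - 1 - j) = j by omega])
      omega
    have hxx : x ≠ x' := fun he => h3 _ _ _ hxN.1 (he ▸ hxN'.1.symm) h.last.symm
    have hxx' : ¬ G.Adj x x' := fun he => by
      rcases h4 _ _ _ _ he hxN'.1.symm h.last hxN.1 with h' | h'
      · exact a1 _ (by omega) h'
      · exact b1' _ (by omega) h'
    let y : ℕ → V := fun i => if i = 0 then x else if i ≤ k then p (i - 1) else x'
    have y0 : y 0 = x := rfl
    have yi : ∀ i, 1 ≤ i → i ≤ k → y i = p (i - 1) := fun i h1 h2 => by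
      simp only [y, if_neg (show i ≠ 0 by omega), if_pos h2]
    have yk : y (k + 1) = x' := by simp [y]
    have hcases : ∀ i, i ≤ k + 1 → i = 0 ∨ 1 ≤ i ∧ i ≤ k ∨ i = k + 1 := fun i hi => by omega
    refine good_of_path hG hm h3 h4 h5 hcut (n := k + 1) (y := y) (by omega) ?_ ?_ ?_ ?_
    · intro i j hi hj hij
      rcases hcases i hi with rfl | hi' | rfl <;> rcases hcases j hj with rfl | hj' | rfl
      · rfl
      · rw [y0, yi j hj'.1 hj'.2] at hij
        exact absurd hij (a1 _ (by omega))
      · rw [y0, yk] at hij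
        exact absurd hij hxx
      · rw [y0, yi i hi'.1 hi'.2] at hij
        exact absurd hij.symm (a1 _ (by omega))
      · rw [yi i hi'.1 hi'.2, yi j hj'.1 hj'.2] at hij
        have := h.inj _ _ (by omega) (by omega) hij
        omega
      · rw [yk, yi i hi'.1 hi'.2] at hij
        exact absurd hij.symm (b1' _ (by omega))
      · rw [y0, yk] at hij
        exact absurd hij.symm hxx
      · rw [yk, yi j hj'.1 hj'.2] at hij
        exact absurd hij (b1' _ (by omega))
      · rfl
    · intro i hi
      rcases (by omega : i = 0 ∨ 1 ≤ i ∧ i < k ∨ i = k) with rfl | hi' | rfl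
      · rw [y0, yi 1 le_rfl (by omega)]
        exact hxN.symm
      · rw [yi i hi'.1 hi'.2.le, yi (i + 1) (by omega) (by omega)]
        have := h.adj (i - 1) (by omega)
        rwa [show i - 1 + 1 = i + 1 - 1 by omega] at this
      · rw [yi i (by omega) le_rfl, yk]
        exact hxN'
    · intro i j hij hj hadj
      rcases hcases i (by omega) with rfl | hi' | rfl
      · left
        rcases hcases j hj with rfl | hj' | rfl
        · omega
        · rw [y0, yi j hj'.1 hj'.2] at hadj
          have := a2 _ (by omega) hadj
          omega
        · rw [y0, yk] at hadj
          exact absurd hadj hxx'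
      · rcases (by omega : 1 ≤ j ∧ j ≤ k ∨ j = k + 1) with hj' | rfl
        · rw [yi i hi'.1 hi'.2, yi j hj'.1 hj'.2] at hadj
          have := h.chordless hmin (by omega) (by omega) hadj
          omega
        · rw [yi i hi'.1 hi'.2, yk] at hadj
          have := b2' _ (by omega) hadj.symm
          omega
      · omega
    · rw [yi 1 le_rfl (by omega), yi (k + 1 - 1) (by omega) (by omega)]
      exact hmt
  · have hlast : F.N.Adj (p (k - 1)) (p 0) := ⟨h.last, hl⟩
    have : NeZero k := ⟨by omega⟩
    have hsucc : ∀ i : ZMod k, i.val + 1 < k ∧ (i + 1).val = i.val + 1 ∨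
        i.val + 1 = k ∧ (i + 1).val = 0 := by
      intro i
      have hi := ZMod.val_lt i
      have hv : (i + 1).val = (i.val + 1) % k := by
        rw [← ZMod.val_natCast, Nat.cast_add, ZMod.natCast_zmod_val, Nat.cast_one]
      rcases (by omega : i.val + 1 < k ∨ i.val + 1 = k) with h' | h'
      · exact Or.inl ⟨h', by rw [hv, Nat.mod_eq_of_lt h']⟩
      · exact Or.inr ⟨h', by rw [hv, h', Nat.mod_self]⟩
    have hlt : ∀ i j : ZMod k, i.val < j.val → G.Adj (p i.val) (p j.val) →
        j = i + 1 ∨ i = j + 1 := by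
      intro i j hij hadj
      have hj := ZMod.val_lt j
      rcases h.chordless hmin hij hj hadj with h' | h'
      · left
        apply ZMod.val_injective
        rcases hsucc i with hs | hs <;> omega
      · right
        apply ZMod.val_injective
        rcases hsucc j with hs | hs <;> omega
    refine good_of_cycle hG hm h3 h4 h5 hcut hk (p := fun i => p i.val) ?_ ?_ ?_
    · intro i j hij
      exact ZMod.val_injective k (h.inj _ _ (ZMod.val_lt i) (ZMod.val_lt j) hij)
    · intro i
      rcases hsucc i with ⟨hs, he⟩ | ⟨hs, he⟩
      · rw [he]
        exact h.adj _ hs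
      · rw [he, show i.val = k - 1 by omega]
        exact hlast
    · intro i j hadj
      rcases lt_trichotomy i.val j.val with hv | hv | hv
      · exact hlt i j hv hadj
      · exact absurd (congrArg p hv) hadj.ne
      · exact (hlt j i hv hadj.symm).symm

end Frame

theorem exists_third {v : V} (hv : (G.neighborSet v).ncard = 3) (x y : V) :
    ∃ z, G.Adj v z ∧ z ≠ x ∧ z ≠ y := by
  have hfin : (G.neighborSet v).Finite := Set.finite_of_ncard_ne_zero (by omega)
  by_contra! h
  have hsub : G.neighborSet v ⊆ {x, y} := fun z hz => by
    by_cases hzx : z = x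
    · exact Or.inl hzx
    · exact Or.inr (h z hz hzx)
  have := (Set.ncard_le_ncard hsub).trans (Set.ncard_insert_le x {y})
  rw [Set.ncard_singleton] at this
  omega

theorem eq_of_adj_three {v x y z u : V} (hv : (G.neighborSet v).ncard = 3) (hx : G.Adj v x)
    (hy : G.Adj v y) (hz : G.Adj v z) (hxy : x ≠ y) (hxz : x ≠ z) (hyz : y ≠ z)
    (hu : G.Adj v u) : u = x ∨ u = y ∨ u = z := by
  have hfin : (G.neighborSet v).Finite := Set.finite_of_ncard_ne_zero (by omega)
  have hsub : ({x, y, z} : Set V) ⊆ G.neighborSet v := by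
    rintro t (rfl | rfl | rfl) <;> assumption
  have heq := Set.eq_of_subset_of_ncard_le hsub
    (by rw [hv, Set.ncard_eq_three.2 ⟨x, y, z, hxy, hxz, hyz, rfl⟩]) hfin
  have : u ∈ ({x, y, z} : Set V) := heq ▸ hu
  simpa using this

theorem card_even_of_involution {A : Finset V} (σ : V → V) (h1 : ∀ v ∈ A, σ v ∈ A)
    (h2 : ∀ v ∈ A, σ (σ v) = v) (h3 : ∀ v ∈ A, σ v ≠ v) : Even A.card := by
  have h := Finset.sum_involution (s := A) (f := fun _ => (1 : ZMod 2)) (fun v _ => σ v)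
    (fun _ _ => by decide) (fun v hv _ => h3 v hv) (fun v hv => h1 v hv) (fun v hv => h2 v hv)
  rw [Finset.sum_const, nsmul_eq_mul, mul_one, ZMod.natCast_eq_zero_iff] at h
  exact even_iff_two_dvd.2 h

section Cubic

variable [Fintype V]

theorem card_bd_le (hcub : ∀ v, (G.neighborSet v).ncard = 3)
    {Y T : Finset V} {k : ℕ}
    (h0 : ∀ v ∈ Y, v ∉ T → ∀ u, G.Adj v u → u ∈ Y)
    (h1 : ∀ v ∈ T, ∃ S ⊆ Y, (∀ u ∈ S, G.Adj v u) ∧ 3 ≤ S.card + k) :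
    (bd G Y).card ≤ T.card * k := by
  rw [mul_comm]
  refine Finset.card_le_mul_card_image_of_maps_to (f := Prod.fst) ?_ k ?_
  · intro p hp
    rw [mem_bd] at hp
    by_contra hpT
    exact hp.2.1 (h0 _ hp.1 hpT _ hp.2.2)
  · intro v hv
    obtain ⟨S, hSY, hS, hk⟩ := h1 v hv
    have hle : ((bd G Y).filter fun p => p.1 = v).card ≤
        ((G.neighborSet v).toFinset \ S).card := by
      refine Finset.card_le_card_of_injOn Prod.snd ?_ ?_
      · intro p hp
        simp only [Finset.coe_filter, Set.mem_ofPred_eq, mem_bd] at hp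
        obtain ⟨⟨-, hp2, hp⟩, rfl⟩ := hp
        simp only [Finset.coe_sdiff, Set.coe_toFinset, Set.mem_sdiff, SimpleGraph.mem_neighborSet]
        exact ⟨hp, fun h => hp2 (hSY h)⟩
      · intro p hp p' hp' h
        simp only [Finset.coe_filter, Set.mem_ofPred_eq] at hp hp'
        exact Prod.ext (hp.2.trans hp'.2.symm) h
    have hsub : S ⊆ (G.neighborSet v).toFinset := fun u hu => by simpa using hS u hu
    rw [Finset.card_sdiff_of_subset hsub, ← Set.ncard_eq_toFinset_card', hcub] at hle
    omega

theorem exists_frame_extend (hcub : ∀ v, (G.neighborSet v).ncard = 3)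
    (hcut : ∀ A : Finset V, A.Nonempty → A ≠ Finset.univ → 2 ≤ (bd G A).card)
    {Y : Finset V} {σ : V → V} (hσ : ∀ v ∈ Y, σ v ∈ Y ∧ σ (σ v) = v ∧ G.Adj v (σ v))
    (hbd : (bd G Y).card ≤ 4) :
    ∃ F : Frame G, (∀ v ∈ Y, F.mt v = σ v) ∧ ∀ v, F.mt v ≠ v := by
  have heV : Even (Finset.univ : Finset V).card := by
    rw [← Nat.not_odd_iff_even, ← odd_card_bd G fun v _ => hcub v]
    have : bd G ((Finset.univ : Finset V) : Set V) = ∅ := by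
      ext p
      simp [mem_bd]
    rw [this]
    simp
  have heY := card_even_of_involution (A := Y) σ (fun v hv => (hσ v hv).1)
    (fun v hv => (hσ v hv).2.1) (fun v hv => (hσ v hv).2.2.ne')
  have heC : Even Yᶜ.card := by
    rw [Finset.card_compl, ← Finset.card_univ]
    exact heV.tsub heY
  obtain ⟨m, m1, m2, m3⟩ := exists_matching_compl G (Y := Y) (fun v _ => hcub v) heC hcut hbd
  have hmY : ∀ v ∉ Y, m v ∉ Y := fun v hv h => by
    have := m2 _ h
    rw [m1] at this
    rw [← this] at h
    exact hv h
  let t : V → V := fun v => if v ∈ Y then σ v else m v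
  have htY : ∀ v ∈ Y, t v = σ v := fun v hv => if_pos hv
  have htn : ∀ v ∉ Y, t v = m v := fun v hv => if_neg hv
  have hadj : ∀ v, G.Adj v (t v) := by
    intro v
    by_cases hv : v ∈ Y
    · rw [htY v hv]; exact (hσ v hv).2.2
    · rw [htn v hv]; exact m3 v hv
  obtain ⟨F, hF⟩ := exists_frame (G := G) (m := t)
    (fun v => by
      by_cases hv : v ∈ Y
      · rw [htY v hv, htY _ (hσ v hv).1, (hσ v hv).2.1]
      · rw [htn v hv, htn _ (hmY v hv), m1])
    (fun v _ => hadj v)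
    (fun v => by
      rw [Set.ncard_sdiff_singleton_of_mem ((SimpleGraph.mem_neighborSet _ _ _).2 (hadj v)), hcub])
  exact ⟨F, fun v hv => by rw [hF, htY v hv], fun v => by rw [hF]; exact (hadj v).ne'⟩

theorem exists_frame_through (hcub : ∀ v, (G.neighborSet v).ncard = 3)
    (hcut : ∀ A : Finset V, A.Nonempty → A ≠ Finset.univ → 2 ≤ (bd G A).card)
    {a b : V} (hab : G.Adj a b) : ∃ F : Frame G, F.mt a = b ∧ ∀ v, F.mt v ≠ v := by
  have hne := hab.ne
  obtain ⟨F, h1, h2⟩ := exists_frame_extend hcub hcut (Y := {a, b})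
    (σ := fun v => if v = a then b else a)
    (by
      intro v hv
      simp only [Finset.mem_insert, Finset.mem_singleton] at hv
      rcases hv with rfl | rfl
      · simp [hne.symm, hab]
      · simp [hne.symm, hab.symm])
    ((card_bd_le hcub (T := {a, b}) (k := 2) (fun v hv h => absurd hv h) (by
      intro v hv
      simp only [Finset.mem_insert, Finset.mem_singleton] at hv
      rcases hv with rfl | rfl
      · exact ⟨{b}, by simp, by simpa using hab, by simp⟩
      · exact ⟨{a}, by simp, by simpa using hab.symm, by simp⟩)).trans
      (by have := Finset.card_le_two (a := a) (b := b); omega))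
  exact ⟨F, by simpa using h1 a (by simp), h2⟩

theorem exists_good_of_two_cut (hcub : ∀ v, (G.neighborSet v).ncard = 3)
    (hG : G.Connected)
    (hcut : ∀ A : Finset V, A.Nonempty → A ≠ Finset.univ → 2 ≤ (bd G A).card)
    {A : Finset V} (hA : (bd G A).card = 2) : ∃ F : Frame G, F.Good := by
  obtain ⟨⟨a, c⟩, ⟨b, d⟩, -, hbd⟩ := Finset.card_eq_two.1 hA
  have hmem : ∀ u w, u ∈ A → w ∉ A → G.Adj u w → (u = a ∧ w = c) ∨ (u = b ∧ w = d) := by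
    intro u w hu hw huw
    have : (u, w) ∈ bd G (A : Set V) := (mem_bd G).2 ⟨hu, hw, huw⟩
    rw [hbd] at this
    simpa using this
  have hac : (a, c) ∈ bd G (A : Set V) := by simp [hbd]
  rw [mem_bd] at hac
  obtain ⟨ha, hc, hac⟩ := hac
  obtain ⟨F, hF, hm⟩ := exists_frame_through hcub hcut hac
  refine ⟨F, F.good_of_two_cut hG hF ha hc ?_ hmem⟩
  by_contra hbd'
  have hev : Even A.card := by
    rw [← Nat.not_odd_iff_even, ← odd_card_bd G fun v _ => hcub v, hA]
    decide
  have hev' : Even (A.erase a).card := by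
    refine card_even_of_involution F.mt ?_ (fun v _ => F.mt_mt v) fun v _ => hm v
    intro v hv
    rw [Finset.mem_erase] at hv ⊢
    refine ⟨fun h => ?_, ?_⟩
    · rw [F.mt_eq_comm, hF] at h
      exact hc (h ▸ hv.2)
    · by_contra hvA
      rcases hmem v _ hv.2 hvA (F.adj_mt v (hm v)) with h | h
      · exact hv.1 h.1
      · exact hbd' (h.1 ▸ h.2)
  rw [Finset.card_erase_of_mem ha] at hev'
  have : 0 < A.card := Finset.card_pos.2 ⟨a, ha⟩
  rcases hev with ⟨x, hx⟩
  rcases hev' with ⟨y, hy⟩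
  omega

theorem exists_good_of_fourCycle (hcub : ∀ v, (G.neighborSet v).ncard = 3)
    (hG : G.Connected)
    (hcut : ∀ A : Finset V, A.Nonempty → A ≠ Finset.univ → 2 ≤ (bd G A).card)
    (h3 : ∀ x y z, G.Adj x y → G.Adj y z → ¬ G.Adj x z)
    {a b c d : V} (hab : G.Adj a b) (hbc : G.Adj b c) (hcd : G.Adj c d) (hda : G.Adj d a)
    (hac : a ≠ c) (hbd : b ≠ d) : ∃ F : Frame G, F.Good := by
  obtain ⟨wa, awa, wab, wad⟩ := exists_third (hcub a) b d
  obtain ⟨wb, bwb, wba, wbc⟩ := exists_third (hcub b) a c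
  obtain ⟨wc, cwc, wcd, wcb⟩ := exists_third (hcub c) d b
  obtain ⟨wd, dwd, wdc, wda⟩ := exists_third (hcub d) c a
  have wac : wa ≠ c := by
    rintro rfl
    exact h3 _ _ _ hab hbc awa
  have wca : wc ≠ a := by
    rintro rfl
    exact h3 _ _ _ hab hbc cwc.symm
  have key : ∀ F : Frame G, F.mt a = b → F.mt c = d →
      (wa = wc ∨ ¬ G.Adj wa wc ∨ F.mt wa = wc) → ∃ F' : Frame G, F'.Good := by
    intro F ha hc hw
    have hb := F.mt_eq_comm.1 ha
    have hd := F.mt_eq_comm.1 hc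
    obtain ⟨pa, hpa, hpa'⟩ := F.exists_N_ne wa a
    obtain ⟨pb, hpb, hpb'⟩ := F.exists_N_ne wb b
    obtain ⟨pc, hpc, hpc'⟩ := F.exists_N_ne wc c
    obtain ⟨pd, hpd, hpd'⟩ := F.exists_N_ne wd d
    have h : FourCycle F a b c d wa wb wc wd pa pb pc pd :=
      { cliqueFree := h3, ab := hab, cd := hcd, mt_a := ha, mt_c := hc
        bc := ⟨hbc, by rw [hb]; exact hac.symm⟩
        da := ⟨hda, by rw [hd]; exact hac⟩
        awa := ⟨awa, by rw [ha]; exact wab⟩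
        wa_ne := wad
        bwb := ⟨bwb, by rw [hb]; exact wba⟩
        wb_ne := wbc
        cwc := ⟨cwc, by rw [hc]; exact wcd⟩
        wc_ne := wcb
        dwd := ⟨dwd, by rw [hd]; exact wdc⟩
        wd_ne := wda
        wpa := hpa, pa_ne := hpa', wpb := hpb, pb_ne := hpb', wpc := hpc, pc_ne := hpc'
        wpd := hpd, pd_ne := hpd' }
    refine h.exists_good hG ?_
    rcases hw with hw | hw | hw
    · exact Or.inl hw
    · exact Or.inr (Or.inr (Or.inl hw))
    · exact Or.inr (Or.inr (Or.inr (Or.inr hw)))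
  by_cases hw : wa ≠ wc ∧ G.Adj wa wc
  · obtain ⟨hww, hadj⟩ := hw
    obtain ⟨F, hF, -⟩ := exists_frame_extend hcub hcut (Y := {a, b, c, d, wa, wc})
      (σ := fun v => if v = a then b else if v = b then a else if v = c then d else
        if v = d then c else if v = wa then wc else wa)
      (by
        intro v hv
        simp only [Finset.mem_insert, Finset.mem_singleton] at hv
        rcases hv with rfl | rfl | rfl | rfl | rfl | rfl
        · simp [hab.ne.symm, hab]
        · simp [hab.ne.symm, hab.symm]
        · simp [hac.symm, hbc.ne.symm, hbd.symm, hda.ne, hcd.ne.symm, hcd]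
        · simp [hac.symm, hbc.ne.symm, hbd.symm, hda.ne, hcd.ne.symm, hcd.symm]
        · simp [awa.ne.symm, wab, wac, wad, wca, wcb, wcd, cwc.ne.symm, hww.symm, hadj]
        · simp [awa.ne.symm, wab, wac, wad, wca, wcb, wcd, cwc.ne.symm, hww.symm, hadj.symm])
      ((card_bd_le hcub (T := {b, d, wa, wc}) (k := 1)
        (by
          intro v hv hvT u hu
          simp only [Finset.mem_insert, Finset.mem_singleton, not_or] at hv hvT ⊢
          rcases hv with rfl | rfl | rfl | rfl | rfl | rfl
          · rcases eq_of_adj_three (hcub v) hab hda.symm awa hbd wab.symm wad.symm hu with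
              h | h | h <;> simp [h]
          · exact absurd rfl hvT.1
          · rcases eq_of_adj_three (hcub v) hbc.symm hcd cwc hbd wcb.symm wcd.symm hu with
              h | h | h <;> simp [h]
          · exact absurd rfl hvT.2.1
          · exact absurd rfl hvT.2.2.1
          · exact absurd rfl hvT.2.2.2)
        (by
          intro v hv
          simp only [Finset.mem_insert, Finset.mem_singleton] at hv
          rcases hv with rfl | rfl | rfl | rfl
          · exact ⟨{a, c}, by intro; simp; tauto, by simpa using ⟨hab.symm, hbc⟩,
              by rw [Finset.card_pair hac]⟩
          · exact ⟨{a, c}, by intro; simp; tauto, by simpa using ⟨hda, hcd.symm⟩,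
              by rw [Finset.card_pair hac]⟩
          · exact ⟨{a, wc}, by intro; simp; tauto, by simpa using ⟨awa.symm, hadj⟩,
              by rw [Finset.card_pair wca.symm]⟩
          · exact ⟨{c, wa}, by intro; simp; tauto, by simpa using ⟨cwc.symm, hadj.symm⟩,
              by rw [Finset.card_pair wac.symm]⟩)).trans
        (by rw [mul_one]; exact Finset.card_le_four))
    refine key F ?_ ?_ (Or.inr (Or.inr ?_))
    · rw [hF a (by simp)]; simp
    · rw [hF c (by simp)]; simp [hac.symm, hbc.ne.symm]
    · rw [hF wa (by simp)]; simp [awa.ne.symm, wab, wac, wad]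
  · obtain ⟨F, hF, -⟩ := exists_frame_extend hcub hcut (Y := {a, b, c, d})
      (σ := fun v => if v = a then b else if v = b then a else if v = c then d else c)
      (by
        intro v hv
        simp only [Finset.mem_insert, Finset.mem_singleton] at hv
        rcases hv with rfl | rfl | rfl | rfl
        · simp [hab.ne.symm, hab]
        · simp [hab.ne.symm, hab.symm]
        · simp [hac.symm, hbc.ne.symm, hbd.symm, hda.ne, hcd.ne.symm, hcd]
        · simp [hac.symm, hbc.ne.symm, hbd.symm, hda.ne, hcd.ne.symm, hcd.symm])
      ((card_bd_le hcub (T := {a, b, c, d}) (k := 1) (fun v hv h => absurd hv h) (by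
        intro v hv
        simp only [Finset.mem_insert, Finset.mem_singleton] at hv
        rcases hv with rfl | rfl | rfl | rfl
        · exact ⟨{b, d}, by intro; simp; tauto, by simpa using ⟨hab, hda.symm⟩,
            by rw [Finset.card_pair hbd]⟩
        · exact ⟨{a, c}, by intro; simp; tauto, by simpa using ⟨hab.symm, hbc⟩,
            by rw [Finset.card_pair hac]⟩
        · exact ⟨{b, d}, by intro; simp; tauto, by simpa using ⟨hbc.symm, hcd⟩,
            by rw [Finset.card_pair hbd]⟩
        · exact ⟨{a, c}, by intro; simp; tauto, by simpa using ⟨hda, hcd.symm⟩,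
            by rw [Finset.card_pair hac]⟩)).trans
        (by rw [mul_one]; exact Finset.card_le_four))
    refine key F ?_ ?_ ?_
    · rw [hF a (by simp)]; simp
    · rw [hF c (by simp)]; simp [hac.symm, hbc.ne.symm]
    · by_cases h : wa = wc
      · exact Or.inl h
      · exact Or.inr (Or.inl fun h' => hw ⟨h, h'⟩)

theorem exists_good_of_cubic (hcub : ∀ v, (G.neighborSet v).ncard = 3)
    (hG : G.Connected)
    (hcut : ∀ A : Finset V, A.Nonempty → A ≠ Finset.univ → 2 ≤ (bd G A).card) :
    ∃ F : Frame G, F.Good := by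
  by_cases hcut3 : ∀ A : Finset V, A.Nonempty → A ≠ Finset.univ → 3 ≤ (bd G A).card
  swap
  · push Not at hcut3
    obtain ⟨A, h1, h2, hlt⟩ := hcut3
    exact exists_good_of_two_cut hcub hG hcut (le_antisymm (by omega) (hcut A h1 h2))
  by_cases h3 : ∀ x y z, G.Adj x y → G.Adj y z → ¬ G.Adj x z
  swap
  · push Not at h3
    obtain ⟨a, b, c, hab, hbc, hac⟩ := h3
    obtain ⟨F, hF, -⟩ := exists_frame_through hcub hcut hab
    refine ⟨F, F.good_of_triangle hG hab.ne hF ⟨hbc, ?_⟩ ⟨hac.symm, ?_⟩⟩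
    · rw [F.mt_eq_comm.1 hF]
      exact hac.ne.symm
    · intro h
      rw [eq_comm, F.mt_eq_comm, hF] at h
      exact hbc.ne h
  by_cases h4 : ∀ x y z w, G.Adj x y → G.Adj y z → G.Adj z w → G.Adj w x → x = z ∨ y = w
  swap
  · push Not at h4
    obtain ⟨a, b, c, d, hab, hbc, hcd, hda, hac, hbd⟩ := h4
    exact exists_good_of_fourCycle hcub hG hcut h3 hab hbc hcd hda hac hbd
  by_cases h5 : ∀ x y z w u, G.Adj x y → G.Adj y z → G.Adj z w → G.Adj w u → ¬ G.Adj u x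
  swap
  · push Not at h5
    obtain ⟨a, b, c, d, e, hab, hbc, hcd, hde, hea⟩ := h5
    obtain ⟨F, hF, -⟩ := exists_frame_through hcub hcut hab
    exact ⟨F, F.good_of_fiveCycle hG h3 h4 hF hab hbc hcd hde hea⟩
  obtain ⟨F, -, hm⟩ := exists_frame_extend hcub hcut (Y := ∅) (σ := id) (by simp)
    (by simp [bd])
  exact ⟨F, F.good_of_girth hG hm h3 h4 h5 hcut3⟩

end Cubic

theorem isPackingEC_iff {k : ℕ} {c : Sym2 V → Fin (k + 1)} : IsPackingEC G k c ↔
    (∀ a b d, G.Adj a b → G.Adj a d → b ≠ d → c s(a, b) ≠ c s(a, d)) ∧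
    ∀ a b d e, G.Adj a b → G.Adj b d → G.Adj d e → a ≠ d → b ≠ e →
      c s(a, b) = c s(d, e) → c s(a, b) = 0 := by
  constructor
  · intro h
    have h1 : ∀ a b d, G.Adj a b → G.Adj a d → b ≠ d → c s(a, b) ≠ c s(a, d) := by
      intro a b d hab had hbd heq
      have hne : s(a, b) ≠ s(a, d) := fun h' => hbd (Sym2.congr_right.1 h')
      by_cases h0 : c s(a, b) = 0
      · exact (h.1 a b a d hab had hne h0 (heq ▸ h0)).1 rfl
      · exact (h.2 a b a d hab had hne heq h0).1.1 rfl
    refine ⟨h1, fun a b d e hab hbd hde had hbe heq => ?_⟩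
    by_contra h0
    have hne : s(a, b) ≠ s(d, e) := fun h' => by
      rcases Sym2.eq_iff.1 h' with h' | h'
      · exact had h'.1
      · exact hbd.ne h'.2
    exact (h.2 a b d e hab hde hne heq h0).2.2.2.1 hbd
  · rintro ⟨h1, h2⟩
    have key : ∀ a b x y, G.Adj a b → G.Adj x y → s(a, b) ≠ s(x, y) →
        c s(a, b) = c s(x, y) → a ≠ x := by
      rintro a b x y hab hxy hne heq rfl
      exact h1 a b y hab hxy (fun h => hne (by rw [h])) heq
    have key4 : ∀ a b x y, G.Adj a b → G.Adj x y → s(a, b) ≠ s(x, y) →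
        c s(a, b) = c s(x, y) → a ≠ x ∧ a ≠ y ∧ b ≠ x ∧ b ≠ y := by
      intro a b x y hab hxy hne heq
      refine ⟨key a b x y hab hxy hne heq, key a b y x hab hxy.symm ?_ ?_,
        key b a x y hab.symm hxy ?_ ?_, key b a y x hab.symm hxy.symm ?_ ?_⟩ <;>
        simpa only [Sym2.eq_swap (a := b) (b := a), Sym2.eq_swap (a := y) (b := x)]
    refine ⟨fun a b x y hab hxy hne h0 h0' => key4 a b x y hab hxy hne (h0.trans h0'.symm),
      fun a b x y hab hxy hne heq h0 => ?_⟩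
    obtain ⟨k1, k2, k3, k4⟩ := key4 a b x y hab hxy hne heq
    have sw : c s(b, a) = c s(a, b) := by rw [Sym2.eq_swap]
    have sw' : c s(y, x) = c s(x, y) := by rw [Sym2.eq_swap]
    exact ⟨⟨k1, k2, k3, k4⟩,
      fun h => h0 (sw ▸ h2 b a x y hab.symm h hxy k3 k2 (sw.trans heq)),
      fun h => h0 (sw ▸ h2 b a y x hab.symm h hxy.symm k4 k1 (sw.trans (heq.trans sw'.symm))),
      fun h => h0 (h2 a b x y hab h hxy k1 k4 heq),
      fun h => h0 (h2 a b y x hab h hxy.symm k2 k3 (heq.trans sw'.symm))⟩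

theorem packing_comap {W : Type} {H : SimpleGraph W} {k : ℕ} {c : Sym2 W → Fin (k + 1)}
    (h : IsPackingEC H k c) (f : V → W) (hf : ∀ a b, G.Adj a b → H.Adj (f a) (f b))
    (hinj : ∀ a b a' b', G.Adj a a' → G.Adj b b' → f a = f b → a = b) :
    IsPackingEC G k fun e => c (e.map f) := by
  rw [isPackingEC_iff] at h ⊢
  obtain ⟨h1, h2⟩ := h
  refine ⟨fun a b d hab had hbd => ?_, fun a b d e hab hbd hde had hbe => ?_⟩
  · exact h1 _ _ _ (hf _ _ hab) (hf _ _ had) fun h => hbd (hinj _ _ _ _ hab.symm had.symm h)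
  · exact h2 _ _ _ _ (hf _ _ hab) (hf _ _ hbd) (hf _ _ hde)
      (fun h => had (hinj _ _ _ _ hab hde h)) fun h => hbe (hinj _ _ _ _ hbd hde.symm h)

theorem packing_perm {k : ℕ} {c : Sym2 V → Fin (k + 1)} (h : IsPackingEC G k c)
    {π : Equiv.Perm (Fin (k + 1))} (hπ : π 0 = 0) : IsPackingEC G k fun e => π (c e) := by
  rw [isPackingEC_iff] at h ⊢
  refine ⟨fun a b d hab had hbd heq => h.1 a b d hab had hbd (π.injective heq),
    fun a b d e hab hbd hde had hbe heq => ?_⟩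
  rw [h.2 a b d e hab hbd hde had hbe (π.injective heq), hπ]

/-- The subgraph of the edges inside `A`. -/
def inner (G : SimpleGraph V) (A : Set V) : SimpleGraph V where
  Adj u v := G.Adj u v ∧ u ∈ A ∧ v ∈ A
  symm := ⟨fun _ _ h => ⟨h.1.symm, h.2.2, h.2.1⟩⟩
  loopless := ⟨fun _ h => h.1.ne rfl⟩

/-- Colourings of the two sides of a cut with at most one edge `xy` glue together if the colours
near `x` and `y` are compatible. -/
theorem exists_glue {A : Set V} {x y : V} (hx : x ∈ A) (hy : y ∉ A)
    (hcr : ∀ u w, u ∈ A → w ∉ A → G.Adj u w → u = x ∧ w = y) {cA cB : Sym2 V → Fin 8}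
    (hA : IsPackingEC (inner G A) 7 cA) (hB : IsPackingEC (inner G Aᶜ) 7 cB) {z : Fin 8}
    (hz : G.Adj x y → z ≠ 0 ∧
      (∀ u v, G.Adj x u → u ∈ A → G.Adj u v → v ∈ A → cA s(u, v) ≠ z) ∧
      (∀ u v, G.Adj y u → u ∉ A → G.Adj u v → v ∉ A → cB s(u, v) ≠ z) ∧
      ∀ u v, G.Adj x u → u ∈ A → G.Adj y v → v ∉ A → cA s(x, u) = cB s(y, v) →
        cA s(x, u) = 0) : ∃ c : Sym2 V → Fin 8, IsPackingEC G 7 c := by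
  let c : Sym2 V → Fin 8 := fun e => if ∀ v ∈ e, v ∈ A then cA e else
    if ∀ v ∈ e, v ∉ A then cB e else z
  have cAA : ∀ u v, u ∈ A → v ∈ A → c s(u, v) = cA s(u, v) := fun u v hu hv => by
    simp [c, hu, hv]
  have cBB : ∀ u v, u ∉ A → v ∉ A → c s(u, v) = cB s(u, v) := fun u v hu hv => by
    simp [c, hu, hv]
  have cAB : ∀ u v, u ∈ A → v ∉ A → c s(u, v) = z := fun u v hu hv => by
    simp [c, hu, hv]
  have cBA : ∀ u v, u ∉ A → v ∈ A → c s(u, v) = z := fun u v hu hv => by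
    simp [c, hu, hv]
  have hcr' : ∀ u w, u ∉ A → w ∈ A → G.Adj u w → u = y ∧ w = x := fun u w hu hw h =>
    (hcr w u hw hu h.symm).symm
  rw [isPackingEC_iff] at hA hB
  obtain ⟨hA1, hA2⟩ := hA
  obtain ⟨hB1, hB2⟩ := hB
  have hsw : ∀ (f : Sym2 V → Fin 8) u v, f s(u, v) = f s(v, u) := fun f u v => by
    rw [Sym2.eq_swap]
  refine ⟨c, isPackingEC_iff.2 ⟨?_, ?_⟩⟩
  · intro a b d hab had hbd
    by_cases ha : a ∈ A <;> by_cases hb : b ∈ A <;> by_cases hd : d ∈ A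
    · rw [cAA a b ha hb, cAA a d ha hd]
      exact hA1 a b d ⟨hab, ha, hb⟩ ⟨had, ha, hd⟩ hbd
    · rw [cAA a b ha hb, cAB a d ha hd]
      obtain ⟨rfl, rfl⟩ := hcr a d ha hd had
      rw [hsw cA a b]
      exact (hz had).2.1 b a hab hb hab.symm ha
    · rw [cAB a b ha hb, cAA a d ha hd]
      obtain ⟨rfl, rfl⟩ := hcr a b ha hb hab
      rw [hsw cA a d]
      exact ((hz hab).2.1 d a had hd had.symm ha).symm
    · exact absurd ((hcr a b ha hb hab).2.trans (hcr a d ha hd had).2.symm) hbd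
    · exact absurd ((hcr' a b ha hb hab).2.trans (hcr' a d ha hd had).2.symm) hbd
    · rw [cBA a b ha hb, cBB a d ha hd]
      obtain ⟨rfl, rfl⟩ := hcr' a b ha hb hab
      rw [hsw cB a d]
      exact ((hz hab.symm).2.2.1 d a had hd had.symm ha).symm
    · rw [cBB a b ha hb, cBA a d ha hd]
      obtain ⟨rfl, rfl⟩ := hcr' a d ha hd had
      rw [hsw cB a b]
      exact (hz had.symm).2.2.1 b a hab hb hab.symm ha
    · rw [cBB a b ha hb, cBB a d ha hd]
      exact hB1 a b d ⟨hab, ha, hb⟩ ⟨had, ha, hd⟩ hbd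
  · intro a b d e hab hbd hde had hbe heq
    by_cases hb : b ∈ A <;> by_cases hd : d ∈ A
    · by_cases ha : a ∈ A <;> by_cases he : e ∈ A
      · rw [cAA a b ha hb] at heq ⊢
        rw [cAA d e hd he] at heq
        exact hA2 a b d e ⟨hab, ha, hb⟩ ⟨hbd, hb, hd⟩ ⟨hde, hd, he⟩ had hbe heq
      · rw [cAA a b ha hb, cAB d e hd he, hsw cA a b] at heq
        obtain ⟨rfl, rfl⟩ := hcr d e hd he hde
        exact absurd heq ((hz hde).2.1 b a hbd.symm hb hab.symm ha)
      · rw [cBA a b ha hb, cAA d e hd he] at heq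
        obtain ⟨rfl, rfl⟩ := hcr' a b ha hb hab
        exact absurd heq.symm ((hz hab.symm).2.1 d e hbd hd hde he)
      · exact absurd ((hcr' a b ha hb hab).2.trans (hcr d e hd he hde).1.symm) hbd.ne
    · obtain ⟨rfl, rfl⟩ := hcr b d hb hd hbd
      have ha : a ∈ A := by
        by_contra ha
        exact had (hcr b a hb ha hab.symm).2
      have he : e ∉ A := fun he => hbe (hcr' d e hd he hde).2.symm
      rw [cAA a b ha hb, hsw cA a b] at heq ⊢
      rw [cBB d e hd he] at heq
      exact (hz hbd).2.2.2 a e hab.symm ha hde he heq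
    · obtain ⟨rfl, rfl⟩ := hcr' b d hb hd hbd
      have ha : a ∉ A := fun ha => had (hcr' b a hb ha hab.symm).2
      have he : e ∈ A := by
        by_contra he
        exact hbe (hcr d e hd he hde).2.symm
      rw [heq]
      rw [cBB a b ha hb, hsw cB a b, cAA d e hd he] at heq
      rw [cAA d e hd he]
      exact (hz hbd.symm).2.2.2 e a hde he hab.symm ha heq.symm
    · by_cases ha : a ∈ A <;> by_cases he : e ∈ A
      · exact absurd ((hcr a b ha hb hab).2.trans (hcr' d e hd he hde).1.symm) hbd.ne
      · rw [cAB a b ha hb, cBB d e hd he] at heq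
        obtain ⟨rfl, rfl⟩ := hcr a b ha hb hab
        exact absurd heq.symm ((hz hab).2.2.1 d e hbd hd hde he)
      · rw [cBB a b ha hb, cBA d e hd he, hsw cB a b] at heq
        obtain ⟨rfl, rfl⟩ := hcr' d e hd he hde
        exact absurd heq ((hz hde.symm).2.2.1 b a hbd.symm hb hab.symm ha)
      · rw [cBB a b ha hb] at heq ⊢
        rw [cBB d e hd he] at heq
        exact hB2 a b d e ⟨hab, ha, hb⟩ ⟨hbd, hb, hd⟩ ⟨hde, hd, he⟩ had hbe heq

theorem exists_perm_fixing {z : Fin 8} {S : Finset (Fin 8)} (hS : S.card ≤ 2)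
    (T : Finset (Fin 8)) (hT : T.card ≤ 2) (h0 : 0 ∉ T) (hz : z ∉ T) :
    ∃ π : Equiv.Perm (Fin 8), π 0 = 0 ∧ π z = z ∧ ∀ t ∈ T, π t ∉ S := by
  induction T using Finset.induction_on with
  | empty => exact ⟨1, rfl, rfl, by simp⟩
  | insert b T hb ih =>
    rw [Finset.card_insert_of_notMem hb] at hT
    simp only [Finset.mem_insert, not_or] at h0 hz
    obtain ⟨π, p0, pz, hπ⟩ := ih (by omega) h0.2 hz.2
    obtain ⟨t, -, ht⟩ := Finset.exists_mem_notMem_of_card_lt_card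
      (s := S ∪ T.image π ∪ {0, z}) (t := Finset.univ) (by
        have h1 := Finset.card_union_le (S ∪ T.image π) {0, z}
        have h2 := Finset.card_union_le S (T.image π)
        have h3 : (T.image π).card ≤ T.card := Finset.card_image_le
        have h4 := Finset.card_le_two (a := (0 : Fin 8)) (b := z)
        rw [Finset.card_univ, Fintype.card_fin]
        omega)
    simp only [Finset.mem_union, Finset.mem_insert, Finset.mem_singleton, not_or] at ht
    refine ⟨Equiv.swap (π b) t * π, ?_, ?_, ?_⟩
    · rw [Equiv.Perm.mul_apply, p0, Equiv.swap_apply_of_ne_of_ne _ (Ne.symm ht.2.1)]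
      rw [← p0]
      exact fun h => h0.1 (π.injective h)
    · rw [Equiv.Perm.mul_apply, pz, Equiv.swap_apply_of_ne_of_ne _ (Ne.symm ht.2.2)]
      conv_lhs => rw [← pz]
      exact fun h => hz.1 (π.injective h)
    · intro s hs
      rw [Equiv.Perm.mul_apply]
      rcases Finset.mem_insert.1 hs with rfl | hs
      · rw [Equiv.swap_apply_left]
        exact ht.1.1
      · rw [Equiv.swap_apply_of_ne_of_ne]
        · exact hπ s hs
        · intro h
          rw [π.injective h] at hs
          exact hb hs
        · intro h
          exact ht.1.2 (Finset.mem_image.2 ⟨s, hs, h⟩)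

/-- The colours near `x` on one side of a cut leave a nonzero colour for a bridge at `x`. -/
theorem exists_bridge_colour [Finite V] (hsub : Subcubic G) {A : Set V} {x y : V}
    (hxy : G.Adj x y) (hy : y ∉ A) (c : Sym2 V → Fin 8) :
    ∃ (z : Fin 8) (S : Finset (Fin 8)), z ≠ 0 ∧ S.card ≤ 2 ∧ z ∉ S ∧ 0 ∉ S ∧
      (∀ u v, G.Adj x u → u ∈ A → G.Adj u v → v ∈ A → c s(u, v) ≠ z) ∧
      ∀ u, G.Adj x u → u ∈ A → c s(x, u) ≠ 0 → x ∈ A → c s(x, u) ∈ S := by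
  have := Fintype.ofFinite V
  have hdeg : ∀ v, (G.neighborSet v).toFinset.card ≤ 3 := fun v => by
    rw [← Set.ncard_eq_toFinset_card']
    exact hsub v
  let N := (G.neighborSet x).toFinset.erase y
  have hN : N.card ≤ 2 := by
    have := hdeg x
    rw [Finset.card_erase_of_mem (by simpa using hxy)]
    omega
  have hmem : ∀ u, G.Adj x u → u ∈ A → u ∈ N := fun u hu huA =>
    Finset.mem_erase.2 ⟨fun h => hy (h ▸ huA), by simpa using hu⟩
  let B := N.biUnion fun u => (G.neighborSet u).toFinset.image fun v => c s(u, v)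
  have hB : B.card ≤ 6 := by
    refine (Finset.card_biUnion_le_card_mul _ _ 3 fun u _ =>
      Finset.card_image_le.trans (hdeg u)).trans ?_
    omega
  have hcB : ∀ u v, G.Adj x u → u ∈ A → G.Adj u v → c s(u, v) ∈ B := fun u v hu huA huv =>
    Finset.mem_biUnion.2 ⟨u, hmem u hu huA, Finset.mem_image.2 ⟨v, by simpa using huv, rfl⟩⟩
  obtain ⟨z, -, hz⟩ := Finset.exists_mem_notMem_of_card_lt_card
    (s := insert 0 B) (t := Finset.univ) (by
      have := Finset.card_insert_le 0 B
      rw [Finset.card_univ, Fintype.card_fin]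
      omega)
  simp only [Finset.mem_insert, not_or] at hz
  refine ⟨z, (N.image fun u => c s(x, u)).filter fun t => t ≠ 0 ∧ t ≠ z, hz.1,
    (Finset.card_filter_le _ _).trans (Finset.card_image_le.trans hN), by simp, by simp,
    fun u v hu huA huv _ h => hz.2 (h ▸ hcB u v hu huA huv), fun u hu huA h0 hxA => ?_⟩
  refine Finset.mem_filter.2 ⟨Finset.mem_image.2 ⟨u, hmem u hu huA, rfl⟩, h0, fun h => hz.2 ?_⟩
  rw [← h, Sym2.eq_swap]
  exact hcB u x hu huA hu.symm

theorem packing_of_cut [Finite V] (hsub : Subcubic G) {A : Set V} {x y : V} (hx : x ∈ A)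
    (hy : y ∉ A) (hcr : ∀ u w, u ∈ A → w ∉ A → G.Adj u w → u = x ∧ w = y)
    (hA : ∃ c : Sym2 V → Fin 8, IsPackingEC (inner G A) 7 c)
    (hB : ∃ c : Sym2 V → Fin 8, IsPackingEC (inner G Aᶜ) 7 c) :
    ∃ c : Sym2 V → Fin 8, IsPackingEC G 7 c := by
  obtain ⟨cA, hA⟩ := hA
  obtain ⟨cB, hB⟩ := hB
  by_cases hxy : G.Adj x y
  swap
  · exact exists_glue (z := 0) hx hy hcr hA hB fun h => absurd h hxy
  obtain ⟨z, S, z0, hS, -, -, hzA, hSA⟩ := exists_bridge_colour hsub (A := A) hxy hy cA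
  obtain ⟨z', T, z0', hT, hzT, h0T, hzB, hTB⟩ :=
    exists_bridge_colour hsub (A := Aᶜ) hxy.symm (fun h => h hx) cB
  obtain ⟨π, p0, pz, hπ⟩ := exists_perm_fixing (z := z) hS (T.image (Equiv.swap z' z))
    (Finset.card_image_le.trans hT)
    (by
      rw [Finset.mem_image]
      rintro ⟨t, ht, h⟩
      rw [Equiv.swap_apply_eq_iff, Equiv.swap_apply_of_ne_of_ne z0'.symm z0.symm] at h
      exact h0T (h ▸ ht))
    (by
      rw [Finset.mem_image]
      rintro ⟨t, ht, h⟩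
      rw [Equiv.swap_apply_eq_iff, Equiv.swap_apply_right] at h
      exact hzT (h ▸ ht))
  have h0 : (π * Equiv.swap z' z) 0 = 0 := by
    rw [Equiv.Perm.mul_apply, Equiv.swap_apply_of_ne_of_ne z0'.symm z0.symm, p0]
  have hz : (π * Equiv.swap z' z) z' = z := by
    rw [Equiv.Perm.mul_apply, Equiv.swap_apply_left, pz]
  refine exists_glue (z := z) hx hy hcr hA (packing_perm hB h0) fun _ => ⟨z0, hzA, ?_, ?_⟩
  · intro u v hu huA huv hvA h
    exact hzB u v hu huA huv hvA ((π * Equiv.swap z' z).injective (h.trans hz.symm))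
  · intro u v hu huA hv hvA h
    by_contra hne
    have hne' : cB s(y, v) ≠ 0 := fun h' => by
      rw [h', h0] at h
      exact hne h
    refine hπ _ (Finset.mem_image_of_mem _ (hTB v hv hvA hne' hy)) ?_
    rw [← Equiv.Perm.mul_apply, ← h]
    exact hSA u hu huA hne hx

theorem packing_of_card_le [Finite V] (h : Nat.card V ≤ 3) :
    ∃ c : Sym2 V → Fin 8, IsPackingEC G 7 c := by
  have := Fintype.ofFinite V
  have hc : Fintype.card (Sym2 V) ≤ Fintype.card (Fin 8) := by
    rw [Sym2.card, Fintype.card_fin]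
    rw [Nat.card_eq_fintype_card] at h
    calc (Fintype.card V + 1).choose 2 ≤ (3 + 1).choose 2 := Nat.choose_le_choose 2 (by omega)
      _ ≤ 8 := by decide
  obtain ⟨f⟩ := Function.Embedding.nonempty_of_card_le hc
  exact ⟨f, fun a b x y _ _ hne h h' => absurd (f.injective (h.trans h'.symm)) hne,
    fun a b x y _ _ hne h _ => absurd (f.injective h) hne⟩

theorem packing_inner [Finite V] (hsub : Subcubic G) {A : Set V} {x : V} (hx : x ∈ A)
    (ih : Subcubic (G.induce A) → ∃ c : Sym2 A → Fin 8, IsPackingEC (G.induce A) 7 c) :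
    ∃ c : Sym2 V → Fin 8, IsPackingEC (inner G A) 7 c := by
  obtain ⟨c, hc⟩ := ih fun v => by
    refine le_trans ?_ (hsub v)
    refine Set.ncard_le_ncard_of_injOn Subtype.val (fun w hw => hw)
      Subtype.val_injective.injOn (Set.toFinite _)
  refine ⟨_, packing_comap hc (fun v => if h : v ∈ A then ⟨v, h⟩ else ⟨x, hx⟩) ?_ ?_⟩
  · rintro a b ⟨hab, ha, hb⟩
    simpa [ha, hb] using hab
  · rintro a b a' b' ⟨-, ha, -⟩ ⟨-, hb, -⟩ h
    simpa [ha, hb] using h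

theorem connected_of_cut [Fintype V] [Nonempty V]
    (hcut : ∀ A : Finset V, A.Nonempty → A ≠ Finset.univ → 2 ≤ (bd G A).card) :
    G.Connected := by
  refine ⟨fun u v => ?_⟩
  by_contra hv
  have := hcut (Finset.univ.filter fun w => G.Reachable u w)
    ⟨u, by simp⟩ (fun h => by
      have := Finset.mem_univ v
      rw [← h, Finset.mem_filter] at this
      exact hv this.2)
  have h0 : bd G ((Finset.univ.filter fun w => G.Reachable u w : Finset V) : Set V) = ∅ := by
    refine Finset.eq_empty_of_forall_notMem fun p hp => ?_
    rw [mem_bd] at hp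
    obtain ⟨h1, h2, h3⟩ := hp
    simp only [Finset.coe_filter, Finset.mem_univ, true_and, Set.mem_ofPred_eq] at h1 h2
    exact h2 (h1.trans h3.reachable)
  rw [h0] at this
  simp at this

theorem exists_maximal_subcubic [Finite V] (hsub : Subcubic G) :
    ∃ H : SimpleGraph V, G ≤ H ∧ Subcubic H ∧
      ∀ u v, u ≠ v → (H.neighborSet u).ncard ≤ 2 → (H.neighborSet v).ncard ≤ 2 → H.Adj u v := by
  obtain ⟨H, hGH, hH, hmax⟩ :=
    (Set.toFinite {H : SimpleGraph V | Subcubic H}).exists_le_maximal hsub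
  refine ⟨H, hGH, hH, fun u v huv hu hv => ?_⟩
  have hsub' : Subcubic (H ⊔ SimpleGraph.edge u v) := by
    intro w
    by_cases hwu : w = u
    · subst hwu
      have : (H ⊔ SimpleGraph.edge w v).neighborSet w ⊆ insert v (H.neighborSet w) := by
        intro t ht
        simp only [SimpleGraph.mem_neighborSet, SimpleGraph.sup_adj, SimpleGraph.edge_adj] at ht
        rcases ht with h | ⟨h | h, -⟩
        · exact Or.inr h
        · exact Or.inl h.2
        · exact absurd h.1.symm huv.symm
      refine (Set.ncard_le_ncard this).trans ((Set.ncard_insert_le _ _).trans (by omega))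
    by_cases hwv : w = v
    · subst hwv
      have : (H ⊔ SimpleGraph.edge u w).neighborSet w ⊆ insert u (H.neighborSet w) := by
        intro t ht
        simp only [SimpleGraph.mem_neighborSet, SimpleGraph.sup_adj, SimpleGraph.edge_adj] at ht
        rcases ht with h | ⟨h | h, -⟩
        · exact Or.inr h
        · exact absurd h.1 hwu
        · exact Or.inl h.2
      refine (Set.ncard_le_ncard this).trans ((Set.ncard_insert_le _ _).trans (by omega))
    · refine (Set.ncard_le_ncard (t := H.neighborSet w) ?_).trans (hH w)
      intro t ht
      simp only [SimpleGraph.mem_neighborSet, SimpleGraph.sup_adj, SimpleGraph.edge_adj] at ht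
      rcases ht with h | ⟨h | h, -⟩
      · exact h
      · exact absurd h.1 hwu
      · exact absurd h.1 hwv
  have hle : H ⊔ SimpleGraph.edge u v ≤ H := hmax hsub' le_sup_left
  exact hle (Or.inr ((SimpleGraph.edge_adj u v u v).2 ⟨Or.inl ⟨rfl, rfl⟩, huv⟩))

/-- A graph with one or two vertices of degree 2 and no small cuts. -/
theorem exists_good_of_degree_two [Fintype V] (hG : G.Connected)
    (hcut : ∀ A : Finset V, A.Nonempty → A ≠ Finset.univ → 2 ≤ (bd G A).card)
    {Y : Finset V} (hY : Y.Nonempty) (hcard : Y.card ≤ 2)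
    (h2 : ∀ v ∈ Y, (G.neighborSet v).ncard = 2) (h3 : ∀ v ∉ Y, (G.neighborSet v).ncard = 3) :
    ∃ F : Frame G, F.Good := by
  have hpY := card_pairs_eq G h2
  have hpC := card_pairs_eq G (A := Yᶜ) fun v hv => h3 v (Finset.mem_compl.1 hv)
  have heven := even_card_inner G Set.univ
  have hsplit : (Finset.univ.filter fun p : V × V =>
        p.1 ∈ (Set.univ : Set V) ∧ p.2 ∈ (Set.univ : Set V) ∧ G.Adj p.1 p.2).card =
      (Finset.univ.filter fun p : V × V => p.1 ∈ Y ∧ G.Adj p.1 p.2).card +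
      (Finset.univ.filter fun p : V × V => p.1 ∈ Yᶜ ∧ G.Adj p.1 p.2).card := by
    rw [← Finset.card_union_of_disjoint]
    · congr 1
      ext p
      simp only [Set.mem_univ, true_and, Finset.mem_union, Finset.mem_filter, Finset.mem_univ,
        Finset.mem_compl]
      tauto
    · rw [Finset.disjoint_left]
      intro p hp hp'
      simp only [Finset.mem_filter, Finset.mem_compl] at hp hp'
      exact hp'.2.1 hp.2.1
  have heven : Even (2 * Y.card + 3 * Yᶜ.card) := by
    rw [← hpY, ← hpC, ← hsplit]
    convert heven
  have hevenC : Even Yᶜ.card := by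
    rw [Nat.even_iff] at heven ⊢
    omega
  have hbd : (bd G Y).card ≤ 4 := by
    have : (bd G Y).card ≤ (Finset.univ.filter fun p : V × V => p.1 ∈ Y ∧ G.Adj p.1 p.2).card :=
      Finset.card_le_card fun p hp => by
        rw [mem_bd] at hp
        exact Finset.mem_filter.2 ⟨Finset.mem_univ _, hp.1, hp.2.2⟩
    omega
  obtain ⟨m, m1, m2, m3⟩ := exists_matching_compl G h3 hevenC hcut hbd
  obtain ⟨F, rfl⟩ := exists_frame (G := G) m1
    (fun v hv => m3 v fun h => hv (m2 v h))
    (fun v => by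
      by_cases hv : v ∈ Y
      · rw [m2 v hv, Set.sdiff_singleton_eq_self, h2 v hv]
        exact fun h => (SimpleGraph.irrefl G) h
      · rw [Set.ncard_sdiff_singleton_of_mem
          ((SimpleGraph.mem_neighborSet _ _ _).2 (m3 v hv)), h3 v hv])
  obtain ⟨x, hx⟩ := hY
  exact ⟨F, F.good_of_mt_eq hG (m2 x hx)⟩

/-- The reduction to connected graphs without bridges in which vertices of degree at most 2 are
pairwise adjacent. -/
theorem packing_of_cut_or_adj [Fintype V] (hsub : Subcubic G) (h4 : 4 ≤ Fintype.card V)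
    (hadj : ∀ u v, u ≠ v → (G.neighborSet u).ncard ≤ 2 → (G.neighborSet v).ncard ≤ 2 → G.Adj u v)
    (hcut : ∀ A : Finset V, A.Nonempty → A ≠ Finset.univ → 2 ≤ (bd G A).card) :
    ∃ c : Sym2 V → Fin 8, IsPackingEC G 7 c := by
  have : Nonempty V := Fintype.card_pos_iff.1 (by omega)
  have hG := connected_of_cut hcut
  have hne : ∀ A : Finset V, A.card ≤ 3 → A ≠ Finset.univ := by
    rintro A hA rfl
    rw [Finset.card_univ] at hA
    omega
  have hdeg : ∀ v, 2 ≤ (G.neighborSet v).ncard := by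
    intro v
    have h := hcut {v} ⟨v, by simp⟩ (hne _ (by simp))
    refine h.trans ?_
    rw [Set.ncard_eq_toFinset_card']
    refine Finset.card_le_card_of_injOn Prod.snd ?_ ?_
    · intro p hp
      obtain ⟨h1, -, h3⟩ := (mem_bd G).1 hp
      simp only [Finset.coe_singleton, Set.mem_singleton_iff] at h1
      rw [h1] at h3
      simpa using h3
    · intro p hp p' hp' h
      have h1 := ((mem_bd G).1 hp).1
      have h2 := ((mem_bd G).1 hp').1
      simp only [Finset.coe_singleton, Set.mem_singleton_iff] at h1 h2
      exact Prod.ext (h1.trans h2.symm) h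
  let Y : Finset V := Finset.univ.filter fun v => (G.neighborSet v).ncard = 2
  have hY : ∀ v, v ∈ Y ↔ (G.neighborSet v).ncard = 2 := fun v => by simp [Y]
  have h3 : ∀ v ∉ Y, (G.neighborSet v).ncard = 3 := fun v hv => by
    rw [hY] at hv
    have := hsub v
    have := hdeg v
    omega
  suffices h : ∃ F : Frame G, F.Good from h.elim fun F hF => hF.packing
  rcases Y.eq_empty_or_nonempty with hY0 | hYne
  · exact exists_good_of_cubic (fun v => h3 v (by simp [hY0])) hG hcut
  refine exists_good_of_degree_two hG hcut hYne ?_ (fun v hv => (hY v).1 hv) h3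
  by_contra hgt
  obtain ⟨a, ha, b, hb, c, hc, hab, hac, hbc⟩ := Finset.two_lt_card.1 (not_le.1 hgt)
  rw [hY] at ha hb hc
  have eab := hadj a b hab ha.le hb.le
  have eac := hadj a c hac ha.le hc.le
  have ebc := hadj b c hbc hb.le hc.le
  have two : ∀ v x y w, (G.neighborSet v).ncard = 2 → G.Adj v x → G.Adj v y → x ≠ y →
      G.Adj v w → w = x ∨ w = y := by
    intro v x y w hv hx hy hxy hw
    have hs : ({x, y} : Set V) ⊆ G.neighborSet v := by
      rintro t (rfl | rfl) <;> assumption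
    have heq := Set.eq_of_subset_of_ncard_le hs (by rw [hv, Set.ncard_pair hxy])
    have : w ∈ ({x, y} : Set V) := heq ▸ hw
    simpa using this
  have h := hcut {a, b, c} ⟨a, by simp⟩ (hne _ Finset.card_le_three)
  have h0 : bd G (({a, b, c} : Finset V) : Set V) = ∅ := by
    refine Finset.eq_empty_of_forall_notMem fun p hp => ?_
    obtain ⟨h1, h2, h3⟩ := (mem_bd G).1 hp
    simp only [Finset.mem_coe, Finset.mem_insert, Finset.mem_singleton, not_or] at h1 h2
    rcases h1 with h1 | h1 | h1 <;> rw [h1] at h3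
    · rcases two a b c _ ha eab eac hbc h3 with h' | h'
      · exact h2.2.1 h'
      · exact h2.2.2 h'
    · rcases two b a c _ hb eab.symm ebc hac h3 with h' | h'
      · exact h2.1 h'
      · exact h2.2.2 h'
    · rcases two c a b _ hc eac.symm ebc.symm hab h3 with h' | h'
      · exact h2.1 h'
      · exact h2.2.1 h'
  rw [h0] at h
  simp at h

theorem packing_of_subcubic (n : ℕ) : ∀ (V : Type) [Finite V] (G : SimpleGraph V), Nat.card V = n →
    Subcubic G → ∃ c : Sym2 V → Fin 8, IsPackingEC G 7 c := by
  induction n using Nat.strong_induction_on with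
  | _ n ih =>
  intro V _ G hn hG
  obtain ⟨H, hGH, hH, hmax⟩ := exists_maximal_subcubic hG
  suffices h : ∃ c : Sym2 V → Fin 8, IsPackingEC H 7 c by
    obtain ⟨c, hc⟩ := h
    exact ⟨_, packing_comap hc id (fun a b hab => hGH hab) fun _ _ _ _ _ _ h => h⟩
  by_cases h3 : Nat.card V ≤ 3
  · exact packing_of_card_le h3
  have := Fintype.ofFinite V
  by_cases hcut : ∀ A : Finset V, A.Nonempty → A ≠ Finset.univ → 2 ≤ (bd H A).card
  · exact packing_of_cut_or_adj hH (by rw [← Nat.card_eq_fintype_card]; omega) hmax hcut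
  push Not at hcut
  obtain ⟨A, ⟨x₀, hx₀⟩, hAne, hlt⟩ := hcut
  obtain ⟨y₀, hy₀⟩ : ∃ y, y ∉ A := by
    by_contra! h
    exact hAne (Finset.eq_univ_of_forall h)
  have hcr : ∃ x y, x ∈ (A : Set V) ∧ y ∉ (A : Set V) ∧
      ∀ u w, u ∈ (A : Set V) → w ∉ (A : Set V) → H.Adj u w → u = x ∧ w = y := by
    rcases (bd H A).eq_empty_or_nonempty with h0 | ⟨⟨x, y⟩, hxy⟩
    · refine ⟨x₀, y₀, hx₀, hy₀, fun u w hu hw huw => ?_⟩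
      have : (u, w) ∈ bd H (A : Set V) := (mem_bd H).2 ⟨hu, hw, huw⟩
      rw [h0] at this
      simp at this
    · have h1 := (mem_bd H).1 hxy
      refine ⟨x, y, h1.1, h1.2.1, fun u w hu hw huw => ?_⟩
      have : (u, w) = (x, y) := Finset.card_le_one.1 (by omega) _
        ((mem_bd H).2 ⟨hu, hw, huw⟩) _ hxy
      exact Prod.ext_iff.1 this
  obtain ⟨x, y, hx, hy, hcr⟩ := hcr
  have hlt : ∀ (B : Set V) (v : V), v ∉ B → Nat.card B < n := fun B v hv => by
    rw [← hn, ← Set.ncard_univ V, Nat.card_coe_set_eq]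
    exact Set.ncard_lt_ncard ⟨Set.subset_univ B, fun h => hv (h (Set.mem_univ v))⟩
  exact packing_of_cut hH hx hy hcr
    (packing_inner hH hx (ih _ (hlt (A : Set V) y hy) _ (H.induce (A : Set V)) rfl))
    (packing_inner hH (A := (A : Set V)ᶜ) hy
      (ih _ (hlt ((A : Set V)ᶜ) x (fun h => h hx)) _ (H.induce ((A : Set V)ᶜ)) rfl))

end PackingEC

/-- Every finite subcubic simple graph admits a `(1,2^7)`-packing edge-coloring. -/
theorem subcubic_packing_coloring {V : Type} [Finite V] (G : SimpleGraph V)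
    (hG : Subcubic G) :
    ∃ c : Sym2 V → Fin 8, IsPackingEC G 7 c := by
  exact PackingEC.packing_of_subcubic _ V G rfl hG
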